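/- arXiv:2604.04752 — 2 statements merged into one kernel-verified Lean document; each statement's English description precedes it below -/
import Mathlib

section
/- For every integer k ≥ 1 there exists a constant C such that for every n ≥ 3, every directed graph G on n vertices with positive integer edge lengths at most n^k, every 0 < ε < 1, and every 0 < δ < 1/2, there exists a (1+ε)-distance-preserving DAG projection of G whose width is at most ((log₂ n)^C / ε)^{(log₂ n)^δ} · n^{1/(log₂ n)^δ}. -/
open scoped Classical ENNReal

/-- `IsWalk E s t l`: `l` is the list of successive vertices (after `s`) of a
directed walk from `s` to `t` in the graph with edge relation `E`. -/
def IsWalk {V : Type*} (E : V → V → Prop) : V → V → List V → Prop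
  | s, t, [] => s = t
  | s, t, v :: rest => E s v ∧ IsWalk E v t rest

/-- Total length of the walk starting at `s` with successive vertices `l`. -/
def walkLen {V : Type*} (ℓ : V → V → ℕ) : V → List V → ℕ
  | _, [] => 0
  | s, v :: rest => ℓ s v + walkLen ℓ v rest

/-- Shortest-path distance from `s` to `t` (`∞` if `t` is unreachable from `s`). -/
noncomputable def gdist {V : Type*} (E : V → V → Prop) (ℓ : V → V → ℕ) (s t : V) : ℝ≥0∞ :=
  ⨅ (l : List V) (_ : IsWalk E s t l), (walkLen ℓ s l : ℝ≥0∞)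

/-- Set-to-set shortest-path distance. -/
noncomputable def gdistSet {V : Type*} (E : V → V → Prop) (ℓ : V → V → ℕ)
    (A B : Set V) : ℝ≥0∞ :=
  ⨅ (a ∈ A) (b ∈ B), gdist E ℓ a b

/-- A directed graph is acyclic (a DAG). -/
def IsDag {V : Type*} (E : V → V → Prop) : Prop := ∀ x : V, ¬ Relation.TransGen E x x



namespace DP

section Walks
variable {V : Type*}

lemma isWalk_append {E : V → V → Prop} {u t : V} {l2 : List V} :
    ∀ {l1 : List V} {s : V}, IsWalk E s u l1 → IsWalk E u t l2 → IsWalk E s t (l1 ++ l2)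
  | [], s, h1, h2 => by
      have : s = u := h1
      subst this; simpa using h2
  | v :: r, s, h1, h2 => ⟨h1.1, isWalk_append h1.2 h2⟩

lemma walkLen_append {E : V → V → Prop} (ℓ : V → V → ℕ) {u : V} {l2 : List V} :
    ∀ {l1 : List V} {s : V}, IsWalk E s u l1 →
      walkLen ℓ s (l1 ++ l2) = walkLen ℓ s l1 + walkLen ℓ u l2
  | [], s, h1 => by
      have : s = u := h1
      subst this; simp [walkLen]
  | v :: r, s, h1 => by
      have := walkLen_append ℓ (l2 := l2) h1.2
      simp [walkLen, this, add_assoc]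

lemma isWalk_mono {E E' : V → V → Prop} (h : ∀ u v, E u v → E' u v) {t : V} :
    ∀ {l : List V} {s : V}, IsWalk E s t l → IsWalk E' s t l
  | [], _, h1 => h1
  | _ :: _, _, h1 => ⟨h _ _ h1.1, isWalk_mono h h1.2⟩

lemma isWalk_split {E : V → V → Prop} {t y : V} :
    ∀ {l : List V} {s : V}, IsWalk E s t l → y ∈ s :: l →
      ∃ l1 l2, l = l1 ++ l2 ∧ IsWalk E s y l1 ∧ IsWalk E y t l2 ∧ (y :: l2) <:+ (s :: l)
  | [], s, h1, hy => by
      have : y = s := by simpa using hy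
      subst this
      exact ⟨[], [], rfl, rfl, h1, List.suffix_refl _⟩
  | v :: r, s, h1, hy => by
      by_cases hs : y = s
      · subst hs
        exact ⟨[], v :: r, rfl, rfl, h1, List.suffix_refl _⟩
      · have hy' : y ∈ v :: r := by
          rcases List.mem_cons.1 hy with h | h
          · exact absurd h hs
          · exact h
        obtain ⟨l1, l2, e, w1, w2, hsuf⟩ := isWalk_split h1.2 hy'
        exact ⟨v :: l1, l2, by simp [e], ⟨h1.1, w1⟩, w2, hsuf.trans (List.suffix_cons _ _)⟩

lemma exists_simple {E : V → V → Prop} (ℓ : V → V → ℕ) {t : V} :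
    ∀ {l : List V} {s : V}, IsWalk E s t l →
      ∃ l', IsWalk E s t l' ∧ (s :: l').Nodup ∧ walkLen ℓ s l' ≤ walkLen ℓ s l
  | [], s, h1 => ⟨[], h1, by simp, le_rfl⟩
  | v :: r, s, h1 => by
      obtain ⟨l', w, nd, hl⟩ := exists_simple ℓ h1.2
      by_cases hs : s ∈ v :: l'
      · obtain ⟨l1, l2, e, w1, w2, hsuf⟩ := isWalk_split w hs
        refine ⟨l2, w2, nd.sublist hsuf.sublist, ?_⟩
        have := walkLen_append ℓ (l2 := l2) w1
        rw [← e] at this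
        simp only [walkLen]
        omega
      · exact ⟨v :: l', ⟨h1.1, w⟩, List.nodup_cons.2 ⟨hs, nd⟩, by simp only [walkLen]; omega⟩

lemma isWalk_end {E : V → V → Prop} {t : V} :
    ∀ {l : List V} {s : V}, IsWalk E s t l → ∃ X, s :: l = X ++ [t]
  | [], s, h1 => ⟨[], by have : s = t := h1; simp [this]⟩
  | v :: r, s, h1 => by
      obtain ⟨X, e⟩ := isWalk_end h1.2
      exact ⟨s :: X, by simp [e]⟩

lemma walkLen_le {E : V → V → Prop} {ℓ : V → V → ℕ} {M : ℕ} (hM : ∀ u v, E u v → ℓ u v ≤ M)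
    {t : V} : ∀ {l : List V} {s : V}, IsWalk E s t l → walkLen ℓ s l ≤ l.length * M
  | [], _, _ => by simp [walkLen]
  | v :: r, s, h => by
      have := walkLen_le hM h.2
      have h2 := hM _ _ h.1
      simp only [walkLen, List.length_cons]
      linarith [Nat.succ_mul r.length M]

/-- Edge relation restricted to a vertex set. -/
def rE (E : V → V → Prop) (U : Finset V) (u v : V) : Prop := E u v ∧ u ∈ U ∧ v ∈ U

lemma rE_mem {E : V → V → Prop} {U : Finset V} {t : V} :
    ∀ {l : List V} {s : V}, s ∈ U → IsWalk (rE E U) s t l → ∀ y ∈ s :: l, y ∈ U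
  | [], s, hs, _, y, hy => by
      have : y = s := by simpa using hy
      exact this ▸ hs
  | v :: r, s, hs, h, y, hy => by
      rcases List.mem_cons.1 hy with h' | h'
      · exact h' ▸ hs
      · exact rE_mem h.1.2.2 h.2 y h'

lemma rE_of_mem {E : V → V → Prop} {U : Finset V} {t : V} :
    ∀ {l : List V} {s : V}, IsWalk E s t l → (∀ y ∈ s :: l, y ∈ U) → IsWalk (rE E U) s t l
  | [], s, h, _ => h
  | v :: r, s, h, hy => by
      refine ⟨⟨h.1, hy _ (by simp), hy _ (by simp)⟩, rE_of_mem h.2 fun y h' => hy y ?_⟩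
      exact List.mem_cons_of_mem _ h'

lemma exists_shortest {E : V → V → Prop} (ℓ : V → V → ℕ) {s t : V} {l : List V}
    (h : IsWalk E s t l) : ∃ l0, IsWalk E s t l0 ∧ (s :: l0).Nodup ∧
      ∀ l', IsWalk E s t l' → walkLen ℓ s l0 ≤ walkLen ℓ s l' := by
  classical
  have hex : ∃ n, ∃ l, IsWalk E s t l ∧ walkLen ℓ s l = n := ⟨_, l, h, rfl⟩
  obtain ⟨l1, w1, e1⟩ := Nat.find_spec hex
  obtain ⟨l0, w0, nd, hl⟩ := exists_simple ℓ w1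
  refine ⟨l0, w0, nd, fun l' w' => ?_⟩
  have := Nat.find_min' hex ⟨l', w', rfl⟩
  omega

/-- Distance capped at `B`. -/
noncomputable def hd (E : V → V → Prop) (ℓ : V → V → ℕ) (B : ℕ) (s v : V) : ℕ :=
  sInf {R | R = B ∨ ∃ l, IsWalk E s v l ∧ walkLen ℓ s l ≤ R}

lemma hd_mem (E : V → V → Prop) (ℓ : V → V → ℕ) (B : ℕ) (s v : V) :
    hd E ℓ B s v = B ∨ ∃ l, IsWalk E s v l ∧ walkLen ℓ s l ≤ hd E ℓ B s v :=
  Nat.sInf_mem (s := {R | R = B ∨ ∃ l, IsWalk E s v l ∧ walkLen ℓ s l ≤ R}) ⟨B, Or.inl rfl⟩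

lemma hd_le_B (E : V → V → Prop) (ℓ : V → V → ℕ) (B : ℕ) (s v : V) : hd E ℓ B s v ≤ B :=
  Nat.sInf_le (Or.inl rfl)

lemma hd_le {E : V → V → Prop} (ℓ : V → V → ℕ) (B : ℕ) {s v : V} {l : List V}
    (h : IsWalk E s v l) : hd E ℓ B s v ≤ walkLen ℓ s l :=
  Nat.sInf_le (Or.inr ⟨l, h, le_rfl⟩)

lemma hd_self (E : V → V → Prop) (ℓ : V → V → ℕ) (B : ℕ) (s : V) : hd E ℓ B s s = 0 := by
  have := hd_le (E := E) ℓ B (s := s) (v := s) (l := []) rfl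
  simpa [walkLen] using this

lemma hd_tri {E : V → V → Prop} {ℓ : V → V → ℕ} (B : ℕ) (s : V) {u v : V} (h : E u v) :
    hd E ℓ B s v ≤ hd E ℓ B s u + ℓ u v := by
  rcases hd_mem E ℓ B s u with h1 | ⟨l, w, hl⟩
  · rw [h1]; exact (hd_le_B E ℓ B s v).trans (Nat.le_add_right _ _)
  · have hw : IsWalk E s v (l ++ [v]) := isWalk_append w ⟨h, rfl⟩
    have := hd_le ℓ B hw
    rw [walkLen_append ℓ w] at this
    simp only [walkLen] at this
    omega

/-- Natural-number distance (junk if unreachable). -/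
noncomputable def nd (E : V → V → Prop) (ℓ : V → V → ℕ) (s v : V) : ℕ :=
  sInf {R | ∃ l, IsWalk E s v l ∧ walkLen ℓ s l = R}

lemma nd_le {E : V → V → Prop} (ℓ : V → V → ℕ) {s v : V} {l : List V}
    (h : IsWalk E s v l) : nd E ℓ s v ≤ walkLen ℓ s l :=
  Nat.sInf_le ⟨l, h, rfl⟩

lemma nd_mem {E : V → V → Prop} (ℓ : V → V → ℕ) {s v : V} {l : List V}
    (h : IsWalk E s v l) : ∃ l, IsWalk E s v l ∧ walkLen ℓ s l = nd E ℓ s v :=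
  Nat.sInf_mem (s := {R | ∃ l, IsWalk E s v l ∧ walkLen ℓ s l = R}) ⟨_, l, h, rfl⟩

lemma exists_in_path {E : V → V → Prop} {ℓ : V → V → ℕ} (hpos : ∀ u v, E u v → 0 < ℓ u v)
    (c : V) : ∀ (n : ℕ) (s : V) (l : List V), IsWalk E s c l → nd E ℓ s c = n →
      ∃ l', IsWalk E s c l' ∧ walkLen ℓ s l' = n ∧
        (s :: l').Pairwise (fun a b => nd E ℓ b c < nd E ℓ a c) := by
  intro n
  induction n using Nat.strong_induction_on with
  | _ n ih =>
  intro s l w e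
  obtain ⟨l1, w1, e1⟩ := nd_mem ℓ w
  cases l1 with
  | nil => exact ⟨[], w1, by rw [e1, e], by simp⟩
  | cons u r =>
    have h1 := nd_le ℓ w1.2
    have hp := hpos _ _ w1.1
    simp only [walkLen] at e1
    obtain ⟨l', w', hl', hp'⟩ := ih (nd E ℓ u c) (by omega) u r w1.2 rfl
    have hle : nd E ℓ s c ≤ ℓ s u + walkLen ℓ u l' := nd_le ℓ (l := u :: l') ⟨w1.1, w'⟩
    refine ⟨u :: l', ⟨w1.1, w'⟩, by simp only [walkLen]; omega, List.pairwise_cons.2 ⟨?_, hp'⟩⟩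
    intro b hb
    rcases List.mem_cons.1 hb with rfl | hb
    · omega
    · have := (List.pairwise_cons.1 hp').1 b hb
      omega

lemma exists_out_path {E : V → V → Prop} {ℓ : V → V → ℕ} (hpos : ∀ u v, E u v → 0 < ℓ u v)
    (c : V) : ∀ (n : ℕ) (t : V) (l : List V), IsWalk E c t l → nd E ℓ c t = n →
      ∃ l', IsWalk E c t l' ∧ walkLen ℓ c l' = n ∧
        (c :: l').Pairwise (fun a b => nd E ℓ c a < nd E ℓ c b) ∧
        ∀ y ∈ c :: l', nd E ℓ c y ≤ n := by
  intro n
  induction n using Nat.strong_induction_on with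
  | _ n ih =>
  intro t l w e
  obtain ⟨l1, w1, e1⟩ := nd_mem ℓ w
  rcases List.eq_nil_or_concat l1 with rfl | ⟨l0, v, rfl⟩
  · have hct : c = t := w1
    subst hct
    exact ⟨[], w1, by rw [e1, e], by simp, by simp [e]⟩
  · obtain ⟨X, hX⟩ := isWalk_end w1
    have hX' : (c :: l0) ++ [v] = X ++ [t] := by simpa using hX
    obtain ⟨-, hv⟩ := List.append_inj' hX' rfl
    have hv : v = t := by simpa using hv
    subst hv
    have : ∃ u, IsWalk E c u l0 ∧ E u v := by
      have key : ∀ (l0 : List V) (c : V), IsWalk E c v (l0 ++ [v]) → ∃ u, IsWalk E c u l0 ∧ E u v := by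
        intro l0
        induction l0 with
        | nil => intro c h; exact ⟨c, rfl, h.1⟩
        | cons a r ihr =>
          intro c h
          obtain ⟨u, hu, he⟩ := ihr a h.2
          exact ⟨u, ⟨h.1, hu⟩, he⟩
      exact key l0 c (by simpa using w1)
    obtain ⟨u, wu, hE⟩ := this
    rw [List.concat_eq_append, walkLen_append ℓ wu] at e1
    simp only [walkLen] at e1
    have hp := hpos _ _ hE
    have h1 := nd_le ℓ wu
    obtain ⟨l', w', hl', hp', hmx⟩ := ih (nd E ℓ c u) (by omega) u l0 wu rfl
    have hw2 : IsWalk E c v (l' ++ [v]) := isWalk_append w' ⟨hE, rfl⟩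
    have hle := nd_le ℓ hw2
    rw [walkLen_append ℓ w'] at hle
    simp only [walkLen] at hle
    refine ⟨l' ++ [v], hw2, ?_, ?_, ?_⟩
    · rw [walkLen_append ℓ w']; simp only [walkLen]; omega
    · rw [← List.cons_append, List.pairwise_append]
      refine ⟨hp', by simp, ?_⟩
      intro a ha b hb
      have : b = v := by simpa using hb
      subst this
      have := hmx a ha
      omega
    · intro y hy
      rw [← List.cons_append, List.mem_append] at hy
      rcases hy with hy | hy
      · have := hmx y hy
        omega
      · have : y = v := by simpa using hy
        subst this; omega

lemma sublist_of_key {α : Type*} (key : α → ℕ) : ∀ (L l : List α),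
    L.Pairwise (fun a b => key a ≤ key b) → l.Pairwise (fun a b => key a < key b) →
    (∀ a ∈ l, a ∈ L) → l.Sublist L := by
  intro L
  induction L with
  | nil =>
    intro l _ _ h
    have : l = [] := List.eq_nil_iff_forall_not_mem.2 fun a ha => by simpa using h a ha
    simp [this]
  | cons a L ih =>
    intro l hL hl h
    cases l with
    | nil => simp
    | cons b l =>
      rw [List.pairwise_cons] at hL hl
      by_cases hab : b = a
      · subst hab
        refine List.Sublist.cons_cons _ (ih l hL.2 hl.2 fun y hy => ?_)
        rcases List.mem_cons.1 (h y (List.mem_cons_of_mem _ hy)) with rfl | h'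
        · exact absurd (hl.1 _ hy) (lt_irrefl _)
        · exact h'
      · refine List.Sublist.cons _ (ih _ hL.2 (List.pairwise_cons.2 hl) fun y hy => ?_)
        have hbL : b ∈ L := by
          rcases List.mem_cons.1 (h b (by simp)) with h' | h'
          · exact absurd h' hab
          · exact h'
        rcases List.mem_cons.1 (h y hy) with rfl | h'
        · rcases List.mem_cons.1 hy with h2 | h2
          · exact absurd h2.symm hab
          · exact absurd (hl.1 _ h2) (not_lt.2 (hL.1 _ hbL))
        · exact h'

lemma exists_sorted (U : Finset V) (key : V → ℕ) :
    ∃ L : List V, L.Nodup ∧ (∀ v, v ∈ L ↔ v ∈ U) ∧ L.Pairwise (fun a b => key a ≤ key b) := by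
  classical
  refine ⟨U.toList.insertionSort (fun a b => key a ≤ key b), ?_, ?_, ?_⟩
  · exact (List.perm_insertionSort _ _).nodup_iff.2 U.nodup_toList
  · intro v; rw [(List.perm_insertionSort _ _).mem_iff]; simp
  · have : Std.Total (fun a b : V => key a ≤ key b) := ⟨fun a b => le_total _ _⟩
    have : IsTrans V (fun a b : V => key a ≤ key b) := ⟨fun a b c => le_trans⟩
    exact List.pairwise_insertionSort _ _

lemma star {E : V → V → Prop} {ℓ : V → V → ℕ} (hpos : ∀ u v, E u v → 0 < ℓ u v)
    (U : Finset V) (c : V) (hc : c ∈ U) :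
    ∃ σ : List V, (∀ v, σ.count v ≤ 2) ∧ (∀ v ∈ σ, v ∈ U) ∧
      ∀ s t l1 l2, s ∈ U → IsWalk (rE E U) s c l1 → IsWalk (rE E U) c t l2 →
        ∃ l', IsWalk E s t l' ∧ (s :: l').Sublist σ ∧
          walkLen ℓ s l' ≤ walkLen ℓ s l1 + walkLen ℓ c l2 := by
  classical
  have hpos' : ∀ u v, rE E U u v → 0 < ℓ u v := fun u v h => hpos u v h.1
  obtain ⟨L1, n1, m1, p1⟩ := exists_sorted U (fun v => nd (rE E U) ℓ v c)
  obtain ⟨L2, n2, m2, p2⟩ := exists_sorted U (fun v => nd (rE E U) ℓ c v)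
  refine ⟨L1.reverse ++ L2, ?_, ?_, ?_⟩
  · intro v
    rw [List.count_append, List.count_reverse]
    have := List.nodup_iff_count_le_one.1 n1 v
    have := List.nodup_iff_count_le_one.1 n2 v
    omega
  · intro v hv
    rcases List.mem_append.1 hv with h | h
    · exact (m1 v).1 (List.mem_reverse.1 h)
    · exact (m2 v).1 h
  · intro s t l1 l2 hs w1 w2
    obtain ⟨a, wa, ea, pa⟩ := exists_in_path hpos' c _ s l1 w1 rfl
    obtain ⟨b, wb, eb, pb, -⟩ := exists_out_path hpos' c _ t l2 w2 rfl
    have h1 := nd_le ℓ w1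
    have h2 := nd_le ℓ w2
    refine ⟨a ++ b, isWalk_mono (fun _ _ h => h.1) (isWalk_append wa wb), ?_, ?_⟩
    · obtain ⟨X, hX⟩ := isWalk_end wa
      have e : s :: (a ++ b) = X ++ (c :: b) := by
        rw [← List.cons_append, hX]; simp
      rw [e]
      refine List.Sublist.append ?_ ?_
      · have : (s :: a).reverse.Sublist L1 := by
          apply sublist_of_key _ _ _ p1
          · rw [List.pairwise_reverse]; exact pa
          · intro y hy
            exact (m1 y).2 (rE_mem hs wa y (List.mem_reverse.1 hy))
        have h3 : (s :: a).Sublist L1.reverse := by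
          have := this.reverse
          simpa using this
        rw [hX] at h3
        exact (List.sublist_append_left _ _).trans h3
      · exact sublist_of_key _ _ _ p2 pb fun y hy => (m2 y).2 (rE_mem hc wb y hy)
    · rw [walkLen_append ℓ wa]; omega

lemma sublist_replicate (L : List V) : ∀ (l : List V) (p : ℕ), (∀ y ∈ l, y ∈ L) → l.length ≤ p →
    l.Sublist (List.replicate p L).flatten
  | [], _, _, _ => List.nil_sublist _
  | a :: l, 0, _, h => by simp at h
  | a :: l, p + 1, hm, h => by
      have ih := sublist_replicate L l p (fun y hy => hm y (List.mem_cons_of_mem _ hy))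
        (by simpa using h)
      rw [List.replicate_succ, List.flatten_cons]
      have : [a].Sublist L := List.singleton_sublist.2 (hm a (by simp))
      exact this.append ih

end Walks

section LDD

lemma seq_lemma (N : ℕ) (hN : 0 < N) (cut a : ℕ → ℝ) (W K : ℝ) (hK0 : 0 ≤ K)
    (hcut : ∀ R, 0 ≤ cut R) (ha : ∀ R < N, 1 + ∑ i ∈ Finset.range (R + 1), cut i ≤ a R)
    (haW : ∀ R < N, a R ≤ W) (hW : 0 < W) (hK : Real.log W ≤ K) :
    ∃ R < N, cut R ≤ K / N * a R := by
  by_contra hcon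
  push Not at hcon
  have hN' : (0 : ℝ) < N := by exact_mod_cast hN
  have hKN : 0 ≤ K / N := by positivity
  set B : ℕ → ℝ := fun R => 1 + ∑ i ∈ Finset.range R, cut i with hB
  have hstep : ∀ R < N, B R < (1 - K / N) * B (R + 1) := by
    intro R hR
    have h1 := hcon R hR
    have h2 : B (R + 1) ≤ a R := ha R hR
    have h3 : B (R + 1) = B R + cut R := by simp only [hB, Finset.sum_range_succ]; ring
    have h4 := mul_le_mul_of_nonneg_left h2 hKN
    nlinarith
  have hexp : ∀ R, R ≤ N → Real.exp (K / N * R) ≤ B R ∧ (0 < R → Real.exp (K / N * R) < B R) := by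
    intro R
    induction R with
    | zero => intro _; simp [hB]
    | succ R ih =>
      intro hR
      have h1 := (ih (by omega)).1
      have h2 := hstep R (by omega)
      have hpos : 0 < Real.exp (K / N * R) := Real.exp_pos _
      have h3 : 1 - K / N ≤ Real.exp (-(K / N)) := by
        have := Real.add_one_le_exp (-(K / N)); linarith
      have hBp : 0 < B (R + 1) := by
        have : 0 ≤ ∑ i ∈ Finset.range (R + 1), cut i := Finset.sum_nonneg fun i _ => hcut i
        simp only [hB]; linarith
      have h4 : B R < Real.exp (-(K / N)) * B (R + 1) :=
        h2.trans_le (mul_le_mul_of_nonneg_right h3 hBp.le)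
      have h5 : Real.exp (K / N * R) < Real.exp (-(K / N)) * B (R + 1) := h1.trans_lt h4
      have h6 : Real.exp (K / N * (R + 1 : ℕ)) = Real.exp (K / N) * Real.exp (K / N * R) := by
        rw [← Real.exp_add]; congr 1; push_cast; ring
      have h7 : Real.exp (K / N) * (Real.exp (-(K / N)) * B (R + 1)) = B (R + 1) := by
        rw [← mul_assoc, ← Real.exp_add]; simp
      have h8 : Real.exp (K / N * (R + 1 : ℕ)) < B (R + 1) := by
        rw [h6, ← h7]
        exact mul_lt_mul_of_pos_left h5 (Real.exp_pos _)
      exact ⟨h8.le, fun _ => h8⟩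
  have h1 := (hexp N le_rfl).2 hN
  have h2 : B N ≤ a (N - 1) := by
    have := ha (N - 1) (by omega)
    have e : N - 1 + 1 = N := by omega
    rw [e] at this; exact this
  have h3 := haW (N - 1) (by omega)
  have h4 : W ≤ Real.exp (K / N * N) := by
    rw [div_mul_cancel₀ _ hN'.ne', ← Real.exp_log hW]
    exact Real.exp_le_exp.2 (by simpa using hK)
  linarith

variable {V : Type*}

lemma grow (U : Finset V) (c : V → V → ℝ) (hc : ∀ u v, 0 ≤ c u v) (ℓ : V → V → ℕ)
    (w : V → ℝ) (hw : ∀ v ∈ U, 1 + ∑ u ∈ U, c v u * ℓ v u ≤ w v)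
    (h : V → ℤ) (htri : ∀ u v, c u v ≠ 0 → h v ≤ h u + ℓ u v)
    (s : V) (hs : s ∈ U) (hs0 : h s ≤ 0) (N : ℕ) (hN : 0 < N) (K W : ℝ) (hK0 : 0 ≤ K)
    (hUW : ∑ v ∈ U, w v ≤ W) (hW : 0 < W) (hK : Real.log W ≤ K) :
    ∃ R < N, ∑ u ∈ U with h u ≤ (R : ℕ), ∑ v ∈ U with ¬ h v ≤ (R : ℕ), c u v
      ≤ K / N * ∑ v ∈ U with h v ≤ (R : ℕ), w v := by
  have hw1 : ∀ v ∈ U, 1 ≤ w v := fun v hv => by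
    have := hw v hv
    have h2 : 0 ≤ ∑ u ∈ U, c v u * ℓ v u :=
      Finset.sum_nonneg fun u _ => mul_nonneg (hc _ _) (Nat.cast_nonneg _)
    linarith
  refine seq_lemma N hN _ (fun R => ∑ v ∈ U with h v ≤ (R : ℕ), w v) W K hK0 ?_ ?_ ?_ hW hK
  · exact fun R => Finset.sum_nonneg fun u _ => Finset.sum_nonneg fun v _ => hc u v
  · intro R hR
    have e : ∀ i ∈ Finset.range (R + 1),
        ∑ u ∈ U with h u ≤ (i : ℕ), ∑ v ∈ U with ¬ h v ≤ (i : ℕ), c u v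
        = ∑ u ∈ U with h u ≤ (R : ℕ), ∑ v ∈ U, 
            if h u ≤ (i : ℕ) ∧ ¬ h v ≤ (i : ℕ) then c u v else 0 := by
      intro i hi
      have hi' : i ≤ R := by simpa [Nat.lt_succ_iff] using hi
      have : (U.filter fun u => h u ≤ (i : ℕ)) =
          ((U.filter fun u => h u ≤ (R : ℕ)).filter fun u => h u ≤ (i : ℕ)) := by
        rw [Finset.filter_filter]
        refine Finset.filter_congr fun u _ => ?_
        constructor
        · intro h1; exact ⟨h1.trans (by exact_mod_cast hi'), h1⟩
        · exact fun h1 => h1.2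
      rw [this, Finset.sum_filter]
      refine Finset.sum_congr rfl fun u _ => ?_
      by_cases hu : h u ≤ (i : ℕ)
      · simp only [hu, if_true, true_and]
        rw [Finset.sum_filter]
      · simp [hu]
    rw [Finset.sum_congr rfl e, Finset.sum_comm]
    have hb : ∀ u ∈ U.filter (fun u => h u ≤ (R : ℕ)),
        ∑ i ∈ Finset.range (R + 1), ∑ v ∈ U,
          (if h u ≤ (i : ℕ) ∧ ¬ h v ≤ (i : ℕ) then c u v else 0) ≤ w u - 1 := by
      intro u hu
      have huU := (Finset.mem_filter.1 hu).1
      rw [Finset.sum_comm]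
      have := hw u huU
      refine le_trans (Finset.sum_le_sum fun v _ => ?_) (by linarith : _ ≤ w u - 1)
      by_cases h0 : c u v = 0
      · simp [h0]
      · rw [← Finset.sum_filter, Finset.sum_const, nsmul_eq_mul, mul_comm]
        refine mul_le_mul_of_nonneg_left ?_ (hc _ _)
        have ht := htri u v h0
        have hsub : ((Finset.range (R + 1)).filter
            (fun i : ℕ => h u ≤ (i : ℕ) ∧ ¬ h v ≤ (i : ℕ))).image (fun i : ℕ => (i : ℤ)) ⊆
            Finset.Ico (h u) (h v) := by
          intro z hz
          obtain ⟨i, hi, rfl⟩ := Finset.mem_image.1 hz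
          have := (Finset.mem_filter.1 hi).2
          simp only [Finset.mem_Ico]
          omega
        have hcard := Finset.card_le_card hsub
        rw [Finset.card_image_of_injective _ Nat.cast_injective, Int.card_Ico] at hcard
        have : (h v - h u).toNat ≤ ℓ u v := by omega
        exact_mod_cast hcard.trans this
    have hsum := Finset.sum_le_sum hb
    rw [Finset.sum_sub_distrib] at hsum
    have hs1 : (1 : ℝ) ≤ ∑ u ∈ U with h u ≤ (R : ℕ), (1 : ℝ) := by
      rw [Finset.sum_const, nsmul_eq_mul, mul_one]
      have : 0 < (U.filter fun u => h u ≤ (R : ℕ)).card :=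
        Finset.card_pos.2 ⟨s, Finset.mem_filter.2 ⟨hs, hs0.trans (by positivity)⟩⟩
      exact_mod_cast this
    linarith
  · intro R _
    refine le_trans (Finset.sum_le_sum_of_subset_of_nonneg (Finset.filter_subset _ _) ?_) hUW
    intro v hv _
    linarith [hw1 v hv]

lemma wlog_ineq {a b : ℝ} (ha : 1 ≤ a) (hb : 1 ≤ b) :
    a * Real.logb 2 a + b * Real.logb 2 b + min a b ≤ (a + b) * Real.logb 2 (a + b) := by
  wlog hab : a ≤ b generalizing a b
  · have := this hb ha (le_of_not_ge hab)
    rw [min_comm, add_comm b a] at this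
    linarith
  rw [min_eq_left hab]
  have h1 : Real.logb 2 a + 1 ≤ Real.logb 2 (a + b) := by
    have : Real.logb 2 a + 1 = Real.logb 2 (2 * a) := by
      rw [Real.logb_mul (by norm_num) (by linarith)]; simp; ring
    rw [this]
    exact Real.logb_le_logb_of_le (by norm_num) (by linarith) (by linarith)
  have h2 : Real.logb 2 b ≤ Real.logb 2 (a + b) :=
    Real.logb_le_logb_of_le (by norm_num) (by linarith) (by linarith)
  nlinarith

lemma ldd (c : V → V → ℝ) (hc : ∀ u v, 0 ≤ c u v) (ℓ : V → V → ℕ)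
    (h : V → V → ℕ) (hss : ∀ s, h s s = 0)
    (htri : ∀ s u v, c u v ≠ 0 → h s v ≤ h s u + ℓ u v)
    (N : ℕ) (hN : 0 < N) (K W : ℝ) (hK0 : 0 ≤ K) (hW : 0 < W) (hK : Real.log W ≤ K)
    (w : V → ℝ) : ∀ (n : ℕ) (U : Finset V), U.card = n →
    (∀ v ∈ U, 1 + ∑ u ∈ U, c v u * ℓ v u ≤ w v) →
    (∀ v ∈ U, 1 + ∑ u ∈ U, c u v * ℓ u v ≤ w v) →
    ∑ v ∈ U, w v ≤ W →
    ∃ r : V → ℕ, (∀ u ∈ U, ∀ v ∈ U, r u = r v → h u v < 2 * N - 1) ∧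
      ∑ u ∈ U, ∑ v ∈ U, (if r v < r u then c u v else 0) ≤
        K / N * ((∑ v ∈ U, w v) * Real.logb 2 (∑ v ∈ U, w v)) := by
  have hKN : 0 ≤ K / N := by positivity
  intro n
  induction n using Nat.strong_induction_on with
  | _ n ih =>
  intro U hU hw1 hw2 hUW
  have hwp : ∀ v ∈ U, 1 ≤ w v := fun v hv => by
    have := hw1 v hv
    have h2 : 0 ≤ ∑ u ∈ U, c v u * ℓ v u :=
      Finset.sum_nonneg fun u _ => mul_nonneg (hc _ _) (Nat.cast_nonneg _)
    linarith
  by_cases hall : ∀ u ∈ U, ∀ v ∈ U, h u v < 2 * N - 1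
  · refine ⟨fun _ => 0, fun u hu v hv _ => hall u hu v hv, ?_⟩
    simp only [lt_irrefl, if_false, Finset.sum_const_zero]
    rcases U.eq_empty_or_nonempty with rfl | ⟨v, hv⟩
    · simp
    · have h1 : 1 ≤ ∑ v ∈ U, w v :=
        (hwp v hv).trans (Finset.single_le_sum (f := w) (fun i hi => by linarith [hwp i hi]) hv)
      have := Real.logb_nonneg (b := 2) (by norm_num) h1
      positivity
  · push Not at hall
    obtain ⟨s, hs, t, ht, hst⟩ := hall
    have hcut : ∃ S : Finset V, S ⊆ U ∧ s ∈ S ∧ t ∉ S ∧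
        ∑ u ∈ S, ∑ v ∈ U \ S, c u v ≤ K / N * min (∑ v ∈ S, w v) (∑ v ∈ U \ S, w v) := by
      by_cases hcase : ∑ v ∈ U with h s v ≤ N - 1, w v ≤ ∑ v ∈ U with ¬ h s v ≤ N - 1, w v
      · obtain ⟨R, hR, hle⟩ := grow U c hc ℓ w hw1 (fun v => (h s v : ℤ))
          (fun u v huv => by exact_mod_cast htri s u v huv) s hs (by simp [hss]) N hN K W hK0
          hUW hW hK
        have e2 : U \ U.filter (fun v => h s v ≤ R) = U.filter (fun v => ¬ h s v ≤ R) := by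
          ext v; simp only [Finset.mem_sdiff, Finset.mem_filter]; tauto
        refine ⟨U.filter fun v => h s v ≤ R, Finset.filter_subset _ _, ?_, ?_, ?_⟩
        · simp [hs, hss]
        · simp only [Finset.mem_filter, not_and, not_le]; intro _; omega
        · rw [e2]
          simp only [Nat.cast_le] at hle
          refine hle.trans (mul_le_mul_of_nonneg_left (le_min le_rfl ?_) hKN)
          have a1 : ∑ v ∈ U with h s v ≤ R, w v ≤ ∑ v ∈ U with h s v ≤ N - 1, w v := by
            refine Finset.sum_le_sum_of_subset_of_nonneg ?_ ?_
            · intro v; simp only [Finset.mem_filter]; rintro ⟨p, q⟩; exact ⟨p, by omega⟩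
            · intro v hv _; linarith [hwp v (Finset.mem_filter.1 hv).1]
          have a2 : ∑ v ∈ U with ¬ h s v ≤ N - 1, w v ≤ ∑ v ∈ U with ¬ h s v ≤ R, w v := by
            refine Finset.sum_le_sum_of_subset_of_nonneg ?_ ?_
            · intro v; simp only [Finset.mem_filter]; rintro ⟨p, q⟩; exact ⟨p, by omega⟩
            · intro v hv _; linarith [hwp v (Finset.mem_filter.1 hv).1]
          linarith
      · replace hcase := not_le.1 hcase
        obtain ⟨R, hR, hle⟩ := grow U (fun u v => c v u) (fun u v => hc v u) (fun u v => ℓ v u) w hw2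
          (fun v => (2 * N - 1 : ℤ) - h s v)
          (fun u v huv => by have := htri s v u huv; omega) t ht
          (by omega) N hN K W hK0 hUW hW hK
        have hx : ∀ v, ((2 * N - 1 : ℤ) - h s v ≤ (R : ℕ)) ↔ ¬ h s v ≤ 2 * N - 2 - R := by
          intro v; omega
        have e2 : U \ U.filter (fun v => h s v ≤ 2 * N - 2 - R)
            = U.filter (fun v => ¬ h s v ≤ 2 * N - 2 - R) := by
          ext v; simp only [Finset.mem_sdiff, Finset.mem_filter]; tauto
        refine ⟨U.filter fun v => h s v ≤ 2 * N - 2 - R, Finset.filter_subset _ _, ?_, ?_, ?_⟩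
        · simp [hs, hss]
        · simp only [Finset.mem_filter, not_and, not_le]; intro _; omega
        · rw [e2]
          simp only [hx, not_not] at hle
          rw [Finset.sum_comm] at hle
          refine hle.trans (mul_le_mul_of_nonneg_left (le_min ?_ le_rfl) hKN)
          have a1 : ∑ v ∈ U with ¬ h s v ≤ 2 * N - 2 - R, w v ≤
              ∑ v ∈ U with ¬ h s v ≤ N - 1, w v := by
            refine Finset.sum_le_sum_of_subset_of_nonneg ?_ ?_
            · intro v; simp only [Finset.mem_filter]; rintro ⟨p, q⟩; exact ⟨p, by omega⟩
            · intro v hv _; linarith [hwp v (Finset.mem_filter.1 hv).1]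
          have a2 : ∑ v ∈ U with h s v ≤ N - 1, w v ≤
              ∑ v ∈ U with h s v ≤ 2 * N - 2 - R, w v := by
            refine Finset.sum_le_sum_of_subset_of_nonneg ?_ ?_
            · intro v; simp only [Finset.mem_filter]; rintro ⟨p, q⟩; exact ⟨p, by omega⟩
            · intro v hv _; linarith [hwp v (Finset.mem_filter.1 hv).1]
          linarith
    obtain ⟨S, hSU, hsS, htS, hcost⟩ := hcut
    have hsub : ∀ X ⊆ U, (∀ v ∈ X, 1 + ∑ u ∈ X, c v u * ℓ v u ≤ w v) ∧
        (∀ v ∈ X, 1 + ∑ u ∈ X, c u v * ℓ u v ≤ w v) ∧ ∑ v ∈ X, w v ≤ W := by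
      intro X hX
      refine ⟨fun v hv => le_trans ?_ (hw1 v (hX hv)), fun v hv => le_trans ?_ (hw2 v (hX hv)),
        le_trans ?_ hUW⟩
      · gcongr
        exact fun u _ _ => mul_nonneg (hc _ _) (Nat.cast_nonneg _)
      · gcongr
        exact fun u _ _ => mul_nonneg (hc _ _) (Nat.cast_nonneg _)
      · exact Finset.sum_le_sum_of_subset_of_nonneg hX fun u hu _ => by linarith [hwp u hu]
    have hTU : U \ S ⊆ U := Finset.sdiff_subset
    have htT : t ∈ U \ S := Finset.mem_sdiff.2 ⟨ht, htS⟩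
    have hsT : s ∉ U \ S := fun h' => (Finset.mem_sdiff.1 h').2 hsS
    obtain ⟨x1, x2, x3⟩ := hsub S hSU
    obtain ⟨y1, y2, y3⟩ := hsub (U \ S) hTU
    obtain ⟨r2, hr2, hc2⟩ := ih S.card
      (by rw [← hU]; exact Finset.card_lt_card ⟨hSU, fun h' => htS (h' ht)⟩) S rfl x1 x2 x3
    obtain ⟨r1, hr1, hc1⟩ := ih (U \ S).card
      (by rw [← hU]; exact Finset.card_lt_card ⟨hTU, fun h' => hsT (h' hs)⟩) (U \ S) rfl y1 y2 y3
    set M := (∑ v ∈ U, r1 v) + 1 with hM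
    have hlt : ∀ v ∈ U, r1 v < M := fun v hv => by
      have := Finset.single_le_sum (f := r1) (fun i _ => Nat.zero_le _) hv
      omega
    refine ⟨fun v => if v ∈ S then r2 v + M else r1 v, ?_, ?_⟩
    · intro u hu v hv huv
      by_cases h1 : u ∈ S <;> by_cases h2 : v ∈ S <;> simp only [h1, h2, if_true, if_false] at huv
      · exact hr2 u h1 v h2 (by omega)
      · have := hlt v hv; omega
      · have := hlt u hu; omega
      · exact hr1 u (by simp [hu, h1]) v (by simp [hv, h2]) huv
    · have hsplit : ∀ f : V → ℝ, ∑ v ∈ U, f v = ∑ v ∈ S, f v + ∑ v ∈ U \ S, f v := fun f => by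
        rw [add_comm]; exact (Finset.sum_sdiff hSU).symm
      have hw1' : 1 ≤ ∑ v ∈ S, w v := (hwp s hs).trans
        (Finset.single_le_sum (f := w) (fun i hi => by linarith [hwp i (hSU hi)]) hsS)
      have hw2' : 1 ≤ ∑ v ∈ U \ S, w v := (hwp t ht).trans
        (Finset.single_le_sum (f := w) (fun i hi => by linarith [hwp i (hTU hi)]) htT)
      have key := mul_le_mul_of_nonneg_left (wlog_ineq hw1' hw2') hKN
      rw [← hsplit] at key
      refine le_trans ?_ key
      rw [hsplit]
      have b1 : ∑ u ∈ S, ∑ v ∈ U, (if (if v ∈ S then r2 v + M else r1 v) <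
          (if u ∈ S then r2 u + M else r1 u) then c u v else 0) ≤
          ∑ u ∈ S, ∑ v ∈ S, (if r2 v < r2 u then c u v else 0) + ∑ u ∈ S, ∑ v ∈ U \ S, c u v := by
        rw [← Finset.sum_add_distrib]
        refine Finset.sum_le_sum fun u hu => ?_
        rw [hsplit]
        refine add_le_add (Finset.sum_le_sum fun v hv => ?_) (Finset.sum_le_sum fun v hv => ?_)
        · simp [hu, hv]
        · split_ifs <;> first | exact le_rfl | exact hc _ _
      have b2 : ∑ u ∈ U \ S, ∑ v ∈ U, (if (if v ∈ S then r2 v + M else r1 v) <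
          (if u ∈ S then r2 u + M else r1 u) then c u v else 0) ≤
          ∑ u ∈ U \ S, ∑ v ∈ U \ S, (if r1 v < r1 u then c u v else 0) := by
        refine Finset.sum_le_sum fun u hu => ?_
        have hu' := Finset.mem_sdiff.1 hu
        have := hlt u hu'.1
        rw [hsplit]
        have z : ∑ v ∈ S, (if (if v ∈ S then r2 v + M else r1 v) <
          (if u ∈ S then r2 u + M else r1 u) then c u v else 0) = 0 := by
          refine Finset.sum_eq_zero fun v hv => ?_
          simp only [hv, hu'.2, if_true, if_false]
          rw [if_neg (by omega)]
        rw [z, zero_add]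
        refine Finset.sum_le_sum fun v hv => ?_
        have hv' := Finset.mem_sdiff.1 hv
        simp [hu'.2, hv'.2]
      have e : K / N * ((∑ v ∈ S, w v) * Real.logb 2 (∑ v ∈ S, w v) +
          (∑ v ∈ U \ S, w v) * Real.logb 2 (∑ v ∈ U \ S, w v) +
          min (∑ v ∈ S, w v) (∑ v ∈ U \ S, w v)) =
          K / N * ((∑ v ∈ S, w v) * Real.logb 2 (∑ v ∈ S, w v)) +
          K / N * ((∑ v ∈ U \ S, w v) * Real.logb 2 (∑ v ∈ U \ S, w v)) +
          K / N * min (∑ v ∈ S, w v) (∑ v ∈ U \ S, w v) := by ring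
      rw [e]
      linarith

end LDD

section Layer
variable {V : Type*}

/-- Indicator of a backward edge for the rank function `r`. -/
noncomputable def back (r : V → ℕ) (u v : V) : ℕ := if r v < r u then 1 else 0

lemma first_run {E : V → V → Prop} (r : V → ℕ) {t : V} :
    ∀ {l : List V} {s : V}, IsWalk E s t l → ∃ l1 l2 u, l = l1 ++ l2 ∧ IsWalk E s u l1 ∧
      IsWalk E u t l2 ∧ (∀ y ∈ s :: l1, r y = r s) ∧ r u = r s ∧
      (l2 = [] ∨ ∃ v l3, l2 = v :: l3 ∧ r v ≠ r s)
  | [], s, h => ⟨[], [], s, rfl, rfl, h, by simp, rfl, Or.inl rfl⟩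
  | v :: l, s, h => by
      by_cases hv : r v = r s
      · obtain ⟨l1, l2, u, e, w1, w2, h1, hu, h2⟩ := first_run r h.2
        refine ⟨v :: l1, l2, u, by simp [e], ⟨h.1, w1⟩, w2, ?_, hu.trans hv, ?_⟩
        · intro y hy
          rcases List.mem_cons.1 hy with rfl | hy
          · rfl
          · exact (h1 y hy).trans hv
        · rw [← hv]; exact h2
      · exact ⟨[], v :: l, s, rfl, rfl, h, by simp, rfl, Or.inr ⟨v, l, rfl, hv⟩⟩

/-- Remaining word: from cluster `i` on in the current layer, then `j` full layers. -/
def rem (τ : ℕ → List V) (p i j : ℕ) : List V :=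
  (List.range' i (p - i)).flatMap τ ++ (List.replicate j ((List.range' 0 p).flatMap τ)).flatten

lemma rem_forward (τ : ℕ → List V) {p i i' : ℕ} (j : ℕ) (h : i < i') (hp : i < p) {a b : List V}
    (ha : a.Sublist (τ i)) (hb : b.Sublist (rem τ p i' j)) : (a ++ b).Sublist (rem τ p i j) := by
  have e : p - i = (p - (i + 1)) + 1 := by omega
  have : rem τ p i j = τ i ++ rem τ p (i + 1) j := by
    simp only [rem]
    rw [e, List.range'_succ]; simp
  rw [this]
  refine ha.append (hb.trans ?_)
  simp only [rem]
  refine List.Sublist.append ?_ (List.Sublist.refl _)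
  refine List.Sublist.flatMap ?_ τ
  by_cases hh : i' ≤ p
  · have e2 : p - (i + 1) = (i' - (i + 1)) + (p - i') := by omega
    rw [e2, ← List.range'_append]
    have e3 : i + 1 + 1 * (i' - (i + 1)) = i' := by omega
    rw [e3]
    exact List.sublist_append_right _ _
  · have : p - i' = 0 := by omega
    simp [this]

lemma rem_back (τ : ℕ → List V) {p i i' : ℕ} (j : ℕ) (hp : i < p) {a b : List V}
    (ha : a.Sublist (τ i)) (hb : b.Sublist (rem τ p i' j)) :
    (a ++ b).Sublist (rem τ p i (j + 1)) := by
  have e : p - i = (p - (i + 1)) + 1 := by omega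
  have h0 : (List.range' i (p - i)).flatMap τ = τ i ++ (List.range' (i + 1) (p - (i+1))).flatMap τ := by
    rw [e, List.range'_succ]; simp
  have h1 : (rem τ p i' j).Sublist (List.replicate (j + 1) ((List.range' 0 p).flatMap τ)).flatten := by
    rw [List.replicate_succ, List.flatten_cons]
    refine List.Sublist.append ?_ (List.Sublist.refl _)
    refine List.Sublist.flatMap ?_ τ
    by_cases hh : i' ≤ p
    · have e2 : p = i' + (p - i') := by omega
      conv_rhs => rw [e2, ← List.range'_append]
      have e3 : 0 + 1 * i' = i' := by omega
      rw [e3]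
      exact List.sublist_append_right _ _
    · have : p - i' = 0 := by omega
      simp [this]
  unfold rem
  refine List.Sublist.append ?_ (hb.trans h1)
  rw [h0]
  exact ha.trans (List.sublist_append_left _ _)

lemma rem_stay (τ : ℕ → List V) {p i : ℕ} (j : ℕ) (hp : i < p) {a : List V}
    (ha : a.Sublist (τ i)) : a.Sublist (rem τ p i j) := by
  have := rem_forward τ (i' := i + 1) j (Nat.lt_succ_self i) hp ha (List.nil_sublist _)
  simpa using this

lemma layer_walk {E0 E : V → V → Prop} {ℓ : V → V → ℕ} (hE : ∀ u v, E0 u v → E u v)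
    (r : V → ℕ) (p : ℕ) (τ : ℕ → List V) (α : ℝ) (hα : 1 ≤ α) (good : V → Prop)
    (hr : ∀ v, good v → r v < p)
    (hτ : ∀ s t l, IsWalk E0 s t l → (∀ y ∈ s :: l, good y ∧ r y = r s) →
      ∃ l', IsWalk E s t l' ∧ (s :: l').Sublist (τ (r s)) ∧
        (walkLen ℓ s l' : ℝ) ≤ α * walkLen ℓ s l) :
    ∀ (n : ℕ) (l : List V) (s t : V) (j : ℕ), l.length ≤ n → IsWalk E0 s t l →
      (∀ y ∈ s :: l, good y) → walkLen (back r) s l ≤ j →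
      ∃ l', IsWalk E s t l' ∧ (s :: l').Sublist (rem τ p (r s) j) ∧
        (walkLen ℓ s l' : ℝ) ≤ α * walkLen ℓ s l := by
  intro n
  induction n using Nat.strong_induction_on with
  | _ n ih =>
  intro l s t j hn w hg hb
  obtain ⟨l1, l2, u, rfl, w1, w2, h1, hu, h2⟩ := first_run r w
  have hg1 : ∀ y ∈ s :: l1, good y ∧ r y = r s := fun y hy =>
    ⟨hg y (by rw [← List.cons_append]; exact List.mem_append_left _ hy), h1 y hy⟩
  obtain ⟨a, wa, sa, la⟩ := hτ s u l1 w1 hg1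
  have hsp := hr s (hg s (by simp))
  rcases h2 with rfl | ⟨v, l3, rfl, hv⟩
  · have hut : u = t := w2
    subst hut
    exact ⟨a, wa, rem_stay τ j hsp sa, by simpa using la⟩
  · rw [walkLen_append _ w1] at hb
    simp only [walkLen] at hb
    have hlen : l3.length < n := by
      simp only [List.length_append, List.length_cons] at hn; omega
    have hg3 : ∀ y ∈ v :: l3, good y := fun y hy =>
      hg y (List.mem_cons_of_mem _ (List.mem_append_right _ hy))
    have hEuv := hE _ _ w2.1
    have fin : ∀ j', walkLen (back r) v l3 ≤ j' →
        (∀ b, b.Sublist (rem τ p (r v) j') → ((s :: a) ++ b).Sublist (rem τ p (r s) j)) →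
        ∃ l', IsWalk E s t l' ∧ (s :: l').Sublist (rem τ p (r s) j) ∧
        (walkLen ℓ s l' : ℝ) ≤ α * walkLen ℓ s (l1 ++ v :: l3) := by
      intro j' hj' hsub
      obtain ⟨b, wb, sb, lb⟩ := ih _ hlen l3 v t j' le_rfl w2.2 hg3 hj'
      refine ⟨a ++ v :: b, isWalk_append wa ⟨hEuv, wb⟩, hsub _ sb, ?_⟩
      rw [walkLen_append ℓ wa, walkLen_append ℓ w1]
      simp only [walkLen]
      push_cast
      have : (ℓ u v : ℝ) ≤ α * ℓ u v := le_mul_of_one_le_left (Nat.cast_nonneg _) hα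
      linarith
    by_cases hlt : r v < r u
    · have hbk : back r u v = 1 := by simp [back, hlt]
      obtain ⟨j', rfl⟩ : ∃ j', j = j' + 1 := ⟨j - 1, by omega⟩
      exact fin j' (by omega) fun b hb' => rem_back τ j' hsp sa hb'
    · exact fin j (by omega) fun b hb' => rem_forward τ j (by omega) hsp sa hb'

lemma count_flatMap_le {ι : Type*} (I : List ι) (hI : I.Nodup) (τ : ι → List V) (v : V) (i0 : ι)
    (h : ∀ i, i ≠ i0 → (τ i).count v = 0) : (I.flatMap τ).count v ≤ (τ i0).count v := by
  induction I with
  | nil => simp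
  | cons a I ih =>
    rw [List.nodup_cons] at hI
    rw [List.flatMap_cons, List.count_append]
    by_cases ha : a = i0
    · subst ha
      have : (I.flatMap τ).count v = 0 := by
        rw [List.count_flatMap]
        rw [List.sum_eq_zero]
        intro x hx
        obtain ⟨i, hi, rfl⟩ := List.mem_map.1 hx
        exact h i (fun e => hI.1 (e ▸ hi))
      omega
    · rw [h a ha]
      have := ih hI.2
      omega

lemma count_flatMap_le_mul {ι : Type*} (I : List ι) (τ : ι → List V) (v : V) (b : ℕ)
    (h : ∀ i ∈ I, (τ i).count v ≤ b) : (I.flatMap τ).count v ≤ I.length * b := by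
  induction I with
  | nil => simp
  | cons a I ih =>
    rw [List.flatMap_cons, List.count_append, List.length_cons, Nat.succ_mul]
    have h1 := h a (by simp)
    have h2 := ih fun i hi => h i (List.mem_cons_of_mem _ hi)
    omega

/-- `σ` is a word over `U` with multiplicities at most `B`. -/
def WordOn (U : Finset V) (σ : List V) (B : ℝ) : Prop :=
  (∀ v, (σ.count v : ℝ) ≤ B) ∧ ∀ v ∈ σ, v ∈ U

/-- `σ` approximates all walks inside `U` up to the factor `α`. -/
def Approx (E : V → V → Prop) (ℓ : V → V → ℕ) (U : Finset V) (σ : List V) (α : ℝ) : Prop :=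
  ∀ s t l, s ∈ U → IsWalk (rE E U) s t l → ∃ l', IsWalk E s t l' ∧ (s :: l').Sublist σ ∧
    (walkLen ℓ s l' : ℝ) ≤ α * walkLen ℓ s l

lemma one_partition {E : V → V → Prop} {ℓ : V → V → ℕ} (hpos : ∀ u v, E u v → 0 < ℓ u v)
    (U : Finset V) (x y B α : ℝ) (hy : 0 < y) (hα : 1 ≤ α) (hB : 0 ≤ B)
    (IH : ∀ U' : Finset V, (U'.card : ℝ) ≤ y → ∃ σ, WordOn U' σ B ∧ Approx E ℓ U' σ α)
    (hU : (U.card : ℝ) ≤ x * y) (r : V → ℕ) (N J : ℕ) 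
    (hdiam : ∀ u ∈ U, ∀ v ∈ U, r u = r v → hd (rE E U) ℓ (2 * N - 1) u v < 2 * N - 1) :
    ∃ σ, WordOn U σ (2 * x + (J + 1) * B) ∧
      ∀ s t l, s ∈ U → IsWalk (rE E U) s t l → walkLen (back r) s l ≤ J →
        ∃ l', IsWalk E s t l' ∧ (s :: l').Sublist σ ∧
          ((walkLen ℓ s l' : ℝ) ≤ α * walkLen ℓ s l ∨
            walkLen ℓ s l' ≤ walkLen ℓ s l + 4 * (N - 1)) := by
  classical
  set fib : ℕ → Finset V := fun i => U.filter fun v => r v = i with hfib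
  set p := (∑ v ∈ U, r v) + 1 with hp
  have hlt : ∀ v ∈ U, r v < p := fun v hv => by
    have := Finset.single_le_sum (f := r) (fun i _ => Nat.zero_le _) hv
    omega
  set Lg : Finset ℕ := (U.image r).filter fun i => y < (fib i).card with hLg
  have hLgc : (Lg.card : ℝ) ≤ x := by
    have h1 : ∑ i ∈ Lg, ((fib i).card : ℝ) ≤ U.card := by
      have h2 : ∑ i ∈ U.image r, (fib i).card = U.card :=
        (Finset.card_eq_sum_card_image r U).symm
      have h3 : ∑ i ∈ Lg, (fib i).card ≤ ∑ i ∈ U.image r, (fib i).card :=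
        Finset.sum_le_sum_of_subset (Finset.filter_subset _ _)
      rw [h2] at h3
      exact_mod_cast h3
    have h4 : Lg.card • y ≤ ∑ i ∈ Lg, ((fib i).card : ℝ) :=
      Finset.card_nsmul_le_sum _ _ _ fun i hi => (Finset.mem_filter.1 hi).2.le
    rw [nsmul_eq_mul] at h4
    exact le_of_mul_le_mul_right (h4.trans (h1.trans hU)) hy
  have hτ : ∀ i, ∃ σ, WordOn (fib i) σ B ∧ (((fib i).card : ℝ) ≤ y → Approx E ℓ (fib i) σ α) := by
    intro i
    by_cases h : ((fib i).card : ℝ) ≤ y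
    · obtain ⟨σ, h1, h2⟩ := IH _ h
      exact ⟨σ, h1, fun _ => h2⟩
    · exact ⟨[], ⟨fun v => by simpa using hB, by simp⟩, fun h' => absurd h' h⟩
  choose τ hτ1 hτ2 using hτ
  have hst : ∀ i, ∃ σ : List V, (∀ v, σ.count v ≤ 2) ∧ (∀ v ∈ σ, v ∈ U) ∧
      (i ∈ Lg → ∃ c ∈ fib i, ∀ s t l1 l2, s ∈ U → IsWalk (rE E U) s c l1 → IsWalk (rE E U) c t l2 →
        ∃ l', IsWalk E s t l' ∧ (s :: l').Sublist σ ∧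
          walkLen ℓ s l' ≤ walkLen ℓ s l1 + walkLen ℓ c l2) := by
    intro i
    by_cases h : i ∈ Lg
    · obtain ⟨c, hc, hci⟩ := Finset.mem_image.1 (Finset.mem_filter.1 h).1
      obtain ⟨σ, h1, h2, h3⟩ := star (ℓ := ℓ) hpos U c hc
      exact ⟨σ, h1, h2, fun _ => ⟨c, Finset.mem_filter.2 ⟨hc, hci⟩, h3⟩⟩
    · exact ⟨[], by simp, by simp, fun h' => absurd h' h⟩
  choose ζ hζ1 hζ2 hζ3 using hst
  refine ⟨Lg.toList.flatMap ζ ++ (List.replicate (J + 1) ((List.range' 0 p).flatMap τ)).flatten,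
    ⟨?_, ?_⟩, ?_⟩
  · intro v
    rw [List.count_append]
    have h1 : (Lg.toList.flatMap ζ).count v ≤ Lg.card * 2 := by
      have := count_flatMap_le_mul Lg.toList ζ v 2 fun i _ => hζ1 i v
      simpa using this
    have h2 : (((List.range' 0 p).flatMap τ).count v : ℝ) ≤ B := by
      have h3 : ((List.range' 0 p).flatMap τ).count v ≤ (τ (r v)).count v := by
        apply count_flatMap_le _ (List.nodup_range' _)
        intro i hi
        rw [List.count_eq_zero]
        intro hv
        exact hi (Finset.mem_filter.1 ((hτ1 i).2 v hv)).2.symm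
      exact le_trans (by exact_mod_cast h3) ((hτ1 (r v)).1 v)
    have h4 : ((List.replicate (J + 1) ((List.range' 0 p).flatMap τ)).flatten.count v : ℝ)
        = (J + 1) * ((List.range' 0 p).flatMap τ).count v := by
      rw [List.count_flatten, List.map_replicate, List.sum_replicate]
      simp
    push_cast
    rw [h4]
    have h5 : ((Lg.toList.flatMap ζ).count v : ℝ) ≤ Lg.card * 2 := by exact_mod_cast h1
    have h6 : ((J : ℝ) + 1) * (((List.range' 0 p).flatMap τ).count v : ℝ) ≤ (J + 1) * B :=
      mul_le_mul_of_nonneg_left h2 (by positivity)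
    linarith
  · intro v hv
    rcases List.mem_append.1 hv with h | h
    · obtain ⟨i, -, hi⟩ := List.mem_flatMap.1 h
      exact hζ2 i v hi
    · obtain ⟨L, hL, hvL⟩ := List.mem_flatten.1 h
      rw [List.eq_of_mem_replicate hL] at hvL
      obtain ⟨i, -, hi⟩ := List.mem_flatMap.1 hvL
      exact (Finset.mem_filter.1 ((hτ1 i).2 v hi)).1
  · intro s t l hs w hb
    have hmem := rE_mem hs w
    by_cases hsm : ∀ z ∈ s :: l, ((fib (r z)).card : ℝ) ≤ y
    · have := layer_walk (E0 := rE E U) (E := E) (ℓ := ℓ) (fun _ _ h => h.1) r p τ α hα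
        (fun v => v ∈ U ∧ ((fib (r v)).card : ℝ) ≤ y) (fun v hv => hlt v hv.1) ?_ _ l s t J le_rfl w
        (fun z hz => ⟨hmem z hz, hsm z hz⟩) hb
      · obtain ⟨l', w', s', b'⟩ := this
        refine ⟨l', w', s'.trans ?_, Or.inl b'⟩
        refine List.Sublist.trans ?_ (List.sublist_append_right _ _)
        rw [List.replicate_succ, List.flatten_cons]
        unfold rem
        refine List.Sublist.append ?_ (List.Sublist.refl _)
        refine List.Sublist.flatMap ?_ τ
        have hsp := hlt s hs
        have e2 : p = r s + (p - r s) := by omega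
        conv_rhs => rw [e2, ← List.range'_append]
        have e3 : 0 + 1 * r s = r s := by omega
        rw [e3]
        exact List.sublist_append_right _ _
      · intro a b m wm hm
        have ha := hm a (by simp)
        refine hτ2 (r a) ha.1.2 a b m (Finset.mem_filter.2 ⟨ha.1.1, rfl⟩) ?_
        exact rE_of_mem (isWalk_mono (fun _ _ h => h.1) wm) fun z hz =>
          Finset.mem_filter.2 ⟨(hm z hz).1.1, (hm z hz).2⟩
    · push Not at hsm
      obtain ⟨z, hz, hzl⟩ := hsm
      have hzU := hmem z hz
      have hzLg : r z ∈ Lg := Finset.mem_filter.2 ⟨Finset.mem_image_of_mem _ hzU, hzl⟩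
      obtain ⟨c, hc, hstar⟩ := hζ3 _ hzLg
      obtain ⟨hcU, hcr⟩ := Finset.mem_filter.1 hc
      obtain ⟨l1, l2, e, w1, w2, -⟩ := isWalk_split w hz
      have walk : ∀ a ∈ U, ∀ b ∈ U, r a = r b → ∃ m, IsWalk (rE E U) a b m ∧
          walkLen ℓ a m ≤ 2 * (N - 1) := by
        intro a ha b hb hab
        have h1 := hdiam a ha b hb hab
        rcases hd_mem (rE E U) ℓ (2 * N - 1) a b with h2 | ⟨m, wm, hm⟩
        · omega
        · exact ⟨m, wm, by omega⟩
      obtain ⟨m1, wm1, hm1⟩ := walk z hzU c hcU hcr.symm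
      obtain ⟨m2, wm2, hm2⟩ := walk c hcU z hzU hcr
      obtain ⟨l', w', s', b'⟩ := hstar s t (l1 ++ m1) (m2 ++ l2) hs (isWalk_append w1 wm1)
        (isWalk_append wm2 w2)
      refine ⟨l', w', ?_, Or.inr ?_⟩
      · refine s'.trans (List.Sublist.trans ?_ (List.sublist_append_left _ _))
        have h := (List.singleton_sublist.2 (Finset.mem_toList.2 hzLg)).flatMap ζ
        simpa using h
      · rw [walkLen_append ℓ w1, walkLen_append ℓ wm2] at b'
        rw [e, walkLen_append ℓ w1]
        omega

end Layer

section Step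
variable {V : Type*}

/-- Number of times the step `(u, v)` occurs in a walk. -/
noncomputable def occ (u v : V) (s : V) (l : List V) : ℕ :=
  walkLen (fun a b => if a = u ∧ b = v then 1 else 0) s l

lemma occ_ne {E : V → V → Prop} {t u v : V} : ∀ {l : List V} {s : V}, IsWalk E s t l →
    occ u v s l ≠ 0 → E u v
  | [], s, _, h => by simp [occ, walkLen] at h
  | a :: l, s, hw, h => by
      by_cases hs : s = u ∧ a = v
      · rw [← hs.1, ← hs.2]; exact hw.1
      · refine occ_ne hw.2 ?_
        simp only [occ, walkLen, hs, if_false, zero_add] at h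
        exact h

lemma occ_sum {E : V → V → Prop} {U : Finset V} (f : V → V → ℕ) {t : V} :
    ∀ {l : List V} {s : V}, IsWalk (rE E U) s t l →
      ∑ u ∈ U, ∑ v ∈ U, occ u v s l * f u v = walkLen f s l
  | [], s, _ => by simp [occ, walkLen]
  | a :: l, s, hw => by
      have ih := occ_sum f hw.2
      have h1 : ∀ u v, occ u v s (a :: l) * f u v =
          (if s = u then (if a = v then f u v else 0) else 0) + occ u v a l * f u v := by
        intro u v
        simp only [occ, walkLen, add_mul]
        congr 1
        by_cases h1 : s = u <;> by_cases h2 : a = v <;> simp [h1, h2]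
      simp only [h1, Finset.sum_add_distrib, ih, walkLen]
      congr 1
      rw [Finset.sum_eq_single s]
      · simp [hw.1.2.2]
      · intro b _ hb; simp [Ne.symm hb]
      · intro h; exact absurd hw.1.2.1 h

lemma half_good {E : V → V → Prop} {ℓ : V → V → ℕ} (U : Finset V) (D : ℕ) (hD : 1 ≤ D)
    (S : Finset (V × V)) (hS : S.Nonempty) (P : V × V → List V)
    (hP : ∀ q ∈ S, q.1 ∈ U ∧ IsWalk (rE E U) q.1 q.2 (P q) ∧ walkLen ℓ q.1 (P q) ≤ D)
    (G η : ℝ) (hη : 0 < η) (hG : Real.logb 2 (3 * U.card * S.card * D) ≤ G)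
    (N J : ℕ) (hN : 0 < N) (hND : η * D ≤ N) (hJ : 2 * (3 * G ^ 2 / η) ≤ J + 1) :
    ∃ r : V → ℕ, 
      (∀ u ∈ U, ∀ v ∈ U, r u = r v → hd (rE E U) ℓ (2 * N - 1) u v < 2 * N - 1) ∧
      2 * (S.filter fun q => ¬ walkLen (back r) q.1 (P q) ≤ J).card ≤ S.card := by
  classical
  set m : ℝ := (U.card : ℝ) with hm
  have hm1 : 1 ≤ m := by
    obtain ⟨q, hq⟩ := hS
    have : 0 < U.card := Finset.card_pos.2 ⟨_, (hP q hq).1⟩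
    rw [hm]; exact_mod_cast this
  have hS1 : (1 : ℝ) ≤ S.card := by exact_mod_cast Finset.card_pos.2 hS
  have hD1 : (1 : ℝ) ≤ D := by exact_mod_cast hD
  set c : V → V → ℝ := fun u v => m * ∑ q ∈ S, (occ u v q.1 (P q) : ℝ) with hc
  have hc0 : ∀ u v, 0 ≤ c u v := fun u v => by simp only [hc]; positivity
  have hsum : ∀ f : V → V → ℕ, ∑ u ∈ U, ∑ v ∈ U, c u v * f u v =
      m * ∑ q ∈ S, (walkLen f q.1 (P q) : ℝ) := by
    intro f
    have h1 : ∀ q ∈ S, (walkLen f q.1 (P q) : ℝ) =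
        ∑ u ∈ U, ∑ v ∈ U, (occ u v q.1 (P q) : ℝ) * f u v := by
      intro q hq
      rw [← occ_sum f (hP q hq).2.1]; push_cast; rfl
    have h2 : ∑ q ∈ S, (walkLen f q.1 (P q) : ℝ) =
        ∑ u ∈ U, ∑ v ∈ U, ∑ q ∈ S, (occ u v q.1 (P q) : ℝ) * f u v := by
      rw [Finset.sum_congr rfl h1, Finset.sum_comm]
      exact Finset.sum_congr rfl fun u _ => Finset.sum_comm
    rw [h2, Finset.mul_sum]
    refine Finset.sum_congr rfl fun u _ => ?_
    rw [Finset.mul_sum]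
    refine Finset.sum_congr rfl fun v _ => ?_
    simp only [hc]
    rw [← Finset.sum_mul]; ring
  have hcE : ∀ u v, c u v ≠ 0 → rE E U u v := by
    intro u v h
    by_contra hne
    apply h
    simp only [hc]
    rw [Finset.sum_eq_zero, mul_zero]
    intro q hq
    by_contra h2
    exact hne (occ_ne (hP q hq).2.1 (by exact_mod_cast h2))
  set w : V → ℝ := fun v => 1 + ∑ u ∈ U, c v u * ℓ v u + ∑ u ∈ U, c u v * ℓ u v with hw
  set W : ℝ := 3 * m * S.card * D with hW
  have hW1 : 1 ≤ W := by
    have h1 : 1 ≤ m * S.card := one_le_mul_of_one_le_of_one_le hm1 hS1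
    have h2 : 1 ≤ m * S.card * D := one_le_mul_of_one_le_of_one_le h1 hD1
    rw [hW]; linarith
  have hG0 : 0 ≤ G := (Real.logb_nonneg (by norm_num) hW1).trans hG
  have hK : Real.log W ≤ G := by
    have h1 : Real.log W = Real.logb 2 W * Real.log 2 := by
      rw [Real.logb, div_mul_cancel₀]; exact (Real.log_pos (by norm_num)).ne'
    rw [h1]
    have h2 : Real.log 2 ≤ 1 := by linarith [Real.log_two_lt_d9]
    have h3 := Real.logb_nonneg (b := 2) (by norm_num) hW1
    calc Real.logb 2 W * Real.log 2 ≤ Real.logb 2 W * 1 := mul_le_mul_of_nonneg_left h2 h3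
      _ ≤ G := by simpa using hG
  have hwsum : ∑ v ∈ U, w v ≤ W := by
    simp only [hw, Finset.sum_add_distrib]
    have e2 : ∑ v ∈ U, ∑ u ∈ U, c u v * (ℓ u v : ℝ) = ∑ u ∈ U, ∑ v ∈ U, c u v * (ℓ u v : ℝ) :=
      Finset.sum_comm
    rw [e2, hsum ℓ]
    have h1 : ∑ q ∈ S, (walkLen ℓ q.1 (P q) : ℝ) ≤ S.card * D := by
      have := Finset.sum_le_card_nsmul S (fun q => (walkLen ℓ q.1 (P q) : ℝ)) D
        (fun q hq => by exact_mod_cast (hP q hq).2.2)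
      simpa using this
    have h2 := mul_le_mul_of_nonneg_left h1 (by linarith : 0 ≤ m)
    have h3 : 1 ≤ (S.card : ℝ) * D := one_le_mul_of_one_le_of_one_le hS1 hD1
    have h4 := mul_le_mul_of_nonneg_left h3 (by linarith : 0 ≤ m)
    have h5 : ∑ v ∈ U, (1 : ℝ) = m := by simp [hm]
    rw [h5, hW]
    nlinarith
  have hw1 : ∀ v ∈ U, 1 + ∑ u ∈ U, c v u * ℓ v u ≤ w v := fun v _ => by
    have : 0 ≤ ∑ u ∈ U, c u v * (ℓ u v : ℝ) :=
      Finset.sum_nonneg fun u _ => mul_nonneg (hc0 _ _) (Nat.cast_nonneg _)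
    simp only [hw]; linarith
  have hw2 : ∀ v ∈ U, 1 + ∑ u ∈ U, c u v * ℓ u v ≤ w v := fun v _ => by
    have : 0 ≤ ∑ u ∈ U, c v u * (ℓ v u : ℝ) :=
      Finset.sum_nonneg fun u _ => mul_nonneg (hc0 _ _) (Nat.cast_nonneg _)
    simp only [hw]; linarith
  obtain ⟨r, hr1, hr2⟩ := ldd c hc0 ℓ (hd (rE E U) ℓ (2 * N - 1)) (fun s => hd_self _ _ _ s)
    (fun s u v h => hd_tri _ s (hcE u v h)) N hN G W hG0 (by linarith) hK w _ U rfl hw1 hw2 hwsum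
  refine ⟨r, hr1, ?_⟩
  have hback : ∑ u ∈ U, ∑ v ∈ U, (if r v < r u then c u v else 0) =
      m * ∑ q ∈ S, (walkLen (back r) q.1 (P q) : ℝ) := by
    rw [← hsum]
    refine Finset.sum_congr rfl fun u _ => Finset.sum_congr rfl fun v _ => ?_
    simp only [back]; split_ifs <;> simp
  rw [hback] at hr2
  have hNpos : (0 : ℝ) < N := by exact_mod_cast hN
  have hws1 : 1 ≤ ∑ v ∈ U, w v := by
    have h1 : ∑ v ∈ U, (1 : ℝ) ≤ ∑ v ∈ U, w v := Finset.sum_le_sum fun v hv => by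
      have := hw1 v hv
      have : 0 ≤ ∑ u ∈ U, c v u * (ℓ v u : ℝ) :=
        Finset.sum_nonneg fun u _ => mul_nonneg (hc0 _ _) (Nat.cast_nonneg _)
      linarith
    have h5 : ∑ v ∈ U, (1 : ℝ) = m := by simp [hm]
    linarith
  have hl : (∑ v ∈ U, w v) * Real.logb 2 (∑ v ∈ U, w v) ≤ W * G := by
    refine mul_le_mul hwsum ?_ (Real.logb_nonneg (by norm_num) hws1) (by linarith)
    exact (Real.logb_le_logb_of_le (by norm_num) (by linarith) hwsum).trans hG
  have htot : ∑ q ∈ S, (walkLen (back r) q.1 (P q) : ℝ) ≤ 3 * G ^ 2 / η * S.card := by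
    have h1 := hr2.trans (mul_le_mul_of_nonneg_left hl (by positivity : 0 ≤ G / N))
    have h2 : G / N * (W * G) = m * (3 * G ^ 2 * S.card * (D / N)) := by
      rw [hW]; field_simp
    rw [h2] at h1
    have h3 := le_of_mul_le_mul_left h1 (by linarith : 0 < m)
    have h4 : (D : ℝ) / N ≤ 1 / η := by
      rw [div_le_div_iff₀ hNpos hη]; linarith
    calc _ ≤ 3 * G ^ 2 * S.card * (D / N) := h3
      _ ≤ 3 * G ^ 2 * S.card * (1 / η) := mul_le_mul_of_nonneg_left h4 (by positivity)
      _ = _ := by ring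
  set bad := S.filter fun q => ¬ walkLen (back r) q.1 (P q) ≤ J with hbad
  have hb : (bad.card : ℝ) * (J + 1) ≤ ∑ q ∈ S, (walkLen (back r) q.1 (P q) : ℝ) := by
    have h1 : bad.card • ((J : ℝ) + 1) ≤ ∑ q ∈ bad, (walkLen (back r) q.1 (P q) : ℝ) := by
      refine Finset.card_nsmul_le_sum _ _ _ fun q hq => ?_
      have := (Finset.mem_filter.1 hq).2
      have : J + 1 ≤ walkLen (back r) q.1 (P q) := by omega
      exact_mod_cast this
    rw [nsmul_eq_mul] at h1
    exact h1.trans (Finset.sum_le_sum_of_subset_of_nonneg (Finset.filter_subset _ _)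
      fun _ _ _ => Nat.cast_nonneg _)
  have h1 : (bad.card : ℝ) * (J + 1) * 2 ≤ (J + 1) * S.card := by
    have := mul_le_mul_of_nonneg_right hJ (Nat.cast_nonneg S.card : (0:ℝ) ≤ S.card)
    nlinarith
  have h2 : ((2 * bad.card : ℕ) : ℝ) ≤ S.card := by
    have : (0 : ℝ) < J + 1 := by positivity
    push_cast
    refine le_of_mul_le_mul_left ?_ this
    linarith
  exact_mod_cast h2

lemma WordOn.append {U : Finset V} {σ1 σ2 : List V} {B1 B2 : ℝ} (h1 : WordOn U σ1 B1)
    (h2 : WordOn U σ2 B2) : WordOn U (σ1 ++ σ2) (B1 + B2) := by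
  refine ⟨fun v => ?_, fun v hv => ?_⟩
  · rw [List.count_append]; push_cast; exact add_le_add (h1.1 v) (h2.1 v)
  · rcases List.mem_append.1 hv with h | h
    · exact h1.2 v h
    · exact h2.2 v h

lemma halving {Q : Type*} (U : Finset V) (good : List V → Q → Prop)
    (hmono : ∀ σ σ' q, σ.Sublist σ' → good σ q → good σ' q) (B : ℝ) (S : Finset Q)
    (H : ∀ S' ⊆ S, S'.Nonempty → ∃ σ, WordOn U σ B ∧ 2 * (S'.filter fun q => ¬ good σ q).card ≤ S'.card) :
    ∀ (T : ℕ) (S' : Finset Q), S' ⊆ S → S'.card < 2 ^ T → 0 ≤ B →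
      ∃ σ, WordOn U σ (T * B) ∧ ∀ q ∈ S', good σ q := by
  intro T
  induction T with
  | zero =>
    intro S' _ hc _
    have : S' = ∅ := by simpa using hc
    exact ⟨[], ⟨by simp, by simp⟩, by simp [this]⟩
  | succ T ih =>
    intro S' hS' hc hB
    rcases S'.eq_empty_or_nonempty with rfl | hne
    · exact ⟨[], ⟨fun v => by simp only [List.count_nil, Nat.cast_zero]; positivity, by simp⟩, by simp⟩
    obtain ⟨σ1, w1, h1⟩ := H S' hS' hne
    obtain ⟨σ2, w2, h2⟩ := ih (S'.filter fun q => ¬ good σ1 q)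
      ((Finset.filter_subset _ _).trans hS') (by rw [pow_succ] at hc; omega) hB
    refine ⟨σ1 ++ σ2, ?_, fun q hq => ?_⟩
    · have := w1.append w2
      have e : B + T * B = (T + 1 : ℕ) * B := by push_cast; ring
      rwa [e] at this
    · by_cases hg : good σ1 q
      · exact hmono _ _ q (List.sublist_append_left _ _) hg
      · exact hmono _ _ q (List.sublist_append_right _ _) (h2 q (Finset.mem_filter.2 ⟨hq, hg⟩))

lemma WordOn.flatMap {ι : Type*} {U : Finset V} {B : ℝ} (τ : ι → List V) :
    ∀ I : List ι, (∀ i ∈ I, WordOn U (τ i) B) → WordOn U (I.flatMap τ) (I.length * B)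
  | [], _ => ⟨by simp, by simp⟩
  | a :: I, h => by
      have ih := WordOn.flatMap τ I fun i hi => h i (List.mem_cons_of_mem _ hi)
      have := (h a (by simp)).append ih
      rw [List.flatMap_cons]
      have e : B + (I.length : ℝ) * B = ((a :: I).length : ℝ) * B := by
        simp only [List.length_cons]; push_cast; ring
      rwa [e] at this

lemma step {E : V → V → Prop} {ℓ : V → V → ℕ} (hpos : ∀ u v, E u v → 0 < ℓ u v)
    (Λ k : ℕ) (hlen : ∀ u v, E u v → ℓ u v ≤ 2 ^ (k * Λ))
    (x y B α η : ℝ) (hy : 0 < y) (hα : 1 ≤ α) (hB : 1 ≤ B) (hx : x ≤ B) (hη : 0 < η)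
    (IH : ∀ U' : Finset V, (U'.card : ℝ) ≤ y → ∃ σ, WordOn U' σ B ∧ Approx E ℓ U' σ α)
    (J : ℕ) (hJ : 48 * ((k + 4) * Λ + 2 : ℝ) ^ 2 / η ≤ J + 1)
    (U : Finset V) (hU : (U.card : ℝ) ≤ x * y) (hUΛ : U.card ≤ 2 ^ Λ) :
    ∃ σ, WordOn U σ ((1 + ((k + 1) * Λ + 1) * (2 * Λ + 1) * (3 + J)) * B) ∧
      Approx E ℓ U σ (α * (1 + η)) := by
  classical
  have hP : ∀ q : V × V, ∃ P : List V, (∃ l, IsWalk (rE E U) q.1 q.2 l) →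
      IsWalk (rE E U) q.1 q.2 P ∧ (q.1 :: P).Nodup ∧
      ∀ l', IsWalk (rE E U) q.1 q.2 l' → walkLen ℓ q.1 P ≤ walkLen ℓ q.1 l' := by
    intro q
    by_cases h : ∃ l, IsWalk (rE E U) q.1 q.2 l
    · obtain ⟨l, hl⟩ := h
      obtain ⟨P, hP⟩ := exists_shortest ℓ hl
      exact ⟨P, fun _ => hP⟩
    · exact ⟨[], fun h' => absurd h' h⟩
  choose P hP using hP
  set I := (k + 1) * Λ with hI
  have hscale : ∀ i ∈ List.range (I + 1), ∃ σ, WordOn U σ (((2 * Λ + 1 : ℕ) : ℝ) * ((3 + J) * B)) ∧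
      ∀ s ∈ U, ∀ t, (∃ l, IsWalk (rE E U) s t l) → walkLen ℓ s (P (s, t)) ≤ 2 ^ i →
        2 ^ i ≤ 2 * walkLen ℓ s (P (s, t)) →
        ∃ l', IsWalk E s t l' ∧ (s :: l').Sublist σ ∧
          (walkLen ℓ s l' : ℝ) ≤ α * (1 + η) * walkLen ℓ s (P (s, t)) := by
    intro i hi
    have hi' : i ≤ I := by simpa [Nat.lt_succ_iff] using hi
    set S : Finset (V × V) := (U ×ˢ U).filter fun q => (∃ l, IsWalk (rE E U) q.1 q.2 l) ∧
      walkLen ℓ q.1 (P q) ≤ 2 ^ i ∧ 2 ^ i ≤ 2 * walkLen ℓ q.1 (P q) with hS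
    have hScard : S.card ≤ 2 ^ (2 * Λ) := by
      calc S.card ≤ (U ×ˢ U).card := Finset.card_filter_le _ _
        _ = U.card * U.card := Finset.card_product _ _
        _ ≤ 2 ^ Λ * 2 ^ Λ := Nat.mul_le_mul hUΛ hUΛ
        _ = 2 ^ (2 * Λ) := by rw [← pow_add]; congr 1; ring
    have := halving (Q := V × V) U (fun σ q => ∃ l', IsWalk E q.1 q.2 l' ∧ (q.1 :: l').Sublist σ ∧
          (walkLen ℓ q.1 l' : ℝ) ≤ α * (1 + η) * walkLen ℓ q.1 (P q)) ?_ ((3 + J) * B) S ?_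
          (2 * Λ + 1) S subset_rfl (by rw [pow_succ]; have := Nat.two_pow_pos (2 * Λ); omega)
          (by positivity)
    · obtain ⟨σ, w, h⟩ := this
      refine ⟨σ, w, fun s hs t hl h1 h2 => h (s, t) ?_⟩
      have ht : t ∈ U := by
        obtain ⟨l, hl⟩ := hl
        obtain ⟨X, hX⟩ := isWalk_end hl
        exact rE_mem hs hl t (by rw [hX]; simp)
      exact Finset.mem_filter.2 ⟨Finset.mem_product.2 ⟨hs, ht⟩, hl, h1, h2⟩
    · rintro σ σ' q hsub ⟨l', a, b, c⟩
      exact ⟨l', a, b.trans hsub, c⟩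
    · intro S' hS' hne
      have hSP : ∀ q ∈ S', q.1 ∈ U ∧ IsWalk (rE E U) q.1 q.2 (P q) ∧ walkLen ℓ q.1 (P q) ≤ 2 ^ i ∧
          2 ^ i ≤ 2 * walkLen ℓ q.1 (P q) := by
        intro q hq
        obtain ⟨h1, h2, h3, h4⟩ := Finset.mem_filter.1 (hS' hq)
        exact ⟨(Finset.mem_product.1 h1).1, (hP q h2).1, h3, h4⟩
      have hDpos : (0 : ℝ) < ((2 ^ i : ℕ) : ℝ) := by positivity
      set N := ⌈η / 8 * ((2 ^ i : ℕ) : ℝ)⌉₊ with hN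
      have hN0 : 0 < N := Nat.ceil_pos.2 (by positivity)
      have hUpos : 0 < U.card := by
        obtain ⟨q, hq⟩ := hne
        exact Finset.card_pos.2 ⟨_, (hSP q hq).1⟩
      have hGg : Real.logb 2 (3 * U.card * S'.card * ((2 ^ i : ℕ) : ℝ)) ≤
          (((k : ℝ) + 4) * Λ + 2) := by
        have hSc : 0 < S'.card := Finset.card_pos.2 hne
        have hle : 3 * U.card * S'.card * 2 ^ i ≤ 2 ^ ((k + 4) * Λ + 2) := by
          have h1 : S'.card ≤ 2 ^ (2 * Λ) := (Finset.card_le_card hS').trans hScard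
          have h2 : 2 ^ i ≤ 2 ^ I := Nat.pow_le_pow_right (by norm_num) hi'
          calc 3 * U.card * S'.card * 2 ^ i ≤ 2 ^ 2 * 2 ^ Λ * 2 ^ (2 * Λ) * 2 ^ I := by
                gcongr; norm_num
            _ = 2 ^ ((k + 4) * Λ + 2) := by
                rw [← pow_add, ← pow_add, ← pow_add]; congr 1; rw [hI]; ring
        have h0 : (0 : ℝ) < 3 * U.card * S'.card * ((2 ^ i : ℕ) : ℝ) := by positivity
        have h3 : (3 * U.card * S'.card * ((2 ^ i : ℕ) : ℝ)) ≤ (2 : ℝ) ^ ((k + 4) * Λ + 2) := by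
          exact_mod_cast hle
        calc _ ≤ Real.logb 2 ((2 : ℝ) ^ ((k + 4) * Λ + 2)) :=
              Real.logb_le_logb_of_le (by norm_num) h0 h3
          _ = _ := by
              rw [Real.logb_pow]
              rw [Real.logb_self_eq_one (by norm_num)]
              push_cast; ring
      have hJJ : 2 * (3 * (((k : ℝ) + 4) * Λ + 2) ^ 2 / (η / 8)) ≤ J + 1 := by
        refine le_trans (le_of_eq ?_) hJ
        field_simp
        ring
      obtain ⟨r, hr1, hr2⟩ := half_good (E := E) (ℓ := ℓ) U (2 ^ i) Nat.one_le_two_pow S' hne P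
        (fun q hq => ⟨(hSP q hq).1, (hSP q hq).2.1, (hSP q hq).2.2.1⟩)
        ((k + 4) * Λ + 2) (η / 8) (by positivity) hGg N J hN0 (Nat.le_ceil _) hJJ
      · obtain ⟨σ, w, h⟩ := one_partition hpos U x y B α hy hα (by linarith) IH hU r N J hr1
        refine ⟨σ, ⟨fun v => (w.1 v).trans ?_, w.2⟩, le_trans ?_ hr2⟩
        · nlinarith
        · refine Nat.mul_le_mul_left 2 (Finset.card_le_card ?_)
          intro q hq
          obtain ⟨hq1, hq2⟩ := Finset.mem_filter.1 hq
          refine Finset.mem_filter.2 ⟨hq1, fun hle => hq2 ?_⟩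
          obtain ⟨a1, a2, a3, a4⟩ := hSP q hq1
          obtain ⟨l', w', s', b'⟩ := h q.1 q.2 (P q) a1 a2 hle
          refine ⟨l', w', s', ?_⟩
          have hL0 : (0 : ℝ) ≤ walkLen ℓ q.1 (P q) := Nat.cast_nonneg _
          rcases b' with b' | b'
          · refine b'.trans (mul_le_mul_of_nonneg_right ?_ hL0)
            nlinarith
          · have hNlt : (N : ℝ) < η / 8 * ((2 ^ i : ℕ) : ℝ) + 1 := Nat.ceil_lt_add_one (by positivity)
            have h5 : (walkLen ℓ q.1 l' : ℝ) ≤ walkLen ℓ q.1 (P q) + 4 * (N - 1) := by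
              have : ((N - 1 : ℕ) : ℝ) = (N : ℝ) - 1 := by
                rw [Nat.cast_sub hN0]; simp
              rw [← this]; exact_mod_cast b'
            have h6 : ((2 ^ i : ℕ) : ℝ) ≤ 2 * walkLen ℓ q.1 (P q) := by exact_mod_cast a4
            have h7 : η * ((2 ^ i : ℕ) : ℝ) ≤ η * (2 * walkLen ℓ q.1 (P q)) :=
              mul_le_mul_of_nonneg_left h6 hη.le
            have h8 : (walkLen ℓ q.1 l' : ℝ) ≤ (1 + η) * walkLen ℓ q.1 (P q) := by linarith
            refine h8.trans (mul_le_mul_of_nonneg_right ?_ hL0)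
            nlinarith
  choose! σs hσ1 hσ2 using hscale
  refine ⟨U.toList ++ (List.range (I + 1)).flatMap σs, ?_, ?_⟩
  · have h1 : WordOn U U.toList B := by
      refine ⟨fun v => le_trans ?_ hB, by simp⟩
      exact_mod_cast List.nodup_iff_count_le_one.1 U.nodup_toList v
    have h2 := h1.append (WordOn.flatMap σs _ hσ1)
    have e : B + ((List.range (I + 1)).length : ℝ) * (((2 * Λ + 1 : ℕ) : ℝ) * ((3 + J) * B)) =
        (1 + ((k + 1) * Λ + 1) * (2 * Λ + 1) * (3 + J)) * B := by
      rw [List.length_range, hI]; push_cast; ring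
    rwa [e] at h2
  · intro s t l hs w
    obtain ⟨w0, nd0, hmin⟩ := hP (s, t) ⟨l, w⟩
    have hle : (walkLen ℓ s (P (s, t)) : ℝ) ≤ walkLen ℓ s l := by exact_mod_cast hmin l w
    by_cases hL : walkLen ℓ s (P (s, t)) = 0
    · have hst : s = t := by
        cases hPe : P (s, t) with
        | nil => rw [hPe] at w0; exact w0
        | cons a r =>
          rw [hPe] at w0 hL
          have := hpos _ _ w0.1.1
          simp only [walkLen] at hL
          simp only at this
          omega
      refine ⟨[], hst, ?_, ?_⟩
      · exact (List.singleton_sublist.2 (Finset.mem_toList.2 hs)).trans (List.sublist_append_left _ _)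
      · simp only [walkLen, Nat.cast_zero]; positivity
    · set L := walkLen ℓ s (P (s, t)) with hLdef
      have hLI : L ≤ 2 ^ I := by
        have h1 : L ≤ (P (s, t)).length * 2 ^ (k * Λ) :=
          walkLen_le (fun u v (h : rE E U u v) => hlen u v h.1) w0
        have h2 : (P (s, t)).length ≤ U.card := by
          have h3 : (s :: P (s, t)).toFinset ⊆ U := fun z hz =>
            rE_mem hs w0 z (List.mem_toFinset.1 hz)
          have h4 := Finset.card_le_card h3
          rw [List.toFinset_card_of_nodup nd0, List.length_cons] at h4
          omega
        calc L ≤ 2 ^ Λ * 2 ^ (k * Λ) := h1.trans (Nat.mul_le_mul_right _ (h2.trans hUΛ))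
          _ = 2 ^ I := by rw [← pow_add, hI]; congr 1; ring
      have hi : Nat.clog 2 L ≤ I := Nat.clog_le_of_le_pow hLI
      have h1 : L ≤ 2 ^ Nat.clog 2 L := Nat.le_pow_clog (by norm_num) L
      have h2 : 2 ^ Nat.clog 2 L ≤ 2 * L := by
        by_cases h1L : 1 < L
        · have h3 := Nat.pow_pred_clog_lt_self (b := 2) (by norm_num) h1L
          have h4 : 0 < Nat.clog 2 L := Nat.clog_pos (by norm_num) h1L
          have e : Nat.clog 2 L = (Nat.clog 2 L).pred + 1 := by
            rw [Nat.pred_eq_sub_one]; omega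
          rw [e, pow_succ]; omega
        · have : L = 1 := by omega
          simp [this]
      have hir : Nat.clog 2 L ∈ List.range (I + 1) := by simp; omega
      obtain ⟨l', w', s', b'⟩ := hσ2 _ hir s hs t ⟨l, w⟩ h1 h2
      refine ⟨l', w', s'.trans ?_, b'.trans ?_⟩
      · refine List.Sublist.trans ?_ (List.sublist_append_right _ _)
        have h := (List.singleton_sublist.2 hir).flatMap σs
        simpa using h
      · exact mul_le_mul_of_nonneg_left hle (by positivity)

end Step

section Final
variable {V : Type*}

lemma count_flatten_replicate (L : List V) (v : V) : ∀ p : ℕ,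
    ((List.replicate p L).flatten).count v = p * L.count v
  | 0 => by simp
  | p + 1 => by
      rw [List.replicate_succ, List.flatten_cons, List.count_append, count_flatten_replicate L v p]
      ring

lemma base_case (E : V → V → Prop) (ℓ : V → V → ℕ) (U : Finset V) (x : ℝ)
    (hU : (U.card : ℝ) ≤ x) : ∃ σ, WordOn U σ x ∧ Approx E ℓ U σ 1 := by
  classical
  refine ⟨(List.replicate U.card U.toList).flatten, ⟨fun v => le_trans ?_ hU, ?_⟩, ?_⟩
  · rw [count_flatten_replicate]
    have := List.nodup_iff_count_le_one.1 U.nodup_toList v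
    exact_mod_cast (Nat.mul_le_mul_left U.card this).trans (by simp)
  · intro v hv
    obtain ⟨L, hL, hv⟩ := List.mem_flatten.1 hv
    rw [(List.mem_replicate.1 hL).2] at hv
    exact Finset.mem_toList.1 hv
  · intro s t l hs w
    obtain ⟨l', w', nd, hl⟩ := exists_simple ℓ w
    have hm := rE_mem hs w'
    refine ⟨l', isWalk_mono (fun _ _ h => h.1) w', ?_, ?_⟩
    · refine sublist_replicate _ _ _ (fun y hy => Finset.mem_toList.2 (hm y hy)) ?_
      rw [← List.toFinset_card_of_nodup nd]
      exact Finset.card_le_card fun y hy => hm y (List.mem_toFinset.1 hy)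
    · rw [one_mul]; exact_mod_cast hl

lemma iterate {E : V → V → Prop} {ℓ : V → V → ℕ} (hpos : ∀ u v, E u v → 0 < ℓ u v)
    (Λ k : ℕ) (hlen : ∀ u v, E u v → ℓ u v ≤ 2 ^ (k * Λ))
    (x η : ℝ) (hx : 1 ≤ x) (hη : 0 < η)
    (J : ℕ) (hJ : 48 * ((k + 4) * Λ + 2 : ℝ) ^ 2 / η ≤ J + 1)
    (hΛ : ∀ U : Finset V, U.card ≤ 2 ^ Λ) (j : ℕ) :
    ∀ U : Finset V, (U.card : ℝ) ≤ x ^ (j + 1) →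
      ∃ σ, WordOn U σ ((1 + ((k + 1) * Λ + 1) * (2 * Λ + 1) * (3 + J)) ^ j * x) ∧
        Approx E ℓ U σ ((1 + η) ^ j) := by
  induction j with
  | zero => intro U hU; simpa using base_case E ℓ U x (by simpa using hU)
  | succ j ih =>
    intro U hU
    set A : ℝ := (1 + ((k + 1) * Λ + 1) * (2 * Λ + 1) * (3 + J)) with hA
    have hA1 : 1 ≤ A := by
      have : (0 : ℝ) ≤ ((k + 1) * Λ + 1) * (2 * Λ + 1) * (3 + J) := by positivity
      linarith
    have hAj : 1 ≤ A ^ j := one_le_pow₀ hA1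
    have hxB : x ≤ A ^ j * x := le_mul_of_one_le_left (by linarith) hAj
    have := step hpos Λ k hlen x (x ^ (j + 1)) (A ^ j * x) ((1 + η) ^ j) η (by positivity)
      (one_le_pow₀ (by linarith)) (hx.trans hxB) hxB hη ih J hJ U
      (by rw [← pow_succ']; exact hU) (hΛ U)
    rw [← hA] at this
    rw [pow_succ' A, mul_assoc, pow_succ (1 + η)]
    exact this

lemma walk_map {W : Type*} {E : V → V → Prop} {F : W → W → Prop} {ℓ : V → V → ℕ} {m : W → W → ℕ}
    (π : W → V) (h : ∀ x y, F x y → E (π x) (π y) ∧ m x y = ℓ (π x) (π y)) {t : W} :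
    ∀ {l : List W} {s : W}, IsWalk F s t l →
      IsWalk E (π s) (π t) (l.map π) ∧ walkLen ℓ (π s) (l.map π) = walkLen m s l
  | [], s, w => by
      have : s = t := w
      subst this
      exact ⟨rfl, rfl⟩
  | a :: l, s, w => by
      obtain ⟨h1, h2⟩ := walk_map π h w.2
      obtain ⟨h3, h4⟩ := h _ _ w.1
      exact ⟨⟨h3, h1⟩, by simp only [List.map_cons, walkLen, h2, h4]⟩

lemma walk_lift {E : V → V → Prop} {ℓ : V → V → ℕ} {n : ℕ} (π : Fin n → V) {t : V} :
    ∀ {is : List (Fin n)} {i : Fin n}, IsWalk E (π i) t (is.map π) →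
      (i :: is).Pairwise (· < ·) →
      ∃ j, π j = t ∧ IsWalk (fun a b => a < b ∧ E (π a) (π b)) i j is ∧
        walkLen (fun a b => ℓ (π a) (π b)) i is = walkLen ℓ (π i) (is.map π)
  | [], i, w, _ => ⟨i, w, rfl, rfl⟩
  | a :: is, i, w, hp => by
      rw [List.pairwise_cons] at hp
      obtain ⟨j, h1, h2, h3⟩ := walk_lift (ℓ := ℓ) π w.2 hp.2
      exact ⟨j, h1, ⟨⟨hp.1 a (by simp), w.1⟩, h2⟩, by simp only [List.map_cons, walkLen, h3]⟩

lemma fiber_ncard (σ : List V) (v : V) : (σ.get ⁻¹' {v}).ncard = σ.count v := by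
  have h1 : σ.get ⁻¹' {v} = ((Finset.univ.filter fun i => σ.get i = v : Finset (Fin σ.length)) : Set _) := by
    ext i; simp
  rw [h1, Set.ncard_coe_finset]
  conv_rhs => rw [← List.map_get_finRange σ]
  rw [List.count_eq_countP, List.countP_map, List.countP_eq_length_filter]
  rw [← List.toFinset_card_of_nodup ((List.nodup_finRange _).filter _)]
  congr 1
  ext i
  simp

lemma convert_word [Finite V] (E : V → V → Prop) (ℓ : V → V → ℕ) (σ : List V) (U : Finset V)
    (hU : ∀ v, v ∈ U) (ε : ℝ) (hε : 0 < ε) (h : Approx E ℓ U σ (1 + ε)) :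
    IsDag (fun a b : Fin σ.length => a < b ∧ E (σ.get a) (σ.get b)) ∧
    ∀ s t : V,
      gdist E ℓ s t ≤ gdistSet (fun a b : Fin σ.length => a < b ∧ E (σ.get a) (σ.get b))
        (fun a b => ℓ (σ.get a) (σ.get b)) (σ.get ⁻¹' {s}) (σ.get ⁻¹' {t}) ∧
      gdistSet (fun a b : Fin σ.length => a < b ∧ E (σ.get a) (σ.get b))
        (fun a b => ℓ (σ.get a) (σ.get b)) (σ.get ⁻¹' {s}) (σ.get ⁻¹' {t}) ≤
        (1 + ENNReal.ofReal ε) * gdist E ℓ s t := by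
  refine ⟨?_, fun s t => ⟨?_, ?_⟩⟩
  · intro x hx
    have key : ∀ y, Relation.TransGen (fun a b : Fin σ.length => a < b ∧ E (σ.get a) (σ.get b)) x y →
        x < y := by
      intro y hy
      induction hy with
      | single h => exact h.1
      | tail _ h ih => exact ih.trans h.1
    exact lt_irrefl _ (key x hx)
  · unfold gdistSet
    refine le_iInf₂ fun a ha => le_iInf₂ fun b hb => ?_
    have ha : σ.get a = s := ha
    have hb : σ.get b = t := hb
    unfold gdist
    refine le_iInf₂ fun l w => ?_
    obtain ⟨h1, h2⟩ := walk_map (E := E) (ℓ := ℓ) (m := fun a b => ℓ (σ.get a) (σ.get b)) σ.get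
      (fun x y hxy => ⟨hxy.2, rfl⟩) w
    rw [ha, hb] at h1
    rw [ha] at h2
    exact (iInf₂_le _ h1).trans (by rw [h2])
  · by_cases hex : ∃ l, IsWalk E s t l
    · obtain ⟨l, hl⟩ := hex
      obtain ⟨l0, w0, -, hmin⟩ := exists_shortest ℓ hl
      have hg : gdist E ℓ s t = (walkLen ℓ s l0 : ℝ≥0∞) := by
        apply le_antisymm
        · exact iInf₂_le _ w0
        · exact le_iInf₂ fun l' w' => by exact_mod_cast hmin l' w'
      obtain ⟨l', w', hsub, hle⟩ := h s t l0 (hU s) (rE_of_mem w0 fun y _ => hU y)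
      obtain ⟨is, e, hp⟩ := List.sublist_eq_map_getElem hsub
      cases is with
      | nil => simp at e
      | cons i is =>
        have e1 : s = σ.get i := (List.cons.inj e).1
        have e2 : l' = is.map σ.get := (List.cons.inj e).2
        rw [e1, e2] at w'
        obtain ⟨j, h1, h2, h3⟩ := walk_lift (ℓ := ℓ) σ.get w' hp
        rw [← e1, ← e2] at h3
        rw [hg]
        have hfin : (walkLen ℓ s l' : ℝ≥0∞) ≤ (1 + ENNReal.ofReal ε) * (walkLen ℓ s l0 : ℝ≥0∞) := by
          have h5 := ENNReal.ofReal_le_ofReal hle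
          rw [ENNReal.ofReal_mul (by linarith), ENNReal.ofReal_natCast, ENNReal.ofReal_natCast,
            ENNReal.ofReal_add (by norm_num) hε.le, ENNReal.ofReal_one] at h5
          exact h5
        refine le_trans ?_ hfin
        unfold gdistSet
        refine (iInf₂_le i e1.symm).trans ((iInf₂_le j h1).trans ?_)
        unfold gdist
        exact (iInf₂_le _ h2).trans (by rw [h3])
    · have hg : gdist E ℓ s t = ⊤ := by
        unfold gdist
        simp only [iInf_eq_top]
        intro l hl; exact absurd ⟨l, hl⟩ hex
      rw [hg, ENNReal.mul_top (by simp)]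
      exact le_top

lemma numA (k : ℕ) : ∃ C : ℕ, ∀ (Lg ε Λ r J : ℝ), 3 / 2 ≤ Lg → 0 < ε → ε < 1 → 0 ≤ Λ → Λ ≤ 2 * Lg →
    1 ≤ r → r ≤ 2 * Lg → J ≤ 48 * ((k + 4) * Λ + 2 : ℝ) ^ 2 / (ε / (2 * r)) + 1 → 0 ≤ J →
    1 + ((k + 1) * Λ + 1) * (2 * Λ + 1) * (3 + J) ≤ Lg ^ C / ε := by
  obtain ⟨c, hc⟩ := pow_unbounded_of_one_lt (7721 * ((k : ℝ) + 10) ^ 3) (y := (3 / 2 : ℝ)) (by norm_num)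
  refine ⟨c + 5, fun Lg ε Λ r J hL hε hε1 hΛ0 hΛ hr1 hr hJ hJ0 => ?_⟩
  set K : ℝ := (k : ℝ) + 10 with hK
  have hk0 : (0 : ℝ) ≤ k := Nat.cast_nonneg k
  have hK1 : 10 ≤ K := by linarith
  have hL0 : 0 < Lg := by linarith
  have h1 : ((k : ℝ) + 4) * Λ + 2 ≤ 2 * K * Lg := by nlinarith [mul_nonneg hk0 hΛ0, mul_nonneg hk0 hL0.le]
  have h2 : ((k : ℝ) + 1) * Λ + 1 ≤ 2 * K * Lg := by nlinarith [mul_nonneg hk0 hΛ0, mul_nonneg hk0 hL0.le]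
  have h3 : 2 * Λ + 1 ≤ 5 * Lg := by linarith
  have h1' : (((k : ℝ) + 4) * Λ + 2) ^ 2 ≤ (2 * K * Lg) ^ 2 := pow_le_pow_left₀ (by positivity) h1 2
  have e1 : 48 * ((k + 4) * Λ + 2 : ℝ) ^ 2 / (ε / (2 * r)) =
      48 * ((k + 4) * Λ + 2 : ℝ) ^ 2 * (2 * r) / ε := by field_simp
  have h4 : 48 * ((k + 4) * Λ + 2 : ℝ) ^ 2 * (2 * r) ≤ 48 * (2 * K * Lg) ^ 2 * (2 * (2 * Lg)) := by
    gcongr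
  have h5 : J ≤ 768 * K ^ 2 * Lg ^ 3 / ε + 1 := by
    refine hJ.trans ?_
    rw [e1]
    have := div_le_div_of_nonneg_right h4 hε.le
    have e2 : 48 * (2 * K * Lg) ^ 2 * (2 * (2 * Lg)) = 768 * K ^ 2 * Lg ^ 3 := by ring
    rw [e2] at this
    linarith
  have hLpow : ∀ m : ℕ, 1 ≤ Lg ^ m := fun m => one_le_pow₀ (by linarith)
  have hinv : 1 ≤ 1 / ε := by rw [le_div_iff₀ hε]; linarith
  have hbig : ∀ a b : ℝ, 1 ≤ a → 1 ≤ b → 1 ≤ a * b / ε := fun a b ha hb => by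
    rw [le_div_iff₀ hε]; nlinarith
  have h6 : 3 + J ≤ 772 * K ^ 2 * Lg ^ 3 / ε := by
    have := hbig (K ^ 2) (Lg ^ 3) (one_le_pow₀ (by linarith)) (hLpow 3)
    have e3 : 772 * K ^ 2 * Lg ^ 3 / ε = 768 * K ^ 2 * Lg ^ 3 / ε + 4 * (K ^ 2 * Lg ^ 3 / ε) := by ring
    linarith
  have h7 : ((k + 1) * Λ + 1) * (2 * Λ + 1) * (3 + J) ≤
      (2 * K * Lg) * (5 * Lg) * (772 * K ^ 2 * Lg ^ 3 / ε) := by gcongr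
  have h8 := hbig (K ^ 3) (Lg ^ 5) (one_le_pow₀ (by linarith)) (hLpow 5)
  have e4 : (2 * K * Lg) * (5 * Lg) * (772 * K ^ 2 * Lg ^ 3 / ε) = 7720 * (K ^ 3 * Lg ^ 5 / ε) := by ring
  have h9 : 7721 * K ^ 3 ≤ Lg ^ c := hc.le.trans (pow_le_pow_left₀ (by norm_num) hL c)
  have h10 : 7721 * K ^ 3 * Lg ^ 5 / ε ≤ Lg ^ (c + 5) / ε := by
    rw [pow_add]
    gcongr
  have e5 : 7721 * K ^ 3 * Lg ^ 5 / ε = 7721 * (K ^ 3 * Lg ^ 5 / ε) := by ring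
  linarith

lemma main_word (k : ℕ) : ∃ C : ℕ, ∀ (V : Type) (_ : Fintype V) (E : V → V → Prop) (ℓ : V → V → ℕ),
    3 ≤ Nat.card V → (∀ u v, E u v → 0 < ℓ u v ∧ ℓ u v ≤ (Nat.card V) ^ k) →
    ∀ ε δ : ℝ, 0 < ε → ε < 1 → 0 < δ → δ < 1 / 2 →
    ∃ σ : List V, Approx E ℓ Finset.univ σ (1 + ε) ∧ ∀ v, (σ.count v : ℝ) ≤
      ((Real.logb 2 (Nat.card V)) ^ (C : ℝ) / ε) ^ ((Real.logb 2 (Nat.card V)) ^ δ) *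
            (Nat.card V : ℝ) ^ (1 / (Real.logb 2 (Nat.card V)) ^ δ) := by
  obtain ⟨C, hC⟩ := numA k
  refine ⟨C, fun V _ E ℓ hn hE ε δ hε hε1 hδ hδ1 => ?_⟩
  set n := Nat.card V with hnd
  set Lg := Real.logb 2 n with hLg
  have hn0 : (0 : ℝ) < n := by exact_mod_cast (by omega : 0 < n)
  have hn1 : (1 : ℝ) ≤ n := by exact_mod_cast (by omega : 1 ≤ n)
  have hL : 3 / 2 ≤ Lg := by
    rw [hLg, Real.le_logb_iff_rpow_le (by norm_num) hn0]
    have h1 : ((2 : ℝ) ^ (3 / 2 : ℝ)) ^ 2 = 8 := by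
      rw [← Real.rpow_natCast, ← Real.rpow_mul (by norm_num)]; norm_num
    have h3 : (3 : ℝ) ≤ n := by exact_mod_cast hn
    refine le_trans ?_ h3
    have h2 : (0 : ℝ) ≤ (2 : ℝ) ^ (3 / 2 : ℝ) := by positivity
    nlinarith
  set L := Lg ^ δ with hLdef
  have hL1 : 1 < L := Real.one_lt_rpow (by linarith) hδ
  have hLLg : L ≤ Lg := by
    calc L ≤ Lg ^ (1 : ℝ) := Real.rpow_le_rpow_of_exponent_le (by linarith) (by linarith)
      _ = Lg := Real.rpow_one _
  set r := ⌈L⌉₊ with hr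
  have hrL : L ≤ r := Nat.le_ceil _
  have hrL' : (r : ℝ) < L + 1 := Nat.ceil_lt_add_one (by linarith)
  have hr1 : (1 : ℝ) ≤ r := by linarith
  obtain ⟨j, hj⟩ : ∃ j, r = j + 1 := Nat.exists_eq_succ_of_ne_zero (by
    rintro h; rw [h] at hr1; norm_num at hr1)
  have hjr : (r : ℝ) = j + 1 := by rw [hj]; push_cast; ring
  have hjL : (j : ℝ) ≤ L := by linarith
  set Λ := Nat.clog 2 n with hΛ
  have hnΛ : n ≤ 2 ^ Λ := Nat.le_pow_clog (by norm_num) n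
  have hΛL : (Λ : ℝ) ≤ 2 * Lg := by
    have h1 : 2 ^ (Λ - 1) < n := Nat.pow_pred_clog_lt_self (by norm_num) (by omega)
    have h2 : ((Λ - 1 : ℕ) : ℝ) ≤ Lg := by
      rw [hLg, Real.le_logb_iff_rpow_le (by norm_num) hn0, Real.rpow_natCast]
      exact_mod_cast h1.le
    have h3 : (Λ : ℝ) ≤ ((Λ - 1 : ℕ) : ℝ) + 1 := by exact_mod_cast (by omega : Λ ≤ Λ - 1 + 1)
    linarith
  set η := ε / (2 * r) with hη
  have hη0 : 0 < η := by positivity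
  set J := ⌈48 * ((k + 4) * Λ + 2 : ℝ) ^ 2 / η⌉₊ with hJ
  have hJ1 : 48 * ((k + 4) * Λ + 2 : ℝ) ^ 2 / η ≤ J := Nat.le_ceil _
  have hJ2 : (J : ℝ) < 48 * ((k + 4) * Λ + 2 : ℝ) ^ 2 / η + 1 := Nat.ceil_lt_add_one (by positivity)
  have hA := hC Lg ε Λ r J hL hε hε1 (Nat.cast_nonneg _) hΛL hr1 (by linarith) hJ2.le (Nat.cast_nonneg _)
  set x : ℝ := (n : ℝ) ^ (1 / (r : ℝ)) with hx
  have hx1 : 1 ≤ x := Real.one_le_rpow hn1 (by positivity)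
  have hcard : ∀ U : Finset V, U.card ≤ n := fun U => by
    rw [hnd, Nat.card_eq_fintype_card]; exact Finset.card_le_univ U
  have hxr : x ^ (j + 1) = n := by
    rw [← hj, hx, ← Real.rpow_natCast, ← Real.rpow_mul hn0.le, one_div_mul_cancel (by linarith),
      Real.rpow_one]
  obtain ⟨σ, hσ, happ⟩ := iterate (E := E) (ℓ := ℓ) (fun u v h => (hE u v h).1) Λ k
    (fun u v h => (hE u v h).2.trans (by
      rw [mul_comm, pow_mul]; exact Nat.pow_le_pow_left hnΛ k)) x η hx1 hη0 J (by linarith)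
    (fun U => (hcard U).trans hnΛ) j Finset.univ (by rw [hxr]; exact_mod_cast hcard _)
  refine ⟨σ, ?_, fun v => (hσ.1 v).trans ?_⟩
  · intro s t l hs w
    obtain ⟨l', w', hsub, hle⟩ := happ s t l hs w
    refine ⟨l', w', hsub, hle.trans (mul_le_mul_of_nonneg_right ?_ (Nat.cast_nonneg _))⟩
    have h1 : (1 + η) ^ j ≤ Real.exp (η * j) := by
      rw [mul_comm, Real.exp_nat_mul]
      exact pow_le_pow_left₀ (by linarith) (by linarith [Real.add_one_le_exp η]) j
    have h2 : η * j ≤ ε / 2 := by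
      rw [hη, div_mul_eq_mul_div, div_le_div_iff₀ (by positivity) (by norm_num)]
      nlinarith
    have h3 : Real.exp (ε / 2) ≤ 1 + ε := by
      have h4 := Real.add_one_le_exp (-(ε / 2))
      have h5 : Real.exp (ε / 2) * Real.exp (-(ε / 2)) = 1 := by rw [← Real.exp_add]; simp
      have h6 := Real.exp_pos (ε / 2)
      by_contra hcon
      push Not at hcon
      have h7 : Real.exp (ε / 2) * (1 - ε / 2) ≤ 1 := by
        rw [← h5]; exact mul_le_mul_of_nonneg_left (by linarith) h6.le
      have h8 : (1 + ε) * (1 - ε / 2) < Real.exp (ε / 2) * (1 - ε / 2) :=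
        mul_lt_mul_of_pos_right hcon (by linarith)
      nlinarith
    exact h1.trans ((Real.exp_le_exp.2 h2).trans h3)
  · rw [Real.rpow_natCast]
    set A : ℝ := 1 + ((k + 1) * Λ + 1) * (2 * Λ + 1) * (3 + J) with hAd
    have hA1 : 1 ≤ A := by
      have : (0 : ℝ) ≤ ((k + 1) * Λ + 1) * (2 * Λ + 1) * (3 + J) := by positivity
      linarith
    have h1 : A ^ j ≤ (Lg ^ C / ε) ^ L := by
      calc A ^ j ≤ (Lg ^ C / ε) ^ j := pow_le_pow_left₀ (by linarith) hA j
        _ = (Lg ^ C / ε) ^ (j : ℝ) := (Real.rpow_natCast _ _).symm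
        _ ≤ _ := Real.rpow_le_rpow_of_exponent_le (hA1.trans hA) hjL
    have h2 : x ≤ (n : ℝ) ^ (1 / L) :=
      Real.rpow_le_rpow_of_exponent_le hn1 (one_div_le_one_div_of_le (by linarith) hrL)
    exact mul_le_mul h1 h2 (by linarith) ((by positivity : (0:ℝ) ≤ A ^ j).trans h1)

end Final

end DP
/-- For every integer `k ≥ 1` there is a constant `C` such
that every directed graph on `n ≥ 3` vertices with positive integer edge
lengths at most `n^k` admits, for all `0 < ε < 1` and `0 < δ < 1/2`, a
`(1+ε)`-distance-preserving DAG projection of width at most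
`((log₂ n)^C / ε)^{(log₂ n)^δ} · n^{1/(log₂ n)^δ}`. -/
theorem statement7 :
    ∀ k : ℕ, 1 ≤ k →
    ∃ C : ℝ, ∀ (VG : Type) (_ : Finite VG) (EG : VG → VG → Prop) (ℓG : VG → VG → ℕ),
      3 ≤ Nat.card VG →
      (∀ u v, EG u v → 0 < ℓG u v ∧ ℓG u v ≤ (Nat.card VG) ^ k) →
      ∀ ε δ : ℝ, 0 < ε → ε < 1 → 0 < δ → δ < 1 / 2 →
      ∃ (VD : Type) (_ : Finite VD) (ED : VD → VD → Prop) (ℓD : VD → VD → ℕ)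
        (π : VD → VG),
        IsDag ED ∧
        (∀ x y, ED x y → EG (π x) (π y) ∧ ℓD x y = ℓG (π x) (π y)) ∧
        (∀ s t : VG,
          gdist EG ℓG s t ≤ gdistSet ED ℓD (π ⁻¹' {s}) (π ⁻¹' {t}) ∧
          gdistSet ED ℓD (π ⁻¹' {s}) (π ⁻¹' {t}) ≤
            (1 + ENNReal.ofReal ε) * gdist EG ℓG s t) ∧
        (∀ v : VG, ((π ⁻¹' {v}).ncard : ℝ) ≤
          ((Real.logb 2 (Nat.card VG)) ^ C / ε) ^ ((Real.logb 2 (Nat.card VG)) ^ δ) *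
            (Nat.card VG : ℝ) ^ (1 / (Real.logb 2 (Nat.card VG)) ^ δ)) := by
  intro k _
  obtain ⟨C, hC⟩ := DP.main_word k
  refine ⟨C, fun VG hfin EG ℓG hn hE ε δ hε hε1 hδ hδ1 => ?_⟩
  have := Fintype.ofFinite VG
  obtain ⟨σ, h1, h2⟩ := hC VG inferInstance EG ℓG hn hE ε δ hε hε1 hδ hδ1
  obtain ⟨hdag, hdist⟩ := DP.convert_word EG ℓG σ _ (fun v => Finset.mem_univ v) ε hε h1
  refine ⟨Fin σ.length, inferInstance, fun a b => a < b ∧ EG (σ.get a) (σ.get b),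
    fun a b => ℓG (σ.get a) (σ.get b), σ.get, hdag, fun x y h => ⟨h.2, rfl⟩, hdist, fun v => ?_⟩
  rw [DP.fiber_ncard]
  exact h2 v
end

section
/- For every real c > 0 and every integer k ≥ 1 there exists n₀ such that the following holds: for every directed graph G with n ≥ n₀ vertices and m edges, with integer edge capacities in {1,…,n^k}, there exist a finite directed acyclic graph D with nonnegative real edge capacities and a map π : V(D) → V(G) ∪ {⊥} with π⁻¹(v) ≠ ∅ for every v ∈ V(G), such that D has at most m·n^c edges, the width max_{v∈V(G)} |π⁻¹(v)| is at most n^c, and for every pair of vertex subsets S, T ⊆ V(G): maxflow_G(S,T) ≤ maxflow_D(π⁻¹(S), π⁻¹(T)) ≤ n^c · maxflow_G(S,T). -/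
open scoped Classical ENNReal

/-- Net outflow of the flow `f` at vertex `v` (sums range over edges only). -/
noncomputable def netOutflow {V : Type*} (E : V → V → Prop) (f : V → V → ℝ) (v : V) : ℝ :=
  (∑ᶠ u, if E v u then f v u else 0) - (∑ᶠ u, if E u v then f u v else 0)

/-- A flow is feasible if it is nonnegative and respects the capacities on every edge. -/
def FeasibleFlow {V : Type*} (E : V → V → Prop) (U f : V → V → ℝ) : Prop :=
  ∀ u v, E u v → 0 ≤ f u v ∧ f u v ≤ U u v

/-- Value of a flow: sum over the vertices of the positive part of the net outflow. -/
noncomputable def flowValue {V : Type*} (E : V → V → Prop) (f : V → V → ℝ) : ℝ :=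
  ∑ᶠ v, max (netOutflow E f v) 0

/-- Maximum flow value from the vertex set `S` to the vertex set `T`. -/
noncomputable def maxflow {V : Type*} (E : V → V → Prop) (U : V → V → ℝ)
    (S T : Set V) : ℝ :=
  sSup {x : ℝ | ∃ f : V → V → ℝ, FeasibleFlow E U f ∧
    (∀ v ∈ S, 0 ≤ netOutflow E f v) ∧
    (∀ v ∈ T, netOutflow E f v ≤ 0) ∧
    (∀ v, v ∉ S ∪ T → netOutflow E f v = 0) ∧
    x = flowValue E f}


set_option linter.unusedSectionVars false

section MFMC
variable {V : Type} [Fintype V]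

noncomputable def ext0 (E : V → V → Prop) (f : V → V → ℝ) (u v : V) : ℝ := if E u v then f u v else 0

lemma netOutflow_eq (E : V → V → Prop) (f : V → V → ℝ) (v : V) :
    netOutflow E f v = ∑ u, (ext0 E f v u - ext0 E f u v) := by
  unfold netOutflow ext0
  rw [finsum_eq_sum_of_fintype, finsum_eq_sum_of_fintype, Finset.sum_sub_distrib]

noncomputable def cutcap (E : V → V → Prop) (U : V → V → ℝ) (X : Set V) : ℝ :=
  ∑ u, ∑ v, if u ∈ X ∧ v ∉ X ∧ E u v then U u v else 0

def STFlow (E : V → V → Prop) (U : V → V → ℝ) (S T : Set V) (f : V → V → ℝ) : Prop :=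
  FeasibleFlow E U f ∧
    (∀ v ∈ S, 0 ≤ netOutflow E f v) ∧
    (∀ v ∈ T, netOutflow E f v ≤ 0) ∧
    (∀ v, v ∉ S ∪ T → netOutflow E f v = 0)

lemma maxflow_eq (E : V → V → Prop) (U : V → V → ℝ) (S T : Set V) :
    maxflow E U S T = sSup {x : ℝ | ∃ f, STFlow E U S T f ∧ x = flowValue E f} := by
  unfold maxflow STFlow
  congr 1
  ext x
  simp only [Set.mem_ofPred_eq, and_assoc]

lemma maxflow_sdiff (E : V → V → Prop) (U : V → V → ℝ) (S T : Set V) :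
    maxflow E U S T = maxflow E U (S \ T) (T \ S) := by
  rw [maxflow_eq, maxflow_eq]
  congr 1
  ext x
  simp only [Set.mem_ofPred_eq]
  refine exists_congr fun f => and_congr_left fun _ => ?_
  unfold STFlow
  refine and_congr_right fun _ => ?_
  constructor
  · rintro ⟨h1, h2, h3⟩
    refine ⟨fun v hv => h1 v hv.1, fun v hv => h2 v hv.1, fun v hv => ?_⟩
    by_cases a : v ∈ S
    · by_cases b : v ∈ T
      · exact le_antisymm (h2 v b) (h1 v a)
      · exact absurd (Or.inl ⟨a, b⟩) hv
    · by_cases b : v ∈ T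
      · exact absurd (Or.inr ⟨b, a⟩) hv
      · exact h3 v (by simp [a, b])
  · rintro ⟨h1, h2, h3⟩
    have key : ∀ v, v ∈ S → v ∈ T → netOutflow E f v = 0 := fun v a b =>
      h3 v (by simp [a, b])
    refine ⟨fun v hv => ?_, fun v hv => ?_, fun v hv => h3 v ?_⟩
    · by_cases b : v ∈ T
      · exact (key v hv b).ge
      · exact h1 v ⟨hv, b⟩
    · by_cases b : v ∈ S
      · exact (key v b hv).le
      · exact h2 v ⟨hv, b⟩
    · rintro (h | h)
      · exact hv (Or.inl h.1)
      · exact hv (Or.inr h.1)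

lemma sum_net_cut (E : V → V → Prop) (f : V → V → ℝ) (X : Set V) :
    ∑ v, (if v ∈ X then netOutflow E f v else 0) =
      ∑ u, ∑ v, if u ∈ X ∧ v ∉ X then (ext0 E f u v - ext0 E f v u) else 0 := by
  have h1 : ∀ v, (if v ∈ X then netOutflow E f v else 0) =
      ∑ u, ((if v ∈ X ∧ u ∉ X then (ext0 E f v u - ext0 E f u v) else 0) +
        (if v ∈ X ∧ u ∈ X then (ext0 E f v u - ext0 E f u v) else 0)) := by
    intro v
    by_cases hv : v ∈ X
    · rw [if_pos hv, netOutflow_eq]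
      refine Finset.sum_congr rfl fun u _ => ?_
      by_cases hu : u ∈ X <;> simp [hv, hu]
    · simp [hv]
  simp only [h1, Finset.sum_add_distrib]
  have h2 : ∑ v, ∑ u, (if v ∈ X ∧ u ∈ X then (ext0 E f v u - ext0 E f u v) else 0) = 0 := by
    have h3 : ∑ v, ∑ u, (if v ∈ X ∧ u ∈ X then (ext0 E f v u - ext0 E f u v) else 0) =
       - ∑ v, ∑ u, (if v ∈ X ∧ u ∈ X then (ext0 E f v u - ext0 E f u v) else 0) := by
      conv_lhs => rw [Finset.sum_comm]
      simp only [← Finset.sum_neg_distrib]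
      refine Finset.sum_congr rfl fun u _ => Finset.sum_congr rfl fun v _ => ?_
      by_cases hu : u ∈ X <;> by_cases hv : v ∈ X <;> simp [hu, hv]
    linarith
  rw [h2, add_zero]

lemma flowValue_eq_cut {E : V → V → Prop} {U : V → V → ℝ} {S T : Set V} {f : V → V → ℝ}
    (hf : STFlow E U S T f) {X : Set V} (hS : S ⊆ X) (hT : ∀ v ∈ T, v ∉ X) :
    flowValue E f = ∑ u, ∑ v, if u ∈ X ∧ v ∉ X then (ext0 E f u v - ext0 E f v u) else 0 := by
  rw [← sum_net_cut]
  unfold flowValue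
  rw [finsum_eq_sum_of_fintype]
  refine Finset.sum_congr rfl fun v _ => ?_
  obtain ⟨_, h1, h2, h3⟩ := hf
  by_cases hv : v ∈ S
  · rw [if_pos (hS hv), max_eq_left (h1 v hv)]
  · by_cases hvT : v ∈ T
    · rw [if_neg (hT v hvT), max_eq_right (h2 v hvT)]
    · rw [h3 v (by simp [hv, hvT])]; simp

lemma flowValue_le_cut {E : V → V → Prop} {U : V → V → ℝ} {S T : Set V} {f : V → V → ℝ}
    (hf : STFlow E U S T f) {X : Set V} (hS : S ⊆ X) (hT : ∀ v ∈ T, v ∉ X) :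
    flowValue E f ≤ cutcap E U X := by
  rw [flowValue_eq_cut hf hS hT]
  unfold cutcap
  refine Finset.sum_le_sum fun u _ => Finset.sum_le_sum fun v _ => ?_
  by_cases h : u ∈ X ∧ v ∉ X
  · rw [if_pos h]
    have h1 : 0 ≤ ext0 E f v u := by
      unfold ext0; split_ifs with h
      · exact (hf.1 _ _ h).1
      · exact le_rfl
    by_cases h' : E u v
    · rw [if_pos ⟨h.1, h.2, h'⟩]
      have := (hf.1 _ _ h').2
      simp only [ext0, h', if_true] at *
      linarith
    · rw [if_neg (by tauto)]
      have : ext0 E f u v = 0 := by simp [ext0, h']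
      linarith
  · rw [if_neg h, if_neg (by tauto)]

lemma maxflow_le_cut {E : V → V → Prop} {U : V → V → ℝ} {S T : Set V}
    (hU : ∀ u v, E u v → 0 ≤ U u v) {X : Set V} (hS : S ⊆ X) (hT : ∀ v ∈ T, v ∉ X) :
    maxflow E U S T ≤ cutcap E U X := by
  rw [maxflow_eq]
  apply csSup_le
  · refine ⟨_, fun _ _ => 0, ⟨fun u v h => ⟨le_rfl, hU u v h⟩, ?_⟩, rfl⟩
    simp [netOutflow]
  · rintro x ⟨f, hf, rfl⟩
    exact flowValue_le_cut hf hS hT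

lemma le_maxflow {E : V → V → Prop} {U : V → V → ℝ} {S T : Set V}
    (hST : ∀ v ∈ T, v ∉ S) {f : V → V → ℝ} (hf : STFlow E U S T f) :
    flowValue E f ≤ maxflow E U S T := by
  rw [maxflow_eq]
  refine le_csSup ⟨cutcap E U S, ?_⟩ ⟨f, hf, rfl⟩
  rintro x ⟨f, hf, rfl⟩
  exact flowValue_le_cut hf subset_rfl hST

/-- residual relation -/
def Res (E : V → V → Prop) (U f : V → V → ℝ) (u v : V) : Prop :=
  (E u v ∧ f u v < U u v) ∨ (E v u ∧ 0 < f v u)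

lemma net_add (E : V → V → Prop) (f g : V → V → ℝ) (ε : ℝ) (v : V) :
    netOutflow E (fun a b => f a b + ε * g a b) v = netOutflow E f v + ε * netOutflow E g v := by
  simp only [netOutflow_eq, Finset.mul_sum, ← Finset.sum_add_distrib]
  refine Finset.sum_congr rfl fun u _ => ?_
  unfold ext0
  split_ifs <;> ring

lemma net_single (E : V → V → Prop) (u v : V) (h : E u v) (w : V) :
    netOutflow E (fun a b => if a = u ∧ b = v then 1 else 0) w =
      (if w = u then 1 else 0) - (if w = v then 1 else 0) := by
  rw [netOutflow_eq, Finset.sum_sub_distrib]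
  congr 1
  · by_cases hw : w = u
    · subst hw
      rw [if_pos rfl, Finset.sum_eq_single v]
      · simp [ext0, h]
      · intro b _ hb; simp [ext0, hb]
      · simp
    · rw [if_neg hw]
      apply Finset.sum_eq_zero
      intro b _; simp [ext0, hw]
  · by_cases hw : w = v
    · subst hw
      rw [if_pos rfl, Finset.sum_eq_single u]
      · simp [ext0, h]
      · intro b _ hb; simp [ext0, hb]
      · simp
    · rw [if_neg hw]
      apply Finset.sum_eq_zero
      intro b _; simp [ext0, hw]

lemma direction {E : V → V → Prop} {U f : V → V → ℝ} {s t : V}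
    (h : Relation.ReflTransGen (Res E U f) s t) :
    ∃ g : V → V → ℝ, (∀ u v, E u v → (f u v ≤ 0 → 0 ≤ g u v) ∧ (U u v ≤ f u v → g u v ≤ 0)) ∧
      ∀ w, netOutflow E g w = (if w = s then 1 else 0) - (if w = t then 1 else 0) := by
  induction h with
  | refl => exact ⟨fun _ _ => 0, by simp, by simp [netOutflow]⟩
  | @tail b t _ hb ih =>
    obtain ⟨g, hg, hn⟩ := ih
    rcases hb with ⟨hE, hlt⟩ | ⟨hE, hlt⟩
    · refine ⟨fun x y => g x y + 1 * (if x = b ∧ y = t then 1 else 0), fun u v huv => ⟨fun h0 => ?_, fun h0 => ?_⟩, fun w => ?_⟩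
      · have := (hg u v huv).1 h0
        beta_reduce
        split_ifs <;> linarith
      · have := (hg u v huv).2 h0
        beta_reduce
        split_ifs with hc
        · obtain ⟨rfl, rfl⟩ := hc; linarith
        · linarith
      · rw [net_add E g (fun x y => if x = b ∧ y = t then 1 else 0), hn, net_single E b t hE]; ring
    · refine ⟨fun x y => g x y + (-1) * (if x = t ∧ y = b then 1 else 0), fun u v huv => ⟨fun h0 => ?_, fun h0 => ?_⟩, fun w => ?_⟩
      · have := (hg u v huv).1 h0
        beta_reduce
        split_ifs with hc
        · obtain ⟨rfl, rfl⟩ := hc; linarith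
        · linarith
      · have := (hg u v huv).2 h0
        beta_reduce
        split_ifs <;> linarith
      · rw [net_add E g (fun x y => if x = t ∧ y = b then 1 else 0), hn, net_single E t b hE]; ring

lemma exists_eps {E : V → V → Prop} {U f g : V → V → ℝ} (hf : FeasibleFlow E U f)
    (hg : ∀ u v, E u v → (f u v ≤ 0 → 0 ≤ g u v) ∧ (U u v ≤ f u v → g u v ≤ 0)) :
    ∃ ε : ℝ, 0 < ε ∧ FeasibleFlow E U (fun a b => f a b + ε * g a b) := by
  have h : ∀ u v, ∀ᶠ ε in nhdsWithin (0:ℝ) (Set.Ioi 0), E u v → 0 ≤ f u v + ε * g u v ∧ f u v + ε * g u v ≤ U u v := by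
    intro u v
    by_cases huv : E u v
    swap
    · simp [huv]
    have hc : Filter.Tendsto (fun ε : ℝ => f u v + ε * g u v) (nhdsWithin 0 (Set.Ioi 0)) (nhds (f u v)) := by
      have : Continuous (fun ε : ℝ => f u v + ε * g u v) := by fun_prop
      have h2 := this.tendsto 0
      simp only [zero_mul, add_zero] at h2
      exact h2.mono_left nhdsWithin_le_nhds
    have hpos : ∀ᶠ ε in nhdsWithin (0:ℝ) (Set.Ioi 0), 0 < ε := eventually_mem_nhdsWithin
    have e1 : ∀ᶠ ε in nhdsWithin (0:ℝ) (Set.Ioi 0), 0 ≤ f u v + ε * g u v := by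
      rcases (hf u v huv).1.eq_or_lt with h0 | h0
      · filter_upwards [hpos] with ε hε
        have := mul_nonneg hε.le ((hg u v huv).1 h0.symm.le)
        linarith
      · filter_upwards [hc.eventually (lt_mem_nhds h0)] with ε hε using hε.le
    have e2 : ∀ᶠ ε in nhdsWithin (0:ℝ) (Set.Ioi 0), f u v + ε * g u v ≤ U u v := by
      rcases (hf u v huv).2.eq_or_lt with h0 | h0
      · filter_upwards [hpos] with ε hε
        have := mul_nonneg hε.le (neg_nonneg.2 ((hg u v huv).2 h0.symm.le))
        linarith
      · filter_upwards [hc.eventually (gt_mem_nhds h0)] with ε hε using hε.le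
    filter_upwards [e1, e2] with ε a b _ using ⟨a, b⟩
  have h2 : ∀ᶠ ε in nhdsWithin (0:ℝ) (Set.Ioi 0), ∀ u v, E u v → 0 ≤ f u v + ε * g u v ∧ f u v + ε * g u v ≤ U u v := by
    rw [Filter.eventually_all]; intro u
    rw [Filter.eventually_all]; intro v
    exact h u v
  obtain ⟨ε, h3, h4⟩ := (h2.and eventually_mem_nhdsWithin).exists
  exact ⟨ε, h4, h3⟩

lemma continuous_net (E : V → V → Prop) (v : V) :
    Continuous (fun f : V → V → ℝ => netOutflow E f v) := by
  simp only [netOutflow_eq, ext0]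
  refine continuous_finsetSum _ fun u _ => ?_
  by_cases h1 : E v u <;> by_cases h2 : E u v <;> simp only [h1, h2, if_true, if_false] <;> fun_prop

lemma exists_max_flow {E : V → V → Prop} {U : V → V → ℝ} {S T : Set V}
    (hU : ∀ u v, E u v → 0 ≤ U u v) :
    ∃ f, STFlow E U S T f ∧ ∀ g, STFlow E U S T g → flowValue E g ≤ flowValue E f := by
  let K : Set (V → V → ℝ) := (Set.univ.pi fun u => Set.univ.pi fun v => Set.Icc 0 (ext0 E U u v)) ∩
    {f | STFlow E U S T f}
  have hbox : IsCompact (Set.univ.pi fun u => Set.univ.pi fun v => Set.Icc 0 (ext0 E U u v)) :=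
    isCompact_univ_pi fun u => isCompact_univ_pi fun v => isCompact_Icc
  have hclosed : IsClosed {f | STFlow E U S T f} := by
    unfold STFlow FeasibleFlow
    simp only [Set.ofPred_and, Set.ofPred_forall]
    refine IsClosed.inter ?_ (IsClosed.inter ?_ (IsClosed.inter ?_ ?_))
    · refine isClosed_iInter fun u => isClosed_iInter fun v => isClosed_iInter fun h => ?_
      exact (isClosed_le (by fun_prop) (by fun_prop)).inter (isClosed_le (by fun_prop) (by fun_prop))
    · exact isClosed_iInter fun u => isClosed_iInter fun _ => isClosed_le continuous_const (continuous_net E u)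
    · exact isClosed_iInter fun u => isClosed_iInter fun _ => isClosed_le (continuous_net E u) continuous_const
    · exact isClosed_iInter fun u => isClosed_iInter fun _ => isClosed_eq (continuous_net E u) continuous_const
  have hK : IsCompact K := hbox.inter_right hclosed
  have hne : K.Nonempty := by
    refine ⟨fun _ _ => 0, ?_, ⟨fun u v h => ⟨le_rfl, hU u v h⟩, ?_⟩⟩
    · simp only [Set.mem_pi, Set.mem_Icc, le_refl, true_and]
      intro u _ v _
      unfold ext0; split_ifs with h
      · exact hU u v h
      · exact le_rfl
    · simp [netOutflow]
  have hcont : Continuous (fun f : V → V → ℝ => flowValue E f) := by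
    unfold flowValue
    simp only [finsum_eq_sum_of_fintype]
    exact continuous_finsetSum _ fun v _ => (continuous_net E v).max continuous_const
  obtain ⟨f, hf, hmax⟩ := hK.exists_isMaxOn hne hcont.continuousOn
  refine ⟨f, hf.2, fun g hg => ?_⟩
  have hnet : ∀ v, netOutflow E (ext0 E g) v = netOutflow E g v := by
    intro v
    simp only [netOutflow_eq]
    refine Finset.sum_congr rfl fun u _ => ?_
    unfold ext0; split_ifs <;> rfl
  have hval : flowValue E (ext0 E g) = flowValue E g := by
    unfold flowValue; simp only [hnet]
  rw [← hval]
  apply hmax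
  refine ⟨?_, ?_⟩
  · simp only [Set.mem_pi, Set.mem_Icc]
    intro u _ v _
    unfold ext0; split_ifs with h
    · exact hg.1 u v h
    · exact ⟨le_rfl, le_rfl⟩
  · obtain ⟨h0, h1, h2, h3⟩ := hg
    refine ⟨fun u v h => ?_, ?_⟩
    · simpa [ext0, h] using h0 u v h
    · simp only [hnet]; exact ⟨h1, h2, h3⟩

lemma exists_min_cut {E : V → V → Prop} {U : V → V → ℝ} {S T : Set V}
    (hU : ∀ u v, E u v → 0 ≤ U u v) (hST : ∀ v ∈ T, v ∉ S) :
    ∃ X : Set V, S ⊆ X ∧ (∀ v ∈ T, v ∉ X) ∧ cutcap E U X ≤ maxflow E U S T := by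
  obtain ⟨f, hf, hmax⟩ := exists_max_flow (S := S) (T := T) hU
  let X : Set V := {v | ∃ s ∈ S, Relation.ReflTransGen (Res E U f) s v}
  have hSX : S ⊆ X := fun s hs => ⟨s, hs, Relation.ReflTransGen.refl⟩
  have hTX : ∀ v ∈ T, v ∉ X := by
    rintro t ht ⟨s, hs, hr⟩
    have hst : s ≠ t := fun h => hST t ht (h ▸ hs)
    obtain ⟨g, hg, hn⟩ := direction hr
    obtain ⟨ε, hε, hfe⟩ := exists_eps hf.1 hg
    obtain ⟨h0, h1, h2, h3⟩ := hf
    have hf' : STFlow E U S T (fun a b => f a b + ε * g a b) := by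
      refine ⟨hfe, fun v hv => ?_, fun v hv => ?_, fun v hv => ?_⟩ <;> rw [net_add, hn]
      · have hvt : v ≠ t := fun h => hST t ht (h ▸ hv)
        rw [if_neg hvt]
        have := h1 v hv
        split_ifs <;> linarith
      · have hvt : v ≠ s := fun h => hST v hv (h ▸ hs)
        rw [if_neg hvt]
        have := h2 v hv
        split_ifs <;> linarith
      · have a : v ≠ s := fun h => hv (Or.inl (h ▸ hs))
        have b : v ≠ t := fun h => hv (Or.inr (h ▸ ht))
        rw [if_neg a, if_neg b, h3 v hv]; ring
    have := hmax _ hf'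
    rw [flowValue_eq_cut hf' (X := S) subset_rfl hST, flowValue_eq_cut ⟨h0, h1, h2, h3⟩ (X := S) subset_rfl hST,
      ← sum_net_cut, ← sum_net_cut] at this
    have h5 : ∑ v, (if v ∈ S then netOutflow E (fun a b => f a b + ε * g a b) v else 0) =
        ∑ v, ((if v ∈ S then netOutflow E f v else 0) + if v = s then ε else 0) := by
      refine Finset.sum_congr rfl fun v _ => ?_
      rw [net_add, hn]
      by_cases hv : v ∈ S
      · have hvt : v ≠ t := fun h => hST t ht (h ▸ hv)
        simp [hv, hvt]
      · have hvs : v ≠ s := fun h => hv (h ▸ hs)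
        simp [hv, hvs]
    rw [h5, Finset.sum_add_distrib] at this
    simp at this
    linarith
  refine ⟨X, hSX, hTX, ?_⟩
  refine le_trans (le_of_eq ?_) (le_maxflow hST hf)
  rw [flowValue_eq_cut hf hSX hTX]
  unfold cutcap
  refine Finset.sum_congr rfl fun u _ => Finset.sum_congr rfl fun v _ => ?_
  by_cases h : u ∈ X ∧ v ∉ X
  swap
  · rw [if_neg h, if_neg (by tauto)]
  have hnr : ¬ Res E U f u v := by
    intro hr
    obtain ⟨⟨s, hs, h1⟩, h2⟩ := h
    exact h2 ⟨s, hs, h1.tail hr⟩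
  simp only [Res, not_or, not_and, not_lt] at hnr
  have e1 : ext0 E f v u = 0 := by
    unfold ext0; split_ifs with hE
    · exact le_antisymm (hnr.2 hE) (hf.1 _ _ hE).1
    · rfl
  rw [if_pos h, e1, sub_zero]
  unfold ext0
  by_cases hE : E u v
  · rw [if_pos ⟨h.1, h.2, hE⟩, if_pos hE]
    exact le_antisymm (hnr.1 hE) (hf.1 _ _ hE).2
  · rw [if_neg (by tauto), if_neg hE]

end MFMC

section Hier
variable {V : Type} [Fintype V] {L : ℕ}

/-- u, v agree on all labels of index at least `i`. -/
def same (R : Fin L → V → V → Prop) (i : ℕ) (u v : V) : Prop :=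
  ∀ j : Fin L, i ≤ j.val → R j u v ∧ R j v u

/-- terminal pairs of level `i`. -/
def term (R : Fin L → V → V → Prop) (i : ℕ) (u v : V) : Prop :=
  same R i u v ∧ ∀ j : Fin L, j.val + 1 = i → ¬ R j u v

def rel (q : Fin L → V → ℕ) : Fin L → V → V → Prop := fun j u v => q j u ≤ q j v

lemma same_rel {q : Fin L → V → ℕ} {i : ℕ} {u v : V} :
    same (rel q) i u v ↔ ∀ j : Fin L, i ≤ j.val → q j u = q j v := by
  unfold same rel
  refine forall_congr' fun j => forall_congr' fun _ => ?_
  omega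

lemma same_refl (q : Fin L → V → ℕ) (i : ℕ) (u : V) : same (rel q) i u u :=
  same_rel.2 fun _ _ => rfl

lemma same_symm {q : Fin L → V → ℕ} {i : ℕ} {u v : V} (h : same (rel q) i u v) :
    same (rel q) i v u := same_rel.2 fun j hj => (same_rel.1 h j hj).symm

lemma same_trans {q : Fin L → V → ℕ} {i : ℕ} {u v w : V} (h : same (rel q) i u v)
    (h' : same (rel q) i v w) : same (rel q) i u w :=
  same_rel.2 fun j hj => (same_rel.1 h j hj).trans (same_rel.1 h' j hj)

lemma same_congr {q : Fin L → V → ℕ} {i : ℕ} {u v : V} (h : same (rel q) i u v) (w : V) :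
    same (rel q) i u w ↔ same (rel q) i v w :=
  ⟨fun h' => same_trans (same_symm h) h', fun h' => same_trans h h'⟩

noncomputable def dg (c : V → V → ℕ) (R : Fin L → V → V → Prop) (i : ℕ) (v : V) : ℕ :=
  ∑ u, ((if term R i v u then c v u else 0) + (if term R i u v then c u v else 0))

noncomputable def vol (c : V → V → ℕ) (R : Fin L → V → V → Prop) (i : ℕ) (v : V) : ℕ :=
  ∑ u, if same R i v u then dg c R i u else 0

noncomputable def Psi (c : V → V → ℕ) (R : Fin L → V → V → Prop) (i : ℕ) : ℝ :=
  ∑ v, (dg c R i v : ℝ) * Real.log (vol c R i v)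

noncomputable def Phi (c : V → V → ℕ) (ρ : ℝ) (R : Fin L → V → V → Prop) : ℝ :=
  ∑ i ∈ Finset.range (L + 1), ρ ^ i * Psi c R i

noncomputable def tot (c : V → V → ℕ) : ℕ := ∑ u, ∑ v, c u v

/-- `v` lies on the side of the cut `X` that is lighter within its class. -/
def small (c : V → V → ℕ) (R : Fin L → V → V → Prop) (i : ℕ) (X : Set V) (v : V) : Prop :=
  2 * (∑ u, if same R i v u ∧ (u ∈ X ↔ v ∈ X) then dg c R i u else 0) ≤ vol c R i v

lemma log_mono_nat {a b : ℕ} (h : a ≤ b) : Real.log a ≤ Real.log b := by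
  rcases Nat.eq_zero_or_pos a with rfl | ha
  · simpa using Real.log_natCast_nonneg b
  · exact Real.log_le_log (by exact_mod_cast ha) (by exact_mod_cast h)

lemma sum_dg_le (c : V → V → ℕ) (R : Fin L → V → V → Prop) (i : ℕ) :
    ∑ v, dg c R i v ≤ 2 * tot c := by
  unfold dg tot
  simp only [Finset.sum_add_distrib, two_mul]
  refine add_le_add ?_ ?_
  · refine Finset.sum_le_sum fun u _ => Finset.sum_le_sum fun v _ => ?_
    split_ifs <;> simp
  · rw [Finset.sum_comm]
    refine Finset.sum_le_sum fun u _ => Finset.sum_le_sum fun v _ => ?_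
    split_ifs <;> simp

lemma vol_le (c : V → V → ℕ) (R : Fin L → V → V → Prop) (i : ℕ) (v : V) :
    vol c R i v ≤ 2 * tot c := by
  refine le_trans ?_ (sum_dg_le c R i)
  unfold vol
  refine Finset.sum_le_sum fun u _ => ?_
  split_ifs <;> simp

lemma dg_mono (c : V → V → ℕ) {R R' : Fin L → V → V → Prop} {i : ℕ}
    (h : ∀ u v, term R' i u v → term R i u v) (v : V) : dg c R' i v ≤ dg c R i v := by
  unfold dg
  refine Finset.sum_le_sum fun u _ => add_le_add ?_ ?_
  · by_cases a : term R' i v u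
    · simp [a, h _ _ a]
    · simp [a]
  · by_cases a : term R' i u v
    · simp [a, h _ _ a]
    · simp [a]

lemma vol_mono (c : V → V → ℕ) {R R' : Fin L → V → V → Prop} {i : ℕ}
    (h : ∀ u v, term R' i u v → term R i u v) (hs : ∀ u v, same R' i u v → same R i u v) (v : V) :
    vol c R' i v ≤ vol c R i v := by
  unfold vol
  refine Finset.sum_le_sum fun u _ => ?_
  by_cases a : same R' i v u
  · simp [a, hs _ _ a, dg_mono c h u]
  · simp [a]

lemma Psi_mono (c : V → V → ℕ) {R R' : Fin L → V → V → Prop} {i : ℕ}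
    (h : ∀ u v, term R' i u v → term R i u v) (hs : ∀ u v, same R' i u v → same R i u v) :
    Psi c R' i ≤ Psi c R i := by
  unfold Psi
  refine Finset.sum_le_sum fun v _ => ?_
  exact mul_le_mul (by exact_mod_cast dg_mono c h v) (log_mono_nat (vol_mono c h hs v))
    (Real.log_natCast_nonneg _) (Nat.cast_nonneg _)

lemma dg_le_vol (c : V → V → ℕ) (q : Fin L → V → ℕ) (i : ℕ) (v : V) :
    dg c (rel q) i v ≤ vol c (rel q) i v := by
  unfold vol
  have := Finset.single_le_sum (f := fun u => if same (rel q) i v u then dg c (rel q) i u else 0)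
    (fun _ _ => Nat.zero_le _) (Finset.mem_univ v)
  simpa [same_refl] using this

/-- gain at the split level -/
lemma Psi_gain (c : V → V → ℕ) {q q' : Fin L → V → ℕ} {i : ℕ} {X : Set V}
    (h : ∀ u v, term (rel q') i u v → term (rel q) i u v)
    (hs : ∀ u v, same (rel q') i u v → same (rel q) i u v ∧ (u ∈ X ↔ v ∈ X)) :
    Psi c (rel q') i ≤ Psi c (rel q) i -
      Real.log 2 * ∑ v, (if small c (rel q) i X v then (dg c (rel q) i v : ℝ) else 0) := by
  unfold Psi
  rw [Finset.mul_sum, ← Finset.sum_sub_distrib]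
  refine Finset.sum_le_sum fun v _ => ?_
  have hm := vol_mono c h (fun u v a => (hs u v a).1) v
  have hd := dg_mono c h v
  by_cases hv : small c (rel q) i X v
  · rw [if_pos hv]
    rcases Nat.eq_zero_or_pos (dg c (rel q) i v) with h0 | h0
    · have : dg c (rel q') i v = 0 := by omega
      simp [h0, this]
    · have h2 : 2 * vol c (rel q') i v ≤ vol c (rel q) i v := by
        refine le_trans (Nat.mul_le_mul_left 2 ?_) hv
        unfold vol
        refine Finset.sum_le_sum fun u _ => ?_
        by_cases a : same (rel q') i v u
        · obtain ⟨a1, a2⟩ := hs _ _ a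
          rw [if_pos a, if_pos ⟨a1, a2.symm⟩]; exact dg_mono c h u
        · simp [a]
      have hp := dg_le_vol c q i v
      rcases Nat.eq_zero_or_pos (dg c (rel q') i v) with h3 | h3
      · have h4 : Real.log 2 ≤ Real.log (vol c (rel q) i v) ∨ vol c (rel q) i v = 1 := by
          rcases Nat.lt_or_ge (vol c (rel q) i v) 2 with h5 | h5
          · right; omega
          · left; exact_mod_cast log_mono_nat h5
        rcases h4 with h4 | h4
        · rw [h3]
          have := mul_nonneg (Nat.cast_nonneg (α := ℝ) (dg c (rel q) i v)) (sub_nonneg.2 h4)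
          push_cast; nlinarith
        · exfalso
          have h6 : dg c (rel q) i v ≤ ∑ u, if same (rel q) i v u ∧ (u ∈ X ↔ v ∈ X) then dg c (rel q) i u else 0 := by
            have := Finset.single_le_sum (f := fun u => if same (rel q) i v u ∧ (u ∈ X ↔ v ∈ X) then dg c (rel q) i u else 0)
              (fun _ _ => Nat.zero_le _) (Finset.mem_univ v)
            simpa [same_refl] using this
          unfold small at hv
          omega
      · have hp' := dg_le_vol c q' i v
        have h4 : Real.log 2 + Real.log (vol c (rel q') i v) ≤ Real.log (vol c (rel q) i v) := by
          have := log_mono_nat h2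
          rwa [Nat.cast_mul, Real.log_mul (by norm_num) (by norm_cast; omega)] at this
        have h5 : (dg c (rel q') i v : ℝ) * Real.log (vol c (rel q') i v) ≤
          (dg c (rel q) i v : ℝ) * Real.log (vol c (rel q') i v) :=
          mul_le_mul_of_nonneg_right (by exact_mod_cast hd) (Real.log_natCast_nonneg _)
        have := mul_le_mul_of_nonneg_left h4 (Nat.cast_nonneg (α := ℝ) (dg c (rel q) i v))
        linarith
  · rw [if_neg hv, mul_zero, sub_zero]
    exact mul_le_mul (by exact_mod_cast hd) (log_mono_nat hm)
      (Real.log_natCast_nonneg _) (Nat.cast_nonneg _)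

/-- loss at the level above -/
lemma Psi_loss (c : V → V → ℕ) {q q' : Fin L → V → ℕ} {i : ℕ} (δ : V → ℕ) {K : ℝ}
    (hK : Real.log ((2 * tot c : ℕ) : ℝ) + 1 ≤ K)
    (hd : ∀ v, dg c (rel q') i v ≤ dg c (rel q) i v + δ v)
    (hs : ∀ u v, same (rel q') i u v ↔ same (rel q) i u v) :
    Psi c (rel q') i ≤ Psi c (rel q) i + K * ∑ v, (δ v : ℝ) := by
  set d := dg c (rel q) i with hdd
  set D := vol c (rel q) i with hDD
  set Δ : V → ℕ := fun v => ∑ u, if same (rel q) i v u then δ u else 0 with hΔ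
  have hD : ∀ v, vol c (rel q') i v ≤ D v + Δ v := by
    intro v
    rw [hDD, hΔ]
    simp only [vol, ← Finset.sum_add_distrib]
    refine Finset.sum_le_sum fun u _ => ?_
    by_cases a : same (rel q) i v u
    · simpa [a, (hs v u).2 a] using hd u
    · have : ¬ same (rel q') i v u := fun h => a ((hs v u).1 h)
      simp [a, this]
  have h1 : ∀ v, (dg c (rel q') i v : ℝ) * Real.log (vol c (rel q') i v) ≤
      (d v : ℝ) * Real.log (D v) + (d v : ℝ) * ((Δ v : ℝ) / D v) + (δ v : ℝ) * (K - 1) := by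
    intro v
    have a1 : (dg c (rel q') i v : ℝ) * Real.log (vol c (rel q') i v) ≤
        ((d v : ℝ) + δ v) * Real.log (vol c (rel q') i v) :=
      mul_le_mul_of_nonneg_right (by exact_mod_cast hd v) (Real.log_natCast_nonneg _)
    have a2 : (δ v : ℝ) * Real.log (vol c (rel q') i v) ≤ (δ v : ℝ) * (K - 1) := by
      refine mul_le_mul_of_nonneg_left ?_ (Nat.cast_nonneg _)
      have := log_mono_nat (vol_le c (rel q') i v)
      linarith
    have a3 : (d v : ℝ) * Real.log (vol c (rel q') i v) ≤
        (d v : ℝ) * Real.log (D v) + (d v : ℝ) * ((Δ v : ℝ) / D v) := by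
      rcases Nat.eq_zero_or_pos (d v) with h0 | h0
      · simp [h0]
      · rw [← mul_add]
        refine mul_le_mul_of_nonneg_left ?_ (Nat.cast_nonneg _)
        have hDp : 0 < D v := lt_of_lt_of_le h0 (dg_le_vol c q i v)
        have hDp' : (0:ℝ) < D v := by exact_mod_cast hDp
        have b1 := log_mono_nat (hD v)
        have b2 : Real.log ((D v + Δ v : ℕ) : ℝ) - Real.log (D v) ≤ (Δ v : ℝ) / D v := by
          rw [← Real.log_div (by norm_cast; omega) hDp'.ne']
          refine (Real.log_le_sub_one_of_pos (by positivity)).trans ?_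
          push_cast
          rw [add_div, div_self hDp'.ne']; linarith
        linarith
    linarith
  have h2 : ∑ v, (d v : ℝ) * ((Δ v : ℝ) / D v) ≤ ∑ u, (δ u : ℝ) := by
    have e : ∀ v, (d v : ℝ) * ((Δ v : ℝ) / D v) =
        ∑ u, (δ u : ℝ) * (if same (rel q) i u v then (d v : ℝ) / D u else 0) := by
      intro v
      rw [hΔ]
      push_cast
      rw [Finset.sum_div, Finset.mul_sum]
      refine Finset.sum_congr rfl fun u _ => ?_
      by_cases a : same (rel q) i v u
      · have : D v = D u := by
          rw [hDD]; unfold vol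
          refine Finset.sum_congr rfl fun w _ => ?_
          simp only [same_congr a w]
        rw [if_pos a, if_pos (same_symm a), this]; ring
      · have : ¬ same (rel q) i u v := fun h => a (same_symm h)
        simp [a, this]
    simp only [e]
    rw [Finset.sum_comm]
    refine Finset.sum_le_sum fun u _ => ?_
    rw [← Finset.mul_sum]
    refine mul_le_of_le_one_right (Nat.cast_nonneg _) ?_
    have : ∑ v, (if same (rel q) i u v then (d v : ℝ) / D u else 0) = (D u : ℝ) / D u := by
      have e2 : (D u : ℝ) = ∑ v, if same (rel q) i u v then (d v : ℝ) else 0 := by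
        rw [hDD]; unfold vol; push_cast; rfl
      conv_rhs => lhs; rw [e2]
      rw [Finset.sum_div]
      refine Finset.sum_congr rfl fun v _ => ?_
      split_ifs
      · rfl
      · simp
    rw [this]
    exact div_self_le_one _
  unfold Psi
  calc _ ≤ ∑ v, ((d v : ℝ) * Real.log (D v) + (d v : ℝ) * ((Δ v : ℝ) / D v) + (δ v : ℝ) * (K - 1)) :=
        Finset.sum_le_sum fun v _ => h1 v
    _ = ∑ v, (d v : ℝ) * Real.log (D v) + ∑ v, (d v : ℝ) * ((Δ v : ℝ) / D v) + (∑ v, (δ v : ℝ)) * (K - 1) := by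
        rw [Finset.sum_add_distrib, Finset.sum_add_distrib, Finset.sum_mul]
    _ ≤ _ := by linarith

/-- The split of the labels of index `i` along `X`. -/
noncomputable def split (q : Fin L → V → ℕ) (i : Fin L) (X : Set V) : Fin L → V → ℕ :=
  fun j v => if j = i then 2 * q j v + (if v ∈ X then 1 else 0) else q j v

lemma same_split {q : Fin L → V → ℕ} {i : Fin L} {X : Set V} {j : ℕ} {u v : V} :
    same (rel (split q i X)) j u v ↔ same (rel q) j u v ∧ (j ≤ i.val → (u ∈ X ↔ v ∈ X)) := by
  rw [same_rel, same_rel]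
  constructor
  · intro h
    refine ⟨fun k hk => ?_, fun hj => ?_⟩
    · have := h k hk
      unfold split at this
      split_ifs at this <;> omega
    · have := h i hj
      simp only [split, if_true] at this
      by_cases a : u ∈ X <;> by_cases b : v ∈ X <;> simp only [a, b, if_true, if_false] at this ⊢
      · omega
      · omega
  · rintro ⟨h, h'⟩ k hk
    unfold split
    by_cases a : k = i
    · subst a
      rw [if_pos rfl, if_pos rfl, h k hk]
      simp only [h' hk]
    · rw [if_neg a, if_neg a, h k hk]

lemma term_split_le {q : Fin L → V → ℕ} {i : Fin L} {X : Set V} {j : ℕ} {u v : V} (hj : j ≠ i.val + 1)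
    (h : term (rel (split q i X)) j u v) : term (rel q) j u v := by
  refine ⟨(same_split.1 h.1).1, fun k hk => ?_⟩
  have := h.2 k hk
  have hne : k ≠ i := by rintro rfl; omega
  simpa [rel, split, hne] using this

lemma term_split_succ {q : Fin L → V → ℕ} {i : Fin L} {X : Set V} {u v : V}
    (h : term (rel (split q i X)) (i.val + 1) u v) :
    term (rel q) (i.val + 1) u v ∨ (u ∈ X ∧ v ∉ X) := by
  by_cases hX : u ∈ X ∧ v ∉ X
  · exact Or.inr hX
  left
  refine ⟨(same_split.1 h.1).1, fun k hk => ?_⟩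
  have := h.2 k hk
  have hki : k = i := Fin.ext (by omega)
  subst hki
  simp only [rel, split, if_true] at this ⊢
  by_cases a : u ∈ X <;> by_cases b : v ∈ X <;> simp only [a, b, if_true, if_false] at this hX ⊢
  · omega
  · simp at hX
  · omega
  · omega

noncomputable def ccut (c : V → V → ℕ) (X : Set V) : ℕ :=
  ∑ u, ∑ v, if u ∈ X ∧ v ∉ X then c u v else 0

theorem hierarchy (c : V → V → ℕ) (L : ℕ) (ρ K : ℝ) (hρ : 0 < ρ)
    (hK : Real.log ((2 * tot c : ℕ) : ℝ) + 1 ≤ K)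
    (hL : (tot c : ℝ) * Real.log ((2 * tot c : ℕ) : ℝ) < ρ ^ L * Real.log 2) :
    ∃ q : Fin L → V → ℕ, (∀ u v, c u v ≠ 0 → ¬ term (rel q) L u v) ∧
      ∀ i : Fin L, ∀ X : Set V,
        Real.log 2 * ∑ v, (if small c (rel q) i X v then (dg c (rel q) i v : ℝ) else 0) ≤
          2 * ρ * K * ccut c X := by
  obtain ⟨_, ⟨q, rfl⟩, hmin⟩ := Set.exists_min_image (Set.range (rel (V := V) (L := L))) (Phi c ρ)
    (Set.toFinite _) ⟨_, ⟨fun _ _ => 0, rfl⟩⟩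
  have hmin' : ∀ q', Phi c ρ (rel q) ≤ Phi c ρ (rel q') := fun q' => hmin _ ⟨q', rfl⟩
  have hPsi0 : ∀ (q : Fin L → V → ℕ) i, 0 ≤ Psi c (rel q) i := fun q i =>
    Finset.sum_nonneg fun v _ => mul_nonneg (Nat.cast_nonneg _) (Real.log_natCast_nonneg _)
  refine ⟨q, ?_, ?_⟩
  · intro u v hc ht
    rcases Nat.eq_zero_or_pos L with hL0 | hLp
    · subst hL0
      -- the case of no labels: the single level contains all the edges
      have h1 : 1 ≤ tot c := by
        unfold tot
        have h1 := Finset.single_le_sum (f := fun u => ∑ v, c u v) (fun _ _ => Nat.zero_le _) (Finset.mem_univ u)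
        have h2 := Finset.single_le_sum (f := fun v => c u v) (fun _ _ => Nat.zero_le _) (Finset.mem_univ v)
        omega
      have h2 : Real.log 2 ≤ Real.log ((2 * tot c : ℕ) : ℝ) := by
        have := log_mono_nat (show 2 ≤ 2 * tot c by omega)
        exact_mod_cast this
      have h3 : (1:ℝ) ≤ tot c := by exact_mod_cast h1
      have h4 : 0 ≤ Real.log ((2 * tot c : ℕ) : ℝ) := Real.log_natCast_nonneg _
      rw [pow_zero] at hL
      nlinarith
    have hne : u ≠ v := by
      rintro rfl
      exact ht.2 ⟨L - 1, by omega⟩ (by simp; omega) (le_refl _)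
    have hdu : 1 ≤ dg c (rel q) L u := by
      unfold dg
      have := Finset.single_le_sum (f := fun w => ((if term (rel q) L u w then c u w else 0) + (if term (rel q) L w u then c w u else 0)))
        (fun _ _ => Nat.zero_le _) (Finset.mem_univ v)
      simp only [ht, if_true] at this
      omega
    have hdv : 1 ≤ dg c (rel q) L v := by
      unfold dg
      have := Finset.single_le_sum (f := fun w => ((if term (rel q) L v w then c v w else 0) + (if term (rel q) L w v then c w v else 0)))
        (fun _ _ => Nat.zero_le _) (Finset.mem_univ u)
      simp only [ht, if_true] at this
      omega
    have hvol : ∀ w, 2 ≤ vol c (rel q) L w := by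
      intro w
      unfold vol
      have hall : ∀ x, same (rel q) L w x := fun x j hj => absurd j.2 (by omega)
      simp only [hall, if_true]
      have := Finset.sum_le_sum_of_subset (f := fun w => dg c (rel q) L w) (Finset.subset_univ {u, v})
      rw [Finset.sum_pair hne] at this
      omega
    have hPL : 2 * Real.log 2 ≤ Psi c (rel q) L := by
      unfold Psi
      have := Finset.sum_le_sum_of_subset_of_nonneg (f := fun w => (dg c (rel q) L w : ℝ) * Real.log (vol c (rel q) L w))
        (Finset.subset_univ {u, v}) (fun w _ _ => mul_nonneg (Nat.cast_nonneg _) (Real.log_natCast_nonneg _))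
      rw [Finset.sum_pair hne] at this
      have hlg : ∀ w, Real.log 2 ≤ Real.log (vol c (rel q) L w) := fun w => by
        exact_mod_cast log_mono_nat (hvol w)
      have l2 : 0 < Real.log 2 := Real.log_pos (by norm_num)
      have a1 : (1:ℝ) ≤ dg c (rel q) L u := by exact_mod_cast hdu
      have a2 : (1:ℝ) ≤ dg c (rel q) L v := by exact_mod_cast hdv
      nlinarith [hlg u, hlg v]
    have hPhi : ρ ^ L * Psi c (rel q) L ≤ Phi c ρ (rel q) :=
      Finset.single_le_sum (f := fun i => ρ ^ i * Psi c (rel q) i)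
        (fun i _ => mul_nonneg (by positivity) (hPsi0 q i)) (Finset.self_mem_range_succ L)
    have hz : Phi c ρ (rel (fun (_ : Fin L) (_ : V) => 0)) ≤ (2 * tot c : ℕ) * Real.log ((2 * tot c : ℕ) : ℝ) := by
      unfold Phi
      rw [Finset.sum_eq_single 0]
      · rw [pow_zero, one_mul]
        unfold Psi
        calc _ ≤ ∑ v, (dg c (rel (fun (_ : Fin L) (_ : V) => 0)) 0 v : ℝ) * Real.log ((2 * tot c : ℕ) : ℝ) :=
              Finset.sum_le_sum fun v _ => mul_le_mul_of_nonneg_left (log_mono_nat (vol_le _ _ _ _)) (Nat.cast_nonneg _)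
          _ ≤ _ := by
              rw [← Finset.sum_mul]
              refine mul_le_mul_of_nonneg_right ?_ (Real.log_natCast_nonneg _)
              exact_mod_cast sum_dg_le c (rel (fun (_ : Fin L) (_ : V) => 0)) 0
      · intro j hj hj0
        have hjl : j < L + 1 := Finset.mem_range.1 hj
        have : ∀ u v, ¬ term (rel (fun (_ : Fin L) (_ : V) => 0)) j u v := by
          intro u v h
          exact h.2 ⟨j - 1, by omega⟩ (by simp; omega) (le_refl _)
        simp [Psi, dg, this]
      · simp
    have := hmin' (fun _ _ => 0)
    have h7 : ρ ^ L * (2 * Real.log 2) ≤ ρ ^ L * Psi c (rel q) L :=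
      mul_le_mul_of_nonneg_left hPL (by positivity)
    push_cast at *
    linarith
  · intro i X
    set q' := split q i X with hq'
    set s := Real.log 2 * ∑ v, (if small c (rel q) i X v then (dg c (rel q) i v : ℝ) else 0) with hs
    set x := ccut c X
    have hgain : Psi c (rel q') i ≤ Psi c (rel q) i - s :=
      Psi_gain c (fun u v h => term_split_le (by omega) h)
        (fun u v h => ⟨(same_split.1 h).1, (same_split.1 h).2 le_rfl⟩)
    have hloss : Psi c (rel q') (i.val + 1) ≤ Psi c (rel q) (i.val + 1) + K * (2 * x) := by
      have h1 := Psi_loss c (q := q) (q' := q') (i := i.val + 1)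
        (fun v => ∑ u, ((if v ∈ X ∧ u ∉ X then c v u else 0) + (if u ∈ X ∧ v ∉ X then c u v else 0))) hK
        (by
          intro v
          unfold dg
          rw [← Finset.sum_add_distrib]
          refine Finset.sum_le_sum fun u _ => ?_
          have e1 : (if term (rel q') (i.val + 1) v u then c v u else 0) ≤
              (if term (rel q) (i.val + 1) v u then c v u else 0) + (if v ∈ X ∧ u ∉ X then c v u else 0) := by
            by_cases a : term (rel q') (i.val + 1) v u
            · rcases term_split_succ a with b | b
              · simp [a, b]
              · simp [a, b]
            · simp [a]
          have e2 : (if term (rel q') (i.val + 1) u v then c u v else 0) ≤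
              (if term (rel q) (i.val + 1) u v then c u v else 0) + (if u ∈ X ∧ v ∉ X then c u v else 0) := by
            by_cases a : term (rel q') (i.val + 1) u v
            · rcases term_split_succ a with b | b
              · simp [a, b]
              · simp [a, b]
            · simp [a]
          omega)
        (by
          intro u v
          rw [same_split]
          simp)
      refine h1.trans (le_of_eq ?_)
      congr 2
      have : (∑ v, ∑ u, ((if v ∈ X ∧ u ∉ X then c v u else 0) + (if u ∈ X ∧ v ∉ X then c u v else 0))) = 2 * ccut c X := by
        simp only [Finset.sum_add_distrib]
        rw [two_mul]
        congr 1
        rw [Finset.sum_comm]; rfl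
      exact_mod_cast this
    have hPhi := hmin' q'
    have hsum : Phi c ρ (rel q') ≤ ∑ j ∈ Finset.range (L + 1), (ρ ^ j * Psi c (rel q) j +
        ((if j = i.val then -(ρ ^ i.val * s) else 0) + (if j = i.val + 1 then ρ ^ (i.val + 1) * (K * (2 * x)) else 0))) := by
      unfold Phi
      refine Finset.sum_le_sum fun j hj => ?_
      by_cases a : j = i.val
      · subst a
        have := mul_le_mul_of_nonneg_left hgain (pow_nonneg hρ.le i.val)
        simp; linarith
      · by_cases b : j = i.val + 1
        · subst b
          have := mul_le_mul_of_nonneg_left hloss (pow_nonneg hρ.le (i.val + 1))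
          simp; linarith
        · have := mul_le_mul_of_nonneg_left (Psi_mono c (R := rel q) (R' := rel q') (i := j)
            (fun u v h => term_split_le b h) (fun u v h => (same_split.1 h).1)) (pow_nonneg hρ.le j)
          simp [a, b, this]
    rw [Finset.sum_add_distrib, Finset.sum_add_distrib, Finset.sum_ite_eq', Finset.sum_ite_eq',
      if_pos (Finset.mem_range.2 (by omega)), if_pos (Finset.mem_range.2 (by omega))] at hsum
    have hfin : 0 ≤ ρ ^ i.val * (2 * ρ * K * x - s) := by
      have : Phi c ρ (rel q) = ∑ j ∈ Finset.range (L + 1), ρ ^ j * Psi c (rel q) j := rfl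
      rw [pow_succ] at hsum
      linarith
    have := nonneg_of_mul_nonneg_right hfin (by positivity)
    linarith

end Hier

section DagC
variable {V : Type} [Fintype V] {L : ℕ}

abbrev Bits (L : ℕ) := Fin L → Bool
abbrev VDag (V : Type) (L : ℕ) := (V × Bits L) ⊕ (Fin L × V × Bits L)

noncomputable def rep (q : Fin L → V → ℕ) (i : ℕ) (v : V) : V :=
  @Classical.epsilon V ⟨v⟩ (fun u => same (rel q) i v u)

lemma same_rep (q : Fin L → V → ℕ) (i : ℕ) (v : V) : same (rel q) i v (rep q i v) :=
  Classical.epsilon_spec_aux ⟨v⟩ (fun u => same (rel q) i v u) ⟨v, same_refl q i v⟩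

lemma rep_eq {q : Fin L → V → ℕ} {i : ℕ} {u v : V} (h : same (rel q) i u v) :
    rep q i u = rep q i v := by
  unfold rep
  have : (fun w => same (rel q) i u w) = (fun w => same (rel q) i v w) :=
    funext fun w => propext (same_congr h w)
  rw [this]

def trunc (i : Fin L) (b : Bits L) : Bits L := fun j => if i < j then b j else false

noncomputable def st (q : Fin L → V → ℕ) (i : Fin L) (p : V × Bits L) : V × Bits L :=
  (rep q i p.1, trunc i p.2)

def fwd (q : Fin L → V → ℕ) (p p' : V × Bits L) : Prop :=
  ∃ i : Fin L, same (rel q) (i.val + 1) p.1 p'.1 ∧ q i p.1 < q i p'.1 ∧ ∀ j, i < j → p.2 j = p'.2 j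

def hasOut (E : V → V → Prop) (q : Fin L → V → ℕ) (i : ℕ) (u : V) : Prop :=
  ∃ v, E u v ∧ term (rel q) i u v

def hasIn (E : V → V → Prop) (q : Fin L → V → ℕ) (i : ℕ) (v : V) : Prop :=
  ∃ u, E u v ∧ term (rel q) i u v

def EDag (E : V → V → Prop) (q : Fin L → V → ℕ) : VDag V L → VDag V L → Prop
  | Sum.inl p, Sum.inl p' => E p.1 p'.1 ∧ fwd q p p'
  | Sum.inl p, Sum.inr s => s.2 = st q s.1 p ∧ hasOut E q s.1 p.1 ∧ p.2 s.1 = false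
  | Sum.inr s, Sum.inl p => s.2 = st q s.1 p ∧ hasIn E q s.1 p.1 ∧ p.2 s.1 = true
  | Sum.inr _, Sum.inr _ => False

noncomputable def UDag (U : V → V → ℕ) (d : ℕ → V → ℕ) : VDag V L → VDag V L → ℝ
  | Sum.inl p, Sum.inl p' => U p.1 p'.1
  | Sum.inl p, Sum.inr s => d s.1 p.1
  | Sum.inr s, Sum.inl p => d s.1 p.1
  | Sum.inr _, Sum.inr _ => 0

def piDag : VDag V L → Option V
  | Sum.inl p => some p.1
  | Sum.inr _ => none

lemma UDag_nonneg (U : V → V → ℕ) (d : ℕ → V → ℕ) (x y : VDag V L) : 0 ≤ UDag U d x y := by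
  rcases x with x | x <;> rcases y with y | y <;> simp [UDag]

noncomputable def key (q : Fin L → V → ℕ) : VDag V L → Fin L → ℕ
  | Sum.inl p => fun j => 3 * q j p.1 + (if p.2 j then 2 else 0)
  | Sum.inr s => fun j => if s.1 < j then 3 * q j s.2.1 + (if s.2.2 j then 2 else 0) else
      if j = s.1 then 3 * q j s.2.1 + 1 else 0

noncomputable def lkey (q : Fin L → V → ℕ) (x : VDag V L) : Lex ((Fin L)ᵒᵈ → ℕ) :=
  toLex fun j => key q x (OrderDual.ofDual j)

lemma lkey_lt {q : Fin L → V → ℕ} {x y : VDag V L} (i : Fin L)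
    (h1 : ∀ j : Fin L, i < j → key q x j = key q y j) (h2 : key q x i < key q y i) :
    lkey q x < lkey q y :=
  ⟨OrderDual.toDual i, fun j hj => h1 (OrderDual.ofDual j) hj, h2⟩

lemma key_lt {E : V → V → Prop} {q : Fin L → V → ℕ} {x y : VDag V L} (h : EDag E q x y) :
    lkey q x < lkey q y := by
  rcases x with p | s <;> rcases y with p' | s'
  · obtain ⟨_, i, h1, h2, h3⟩ := h
    refine lkey_lt i (fun j hj => ?_) ?_
    · have := same_rel.1 h1 j (by have : i.val < j.val := hj; exact this)
      simp only [key]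
      rw [this, h3 j hj]
    · simp only [key]
      split_ifs <;> omega
  · obtain ⟨i, r, β⟩ := s'
    obtain ⟨h1, _, h3⟩ := h
    simp only [st, Prod.mk.injEq] at h1
    obtain ⟨rfl, rfl⟩ := h1
    simp only at h3
    have hr := same_rel.1 (same_rep q i p.1)
    refine lkey_lt i (fun j hj => ?_) ?_
    · simp only [key]
      rw [if_pos hj, hr j (le_of_lt hj)]
      simp [trunc, hj]
    · simp only [key]
      rw [hr i le_rfl, h3]
      simp
  · obtain ⟨i, r, β⟩ := s
    obtain ⟨h1, _, h3⟩ := h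
    simp only [st, Prod.mk.injEq] at h1
    obtain ⟨rfl, rfl⟩ := h1
    simp only at h3
    have hr := same_rel.1 (same_rep q i p'.1)
    refine lkey_lt i (fun j hj => ?_) ?_
    · simp only [key]
      rw [if_pos hj, hr j (le_of_lt hj)]
      simp [trunc, hj]
    · simp only [key]
      rw [hr i le_rfl, h3]
      simp
  · exact h.elim

lemma isDag_EDag (E : V → V → Prop) (q : Fin L → V → ℕ) : IsDag (EDag E q) := by
  intro x hx
  have : ∀ y, Relation.TransGen (EDag E q) x y → lkey q x < lkey q y := by
    intro y h
    induction h with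
    | single h => exact key_lt h
    | tail _ h ih => exact ih.trans (key_lt h)
  exact lt_irrefl _ (this x hx)

lemma width_EDag (v : V) : ((piDag (V := V) (L := L)) ⁻¹' {some v}).ncard ≤ 2 ^ L := by
  have : ((piDag (V := V) (L := L)) ⁻¹' {some v}) ⊆ (fun b : Bits L => Sum.inl (v, b)) '' Set.univ := by
    rintro (⟨u, b⟩ | s) h
    · simp only [piDag, Set.mem_preimage, Set.mem_singleton_iff, Option.some.injEq] at h
      subst h
      exact ⟨b, trivial, rfl⟩
    · simp [piDag] at h
  refine (Set.ncard_le_ncard this (Set.toFinite _)).trans ((Set.ncard_image_le (Set.toFinite _)).trans ?_)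
  rw [Set.ncard_univ]
  simp

lemma edges_EDag (E : V → V → Prop) (q : Fin L → V → ℕ) :
    {p : VDag V L × VDag V L | EDag E q p.1 p.2}.ncard ≤
      {p : V × V | E p.1 p.2}.ncard * (2 ^ L * 2 ^ L + (L * 2 ^ L + L * 2 ^ L)) := by
  let f : (V × V) × ((Bits L × Bits L) ⊕ ((Fin L × Bits L) ⊕ (Fin L × Bits L))) → VDag V L × VDag V L :=
    fun x => match x.2 with
      | Sum.inl b => (Sum.inl (x.1.1, b.1), Sum.inl (x.1.2, b.2))
      | Sum.inr (Sum.inl b) => (Sum.inl (x.1.1, b.2), Sum.inr (b.1, st q b.1 (x.1.1, b.2)))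
      | Sum.inr (Sum.inr b) => (Sum.inr (b.1, st q b.1 (x.1.2, b.2)), Sum.inl (x.1.2, b.2))
  have hsub : {p : VDag V L × VDag V L | EDag E q p.1 p.2} ⊆ f '' ({p : V × V | E p.1 p.2} ×ˢ Set.univ) := by
    rintro ⟨x | x, y | y⟩ h
    · exact ⟨((x.1, y.1), Sum.inl (x.2, y.2)), ⟨h.1, trivial⟩, rfl⟩
    · obtain ⟨i, r⟩ := y
      obtain ⟨h1, ⟨v, hv, _⟩, _⟩ := h
      simp only at h1
      subst h1
      exact ⟨((x.1, v), Sum.inr (Sum.inl (i, x.2))), ⟨hv, trivial⟩, rfl⟩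
    · obtain ⟨i, r⟩ := x
      obtain ⟨h1, ⟨v, hv, _⟩, _⟩ := h
      simp only at h1
      subst h1
      exact ⟨((v, y.1), Sum.inr (Sum.inr (i, y.2))), ⟨hv, trivial⟩, rfl⟩
    · exact h.elim
  refine (Set.ncard_le_ncard hsub (Set.toFinite _)).trans ((Set.ncard_image_le (Set.toFinite _)).trans ?_)
  rw [Set.ncard_prod, Set.ncard_univ]
  simp

/-- reachability: walks avoiding the cut -/
lemma first_last {W T : V → V → Prop} {s t : V} (h : Relation.ReflTransGen W s t) :
    Relation.ReflTransGen (fun u v => W u v ∧ ¬ T u v) s t ∨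
    ∃ u v u' v', Relation.ReflTransGen (fun u v => W u v ∧ ¬ T u v) s u ∧ W u v ∧ T u v ∧
      Relation.ReflTransGen W v v' ∧ W u' v' ∧ T u' v' ∧
      Relation.ReflTransGen (fun u v => W u v ∧ ¬ T u v) v' t := by
  induction h with
  | refl => exact Or.inl Relation.ReflTransGen.refl
  | @tail b t _ hb ih =>
    by_cases hT : T b t
    · right
      rcases ih with h | ⟨u, v, u', v', h1, h2, h3, h4, h5, h6, h7⟩
      · exact ⟨b, t, b, t, h, hb, hT, Relation.ReflTransGen.refl, hb, hT, Relation.ReflTransGen.refl⟩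
      · refine ⟨u, v, b, t, h1, h2, h3, ?_, hb, hT, Relation.ReflTransGen.refl⟩
        exact (h4.trans (Relation.ReflTransGen.mono (fun _ _ h => h.1) _ _ h7)).tail hb
    · rcases ih with h | ⟨u, v, u', v', h1, h2, h3, h4, h5, h6, h7⟩
      · exact Or.inl (h.tail ⟨hb, hT⟩)
      · exact Or.inr ⟨u, v, u', v', h1, h2, h3, h4, h5, h6, h7.tail ⟨hb, hT⟩⟩

lemma reach_level {q : Fin L → V → ℕ} {Y : Set (VDag V L)} {G' : V → V → Prop}
    (e1 : ∀ u v b b', G' u v → fwd q (u, b) (v, b') → Sum.inl (u, b) ∈ Y → Sum.inl (v, b') ∈ Y)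
    (e2 : ∀ u v b (i : Fin L), G' u v → term (rel q) i u v → b i = false → Sum.inl (u, b) ∈ Y →
      Sum.inr (i, st q i (u, b)) ∈ Y)
    (e3 : ∀ u v b (i : Fin L), G' u v → term (rel q) i u v → b i = true →
      Sum.inr (i, st q i (v, b)) ∈ Y → Sum.inl (v, b) ∈ Y) (i : ℕ) (hi : i ≤ L) :
    ∀ s t, Relation.ReflTransGen (fun u v => (G' u v ∧ same (rel q) i u v) ∧ ¬ term (rel q) i u v) s t →
      ∀ β : Bits L, ∃ b b' : Bits L, (∀ j : Fin L, i ≤ j.val → b j = β j ∧ b' j = β j) ∧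
        ((Sum.inl (s, b) : VDag V L) ∈ Y → (Sum.inl (t, b') : VDag V L) ∈ Y) := by
  induction i with
  | zero =>
    intro s t h β
    have : s = t := by
      induction h with
      | refl => rfl
      | tail _ hb _ => exact absurd ⟨hb.1.2, fun j hj => absurd hj (by omega)⟩ hb.2
    subst this
    exact ⟨β, β, fun j _ => ⟨rfl, rfl⟩, id⟩
  | succ i ih =>
    have ih := ih (by omega)
    let I : Fin L := ⟨i, by omega⟩
    have hB : ∀ s t, Relation.ReflTransGen (fun u v => G' u v ∧ same (rel q) i u v) s t →
        ∀ β : Bits L, ∃ b b' : Bits L, (∀ j : Fin L, i + 1 ≤ j.val → b j = β j ∧ b' j = β j) ∧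
          ((Sum.inl (s, b) : VDag V L) ∈ Y → (Sum.inl (t, b') : VDag V L) ∈ Y) := by
      intro s t h β
      rcases first_last (T := term (rel q) i) h with h | ⟨u, v, u', v', h1, h2, h3, h4, h5, h6, h7⟩
      · obtain ⟨b, b', hb, hY⟩ := ih s t h β
        exact ⟨b, b', fun j hj => hb j (by omega), hY⟩
      · obtain ⟨b, b', hb, hY⟩ := ih s u h1 (Function.update β I false)
        obtain ⟨a, a', ha, hY'⟩ := ih v' t h7 (Function.update β I true)
        have hne : ∀ j : Fin L, i + 1 ≤ j.val → j ≠ I := by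
          rintro j hj rfl
          simp only [I] at hj; omega
        refine ⟨b, a', fun j hj => ⟨?_, ?_⟩, fun hs => hY' ?_⟩
        · rw [(hb j (by omega)).1, Function.update_of_ne (hne j hj)]
        · rw [(ha j (by omega)).2, Function.update_of_ne (hne j hj)]
        · have s1 := e2 u v b' I h2.1 h3 (by rw [(hb I le_rfl).2, Function.update_self]) (hY hs)
          refine e3 u' v' a I h5.1 h6 (by rw [(ha I le_rfl).1, Function.update_self]) ?_
          have hsame : same (rel q) i v v' := by
            clear h5 h6 h7 hY'
            induction h4 with
            | refl => exact same_refl q i v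
            | tail _ hb ih => exact same_trans ih hb.2
          have hst : st q I (u, b') = st q I (v', a) := by
            unfold st
            refine Prod.ext ?_ ?_
            · exact rep_eq (same_trans h2.2 hsame)
            · funext j
              simp only [trunc]
              split_ifs with hj
              · have hj' : i + 1 ≤ j.val := hj
                rw [(hb j (by omega)).2, (ha j (by omega)).1]
                simp [Function.update_of_ne (hne j hj')]
              · rfl
          rw [← hst]; exact s1
    intro s t h β
    have hP : ∃ w, Relation.ReflTransGen (fun u v => G' u v ∧ same (rel q) i u v) s w ∧
        (w = t ∨ ∃ w', G' w w' ∧ same (rel q) (i + 1) w w' ∧ q I w < q I w' ∧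
          ∃ b b' : Bits L, (∀ j : Fin L, i + 1 ≤ j.val → b j = β j ∧ b' j = β j) ∧
          ((Sum.inl (w', b) : VDag V L) ∈ Y → (Sum.inl (t, b') : VDag V L) ∈ Y)) := by
      induction h using Relation.ReflTransGen.head_induction_on with
      | refl => exact ⟨t, Relation.ReflTransGen.refl, Or.inl rfl⟩
      | @head s s' hs _ ihP =>
        obtain ⟨⟨hG, hsm⟩, hnt⟩ := hs
        have hle : q I s ≤ q I s' := by
          by_contra hlt
          apply hnt
          refine ⟨hsm, fun j hj => ?_⟩
          have : j = I := Fin.ext (by simp only [I]; omega)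
          subst this
          exact hlt
        rcases hle.eq_or_lt with he | hlt
        · have hsi : same (rel q) i s s' := by
            rw [same_rel] at hsm ⊢
            intro j hj
            by_cases hji : j = I
            · subst hji; exact he
            · exact hsm j (by
                have : j.val ≠ i := fun h => hji (Fin.ext h)
                omega)
          obtain ⟨w, h1, h2⟩ := ihP
          exact ⟨w, h1.head ⟨hG, hsi⟩, h2⟩
        · refine ⟨s, Relation.ReflTransGen.refl, Or.inr ⟨s', hG, hsm, hlt, ?_⟩⟩
          obtain ⟨w, h1, h2⟩ := ihP
          obtain ⟨a, a', ha, hY⟩ := hB s' w h1 β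
          rcases h2 with rfl | ⟨w', g1, g2, g3, b, b', hb, hY'⟩
          · exact ⟨a, a', ha, hY⟩
          · refine ⟨a, b', fun j hj => ⟨(ha j hj).1, (hb j hj).2⟩, fun h => hY' ?_⟩
            refine e1 w w' a' b g1 ⟨I, g2, g3, fun j hj => ?_⟩ (hY h)
            have hj' : i + 1 ≤ j.val := hj
            exact (ha j hj').2.trans (hb j hj').1.symm
    obtain ⟨w, h1, h2⟩ := hP
    obtain ⟨a, a', ha, hY⟩ := hB s w h1 β
    rcases h2 with rfl | ⟨w', g1, g2, g3, b, b', hb, hY'⟩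
    · exact ⟨a, a', ha, hY⟩
    · refine ⟨a, b', fun j hj => ⟨(ha j hj).1, (hb j hj).2⟩, fun h => hY' ?_⟩
      refine e1 w w' a' b g1 ⟨I, g2, g3, fun j hj => ?_⟩ (hY h)
      have hj' : i + 1 ≤ j.val := hj
      exact (ha j hj').2.trans (hb j hj').1.symm

lemma cutcap_EDag (E : V → V → Prop) (U : V → V → ℕ) (q : Fin L → V → ℕ) (d : ℕ → V → ℕ)
    (Y : Set (VDag V L)) :
    cutcap (EDag E q) (UDag U d) Y =
      (∑ p : V × Bits L, ∑ p' : V × Bits L,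
        if (Sum.inl p : VDag V L) ∈ Y ∧ (Sum.inl p' : VDag V L) ∉ Y ∧ (E p.1 p'.1 ∧ fwd q p p') then (U p.1 p'.1 : ℝ) else 0) +
      (∑ p : V × Bits L, ∑ i : Fin L,
        if (Sum.inl p : VDag V L) ∈ Y ∧ (Sum.inr (i, st q i p) : VDag V L) ∉ Y ∧ hasOut E q i p.1 ∧ p.2 i = false then (d i p.1 : ℝ) else 0) +
      (∑ p : V × Bits L, ∑ i : Fin L,
        if (Sum.inr (i, st q i p) : VDag V L) ∈ Y ∧ (Sum.inl p : VDag V L) ∉ Y ∧ hasIn E q i p.1 ∧ p.2 i = true then (d i p.1 : ℝ) else 0) := by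
  unfold cutcap
  rw [Fintype.sum_sum_type]
  simp only [Fintype.sum_sum_type]
  simp only [Finset.sum_add_distrib]
  have h4 : ∑ x : Fin L × V × Bits L, ∑ y : Fin L × V × Bits L,
      (if (Sum.inr x : VDag V L) ∈ Y ∧ (Sum.inr y : VDag V L) ∉ Y ∧ EDag E q (Sum.inr x) (Sum.inr y) then
        UDag U d (Sum.inr x) (Sum.inr y) else 0) = 0 := by
    simp [EDag]
  rw [h4, add_zero]
  refine congrArg₂ (· + ·) (congrArg₂ (· + ·) ?_ ?_) ?_
  · refine Finset.sum_congr rfl fun p _ => Finset.sum_congr rfl fun r _ => ?_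
    exact if_congr Iff.rfl rfl rfl
  · refine Finset.sum_congr rfl fun p _ => ?_
    rw [Fintype.sum_prod_type]
    refine Finset.sum_congr rfl fun i _ => ?_
    rw [Finset.sum_eq_single (st q i p)]
    · simp only [EDag, UDag, true_and]
    · intro r _ hr
      simp [EDag, hr]
    · simp
  · rw [Finset.sum_comm]
    refine Finset.sum_congr rfl fun p _ => ?_
    rw [Fintype.sum_prod_type]
    refine Finset.sum_congr rfl fun i _ => ?_
    rw [Finset.sum_eq_single (st q i p)]
    · simp only [EDag, UDag, true_and]
    · intro r _ hr
      simp [EDag, hr]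
    · simp

noncomputable def cE (E : V → V → Prop) (U : V → V → ℕ) (u v : V) : ℕ := if E u v then U u v else 0

lemma cutcap_eq_ccut (E : V → V → Prop) (U : V → V → ℕ) (X : Set V) :
    cutcap E (fun u v => (U u v : ℝ)) X = ccut (cE E U) X := by
  unfold cutcap ccut cE
  push_cast
  refine Finset.sum_congr rfl fun u _ => Finset.sum_congr rfl fun v _ => ?_
  by_cases h1 : u ∈ X ∧ v ∉ X <;> by_cases h2 : E u v <;> simp [h1, h2]

lemma sum_term_le_dg {c : V → V → ℕ} (R : Fin L → V → V → Prop) (i : ℕ) (u : V) :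
    (∑ v, if term R i u v then (c u v : ℝ) else 0) ≤ dg c R i u ∧
    (∑ v, if term R i v u then (c v u : ℝ) else 0) ≤ dg c R i u := by
  unfold dg
  push_cast
  constructor <;> refine Finset.sum_le_sum fun v _ => ?_
  · have : (0:ℝ) ≤ if term R i v u then (c v u : ℝ) else 0 := by split_ifs <;> simp
    linarith
  · have : (0:ℝ) ≤ if term R i u v then (c u v : ℝ) else 0 := by split_ifs <;> simp
    linarith

lemma lower_cut {E : V → V → Prop} {U : V → V → ℕ} {q : Fin L → V → ℕ}
    (hq : ∀ u v, cE E U u v ≠ 0 → ¬ term (rel q) L u v) (hU : ∀ u v, E u v → 1 ≤ U u v)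
    {S T : Set V} (Y : Set (VDag V L)) (hS : ∀ v ∈ S, ∀ b, Sum.inl (v, b) ∈ Y)
    (hT : ∀ v ∈ T, ∀ b, Sum.inl (v, b) ∉ Y) :
    ∃ X : Set V, S ⊆ X ∧ (∀ v ∈ T, v ∉ X) ∧
      cutcap E (fun u v => (U u v : ℝ)) X ≤ cutcap (EDag E q) (UDag U (dg (cE E U) (rel q))) Y := by
  set c := cE E U with hc
  let M1 : V → V → Prop := fun u v => ∃ b b' : Bits L, (Sum.inl (u, b) : VDag V L) ∈ Y ∧ (Sum.inl (v, b') : VDag V L) ∉ Y ∧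
    fwd q (u, b) (v, b')
  let N2 : Fin L → V → Prop := fun i u => ∃ b : Bits L, (Sum.inl (u, b) : VDag V L) ∈ Y ∧
    (Sum.inr (i, st q i (u, b)) : VDag V L) ∉ Y ∧ b i = false
  let N3 : Fin L → V → Prop := fun i v => ∃ b : Bits L, (Sum.inr (i, st q i (v, b)) : VDag V L) ∈ Y ∧
    (Sum.inl (v, b) : VDag V L) ∉ Y ∧ b i = true
  let M : V → V → Prop := fun u v => M1 u v ∨ (∃ i : Fin L, term (rel q) i u v ∧ N2 i u) ∨
    (∃ i : Fin L, term (rel q) i u v ∧ N3 i v)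
  let G' : V → V → Prop := fun u v => E u v ∧ ¬ M u v
  let X : Set V := {v | ∃ s ∈ S, Relation.ReflTransGen G' s v}
  refine ⟨X, fun s hs => ⟨s, hs, Relation.ReflTransGen.refl⟩, ?_, ?_⟩
  · rintro t ht ⟨s, hs, hr⟩
    have hlev := reach_level (q := q) (Y := Y) (G' := G')
      (by
        intro u v b b' hG hf hu
        by_contra hv
        exact hG.2 (Or.inl ⟨b, b', hu, hv, hf⟩))
      (by
        intro u v b i hG ht hb hu
        by_contra hv
        exact hG.2 (Or.inr (Or.inl ⟨i, ht, b, hu, hv, hb⟩)))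
      (by
        intro u v b i hG ht hb hu
        by_contra hv
        exact hG.2 (Or.inr (Or.inr ⟨i, ht, b, hu, hv, hb⟩))) L le_rfl s t
      (by
        refine Relation.ReflTransGen.mono (fun u v h => ⟨⟨h, fun j hj => absurd j.2 (by omega)⟩, hq u v ?_⟩) _ _ hr
        have := hU u v h.1
        simp only [hc, cE, h.1, if_true]
        omega) (fun _ => false)
    obtain ⟨b, b', _, h⟩ := hlev
    exact hT t ht b' (h (hS s hs b))
  · have hcap : cutcap E (fun u v => (U u v : ℝ)) X ≤
        (∑ u, ∑ v, if E u v ∧ M1 u v then (U u v : ℝ) else 0) +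
        (∑ u, ∑ v, ∑ i : Fin L, if term (rel q) i u v ∧ N2 i u then (c u v : ℝ) else 0) +
        (∑ u, ∑ v, ∑ i : Fin L, if term (rel q) i u v ∧ N3 i v then (c u v : ℝ) else 0) := by
      unfold cutcap
      simp only [← Finset.sum_add_distrib]
      refine Finset.sum_le_sum fun u _ => Finset.sum_le_sum fun v _ => ?_
      have p1 : (0:ℝ) ≤ if E u v ∧ M1 u v then (U u v : ℝ) else 0 := by split_ifs <;> simp
      have p2 : ∀ i ∈ Finset.univ, (0:ℝ) ≤ (fun i : Fin L => if term (rel q) i u v ∧ N2 i u then (c u v : ℝ) else 0) i := by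
        intro i _; beta_reduce; split_ifs <;> simp
      have p3 : ∀ i ∈ Finset.univ, (0:ℝ) ≤ (fun i : Fin L => if term (rel q) i u v ∧ N3 i v then (c u v : ℝ) else 0) i := by
        intro i _; beta_reduce; split_ifs <;> simp
      have s2 := Finset.sum_nonneg p2
      have s3 := Finset.sum_nonneg p3
      by_cases h : u ∈ X ∧ v ∉ X ∧ E u v
      · rw [if_pos h]
        have hM : M u v := by
          by_contra hM
          obtain ⟨⟨s, hs, hr⟩, h2, h3⟩ := h
          exact h2 ⟨s, hs, hr.tail ⟨h3, hM⟩⟩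
        have hcu : (c u v : ℝ) = U u v := by simp [hc, cE, h.2.2]
        rcases hM with hM | ⟨i, hM⟩ | ⟨i, hM⟩
        · rw [if_pos ⟨h.2.2, hM⟩]; linarith
        · have := Finset.single_le_sum p2 (Finset.mem_univ i)
          beta_reduce at this
          rw [if_pos hM] at this
          linarith
        · have := Finset.single_le_sum p3 (Finset.mem_univ i)
          beta_reduce at this
          rw [if_pos hM] at this
          linarith
      · rw [if_neg h]; linarith
    refine hcap.trans ?_
    rw [cutcap_EDag]
    refine add_le_add (add_le_add ?_ ?_) ?_
    · rw [Fintype.sum_prod_type]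
      simp only [Fintype.sum_prod_type (α₁ := V) (α₂ := Bits L)]
      refine Finset.sum_le_sum fun u _ => ?_
      rw [Finset.sum_comm]
      refine Finset.sum_le_sum fun v _ => ?_
      by_cases h : E u v ∧ M1 u v
      · rw [if_pos h]
        obtain ⟨hE, b, b', h1, h2, h3⟩ := h
        refine le_trans ?_ (Finset.single_le_sum (fun b _ => ?_) (Finset.mem_univ b))
        · refine le_trans ?_ (Finset.single_le_sum (fun b' _ => ?_) (Finset.mem_univ b'))
          · rw [if_pos ⟨h1, h2, hE, h3⟩]
          · split_ifs <;> simp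
        · refine Finset.sum_nonneg fun b' _ => ?_
          split_ifs <;> simp
      · rw [if_neg h]
        refine Finset.sum_nonneg fun b _ => Finset.sum_nonneg fun b' _ => ?_
        split_ifs <;> simp
    · rw [Fintype.sum_prod_type]
      refine Finset.sum_le_sum fun u _ => ?_
      rw [Finset.sum_comm]
      conv_rhs => rw [Finset.sum_comm]
      refine Finset.sum_le_sum fun i _ => ?_
      by_cases h : N2 i u ∧ hasOut E q i u
      · obtain ⟨⟨b, h1, h2, h3⟩, h4⟩ := h
        refine le_trans ?_ (Finset.single_le_sum (fun b _ => ?_) (Finset.mem_univ b))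
        · rw [if_pos ⟨h1, h2, h4, h3⟩]
          refine le_trans (Finset.sum_le_sum fun v _ => ?_) (sum_term_le_dg (rel q) i u).1
          by_cases ht : term (rel q) i u v
          · simp only [ht, true_and, if_true]
            split_ifs <;> simp
          · simp [ht]
        · split_ifs <;> simp
      · have : ∑ v, (if term (rel q) i u v ∧ N2 i u then (c u v : ℝ) else 0) = 0 := by
          refine Finset.sum_eq_zero fun v _ => ?_
          split_ifs with h'
          · by_cases hE : E u v
            · exact absurd ⟨h'.2, v, hE, h'.1⟩ h
            · simp [hc, cE, hE]
          · rfl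
        rw [this]
        refine Finset.sum_nonneg fun b _ => ?_
        split_ifs <;> simp
    · rw [Fintype.sum_prod_type, Finset.sum_comm]
      refine Finset.sum_le_sum fun u _ => ?_
      rw [Finset.sum_comm]
      conv_rhs => rw [Finset.sum_comm]
      refine Finset.sum_le_sum fun i _ => ?_
      by_cases h : N3 i u ∧ hasIn E q i u
      · obtain ⟨⟨b, h1, h2, h3⟩, h4⟩ := h
        refine le_trans ?_ (Finset.single_le_sum (fun b _ => ?_) (Finset.mem_univ b))
        · rw [if_pos ⟨h1, h2, h4, h3⟩]
          refine le_trans (Finset.sum_le_sum fun v _ => ?_) (sum_term_le_dg (rel q) i u).2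
          by_cases ht : term (rel q) i v u
          · simp only [ht, true_and, if_true]
            split_ifs <;> simp
          · simp [ht]
        · split_ifs <;> simp
      · have : ∑ v, (if term (rel q) i v u ∧ N3 i u then (c v u : ℝ) else 0) = 0 := by
          refine Finset.sum_eq_zero fun v _ => ?_
          split_ifs with h'
          · by_cases hE : E v u
            · exact absurd ⟨h'.2, v, hE, h'.1⟩ h
            · simp [hc, cE, hE]
          · rfl
        rw [this]
        refine Finset.sum_nonneg fun b _ => ?_
        split_ifs <;> simp

/-- The heavier side of the class of `r` is `X`. -/
def heavy (c : V → V → ℕ) (R : Fin L → V → V → Prop) (i : ℕ) (X : Set V) (r : V) : Prop :=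
  vol c R i r ≤ 2 * ∑ u, if same R i r u ∧ u ∈ X then dg c R i u else 0

lemma heavy_congr {c : V → V → ℕ} {q : Fin L → V → ℕ} {i : ℕ} {X : Set V} {u v : V}
    (h : same (rel q) i u v) : heavy c (rel q) i X u ↔ heavy c (rel q) i X v := by
  unfold heavy vol
  simp only [same_congr h]

lemma small_of_heavy {c : V → V → ℕ} {q : Fin L → V → ℕ} {i : ℕ} {X : Set V} {v : V}
    (h : heavy c (rel q) i X v) (hv : v ∉ X) : small c (rel q) i X v := by
  unfold heavy at h
  unfold small
  have : vol c (rel q) i v = (∑ u, if same (rel q) i v u ∧ u ∈ X then dg c (rel q) i u else 0) +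
      ∑ u, if same (rel q) i v u ∧ (u ∈ X ↔ v ∈ X) then dg c (rel q) i u else 0 := by
    unfold vol
    rw [← Finset.sum_add_distrib]
    refine Finset.sum_congr rfl fun u _ => ?_
    by_cases a : same (rel q) i v u <;> by_cases b : u ∈ X <;> simp [a, b, hv]
  omega

lemma small_of_not_heavy {c : V → V → ℕ} {q : Fin L → V → ℕ} {i : ℕ} {X : Set V} {v : V}
    (h : ¬ heavy c (rel q) i X v) (hv : v ∈ X) : small c (rel q) i X v := by
  unfold heavy at h
  unfold small
  simp only [hv, iff_true]
  omega

lemma upper_cut {E : V → V → Prop} {U : V → V → ℕ} {q : Fin L → V → ℕ} {B : ℝ} (X : Set V)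
    (hB : ∀ i : Fin L, ∑ v, (if small (cE E U) (rel q) i X v then (dg (cE E U) (rel q) i v : ℝ) else 0) ≤
      B * ccut (cE E U) X) :
    ∃ Y : Set (VDag V L), (∀ v b, Sum.inl (v, b) ∈ Y ↔ v ∈ X) ∧
      cutcap (EDag E q) (UDag U (dg (cE E U) (rel q))) Y ≤
        (2 ^ L * 2 ^ L + L * 2 ^ L * B) * cutcap E (fun u v => (U u v : ℝ)) X := by
  set c := cE E U with hc
  let Y : Set (VDag V L) := {x | match x with
    | Sum.inl p => p.1 ∈ X
    | Sum.inr s => heavy c (rel q) s.1 X s.2.1}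
  have hYl : ∀ p, (Sum.inl p : VDag V L) ∈ Y ↔ p.1 ∈ X := fun p => Iff.rfl
  have hYr : ∀ i p, (Sum.inr (i, st q i p) : VDag V L) ∈ Y ↔ heavy c (rel q) i X p.1 := by
    intro i p
    have : (Sum.inr (i, st q i p) : VDag V L) ∈ Y ↔ heavy c (rel q) i X (rep q i p.1) := Iff.rfl
    rw [this]
    exact (heavy_congr (same_rep q i p.1)).symm
  refine ⟨Y, fun v b => hYl (v, b), ?_⟩
  rw [cutcap_EDag, add_assoc, add_mul]
  have hcard : (Fintype.card (Bits L) : ℝ) = 2 ^ L := by simp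
  refine add_le_add ?_ ?_
  · calc _ ≤ ∑ p : V × Bits L, ∑ p' : V × Bits L, (if p.1 ∈ X ∧ p'.1 ∉ X ∧ E p.1 p'.1 then (U p.1 p'.1 : ℝ) else 0) := by
          refine Finset.sum_le_sum fun p _ => Finset.sum_le_sum fun p' _ => ?_
          rw [hYl, hYl]
          by_cases h : p.1 ∈ X ∧ p'.1 ∉ X ∧ E p.1 p'.1
          · rw [if_pos h]; split_ifs <;> simp
          · rw [if_neg h, if_neg (by tauto)]
      _ = _ := by
          unfold cutcap
          rw [Fintype.sum_prod_type]
          simp only [Fintype.sum_prod_type (α₁ := V) (α₂ := Bits L), Finset.sum_const, Finset.card_univ,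
            nsmul_eq_mul, hcard, ← Finset.mul_sum]
          ring
  · rw [← Finset.sum_add_distrib]
    calc _ ≤ ∑ p : V × Bits L, ∑ i : Fin L, (if small c (rel q) i X p.1 then (dg c (rel q) i p.1 : ℝ) else 0) := by
          refine Finset.sum_le_sum fun p _ => ?_
          rw [← Finset.sum_add_distrib]
          refine Finset.sum_le_sum fun i _ => ?_
          rw [hYl, hYr]
          by_cases hp : p.1 ∈ X <;> by_cases hh : heavy c (rel q) i X p.1
          · rw [if_neg (by tauto), if_neg (by tauto)]
            split_ifs <;> simp
          · rw [if_pos (small_of_not_heavy hh hp)]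
            refine le_trans (add_le_add (b := (dg c (rel q) i p.1 : ℝ)) ?_
              (le_of_eq (if_neg (fun h => hh h.1)))) (by simp)
            split_ifs <;> simp
          · rw [if_pos (small_of_heavy hh hp)]
            refine le_trans (add_le_add (d := (dg c (rel q) i p.1 : ℝ))
              (le_of_eq (if_neg (fun h => hp h.1))) ?_) (by simp)
            split_ifs <;> simp
          · rw [if_neg (by tauto), if_neg (by tauto)]
            split_ifs <;> simp
      _ = ∑ i : Fin L, 2 ^ L * ∑ v, (if small c (rel q) i X v then (dg c (rel q) i v : ℝ) else 0) := by
          rw [Finset.sum_comm]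
          refine Finset.sum_congr rfl fun i _ => ?_
          rw [Fintype.sum_prod_type]
          simp only [Finset.sum_const, Finset.card_univ, nsmul_eq_mul, hcard, ← Finset.mul_sum]
      _ ≤ ∑ i : Fin L, 2 ^ L * (B * ccut c X) :=
          Finset.sum_le_sum fun i _ => mul_le_mul_of_nonneg_left (hB i) (by positivity)
      _ = _ := by
          rw [cutcap_eq_ccut]
          simp only [Finset.sum_const, Finset.card_univ, nsmul_eq_mul, Fintype.card_fin]
          ring

end DagC

open Filter in
lemma eventually_bounds (c : ℝ) (hc : 0 < c) (k L : ℕ) (hL : (k : ℝ) + 4 ≤ c / 4 * L) :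
    ∃ n₀ : ℕ, ∀ n : ℕ, n₀ ≤ n → 1 ≤ n ∧
      Real.log (2 * (n : ℝ) ^ (k + 2)) + 1 ≤ (n : ℝ) ^ (c / 4) ∧
      (n : ℝ) ^ (k + 2) * Real.log (2 * (n : ℝ) ^ (k + 2)) < ((n : ℝ) ^ (c / 4)) ^ L * Real.log 2 ∧
      ((2 : ℝ) ^ L * 2 ^ L + (L * 2 ^ L + L * 2 ^ L)) ≤ (n : ℝ) ^ c ∧
      (2 : ℝ) ^ L * 2 ^ L + L * 2 ^ L * (2 * (n : ℝ) ^ (c / 4) * (n : ℝ) ^ (c / 4) / Real.log 2) ≤ (n : ℝ) ^ c := by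
  have hl2 : 0 < Real.log 2 := Real.log_pos (by norm_num)
  have hγ : 0 < c / 4 := by linarith
  have t1 : Tendsto (fun n : ℕ => (n : ℝ)) atTop atTop := tendsto_natCast_atTop_atTop
  have t2 : Tendsto (fun n : ℕ => (n : ℝ) ^ (c / 4)) atTop atTop := (tendsto_rpow_atTop hγ).comp t1
  have t3 : ∀ δ : ℝ, 0 < δ → ∀ᶠ n : ℕ in atTop,
      Real.log (2 * (n : ℝ) ^ (k + 2)) + 1 ≤ (n : ℝ) ^ δ := by
    intro δ hδ
    have hε : (0:ℝ) < 1 / (2 * (k + 2)) := by positivity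
    have o := ((isLittleO_log_rpow_atTop hδ).bound hε)
    have o' := t1.eventually o
    have t4 : Tendsto (fun n : ℕ => (n : ℝ) ^ δ) atTop atTop := (tendsto_rpow_atTop hδ).comp t1
    filter_upwards [o', t4.eventually_ge_atTop (2 * (Real.log 2 + 1)), eventually_ge_atTop 1] with n h1 h2 h3
    have hn : (1:ℝ) ≤ n := by exact_mod_cast h3
    have hp : 0 ≤ (n:ℝ) ^ δ := by positivity
    rw [Real.norm_of_nonneg (Real.log_nonneg hn), Real.norm_of_nonneg hp] at h1
    rw [Real.log_mul (by norm_num) (by positivity), Real.log_pow]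
    push_cast
    have h4 : ((k:ℝ) + 2) * Real.log n ≤ ((k:ℝ) + 2) * (1 / (2 * (k + 2)) * (n:ℝ) ^ δ) :=
      mul_le_mul_of_nonneg_left h1 (by positivity)
    have h5 : ((k:ℝ) + 2) * (1 / (2 * (k + 2)) * (n:ℝ) ^ δ) = (n:ℝ) ^ δ / 2 := by
      field_simp
    linarith
  have hev : ∀ᶠ n : ℕ in atTop, 1 ≤ n ∧
      Real.log (2 * (n : ℝ) ^ (k + 2)) + 1 ≤ (n : ℝ) ^ (c / 4) ∧
      (n : ℝ) ^ (k + 2) * Real.log (2 * (n : ℝ) ^ (k + 2)) < ((n : ℝ) ^ (c / 4)) ^ L * Real.log 2 ∧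
      ((2 : ℝ) ^ L * 2 ^ L + (L * 2 ^ L + L * 2 ^ L)) ≤ (n : ℝ) ^ c ∧
      (2 : ℝ) ^ L * 2 ^ L + L * 2 ^ L * (2 * (n : ℝ) ^ (c / 4) * (n : ℝ) ^ (c / 4) / Real.log 2) ≤ (n : ℝ) ^ c := by
    filter_upwards [t3 _ hγ, t3 1 one_pos, eventually_ge_atTop 1,
      t1.eventually_gt_atTop (1 / Real.log 2), t2.eventually_ge_atTop 1,
      t2.eventually_ge_atTop ((2 : ℝ) ^ L * 2 ^ L + (L * 2 ^ L + L * 2 ^ L)),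
      t2.eventually_ge_atTop ((2 : ℝ) ^ L * 2 ^ L + L * 2 ^ L * (2 / Real.log 2))] with n h1 h2 h3 h4 h5 h6 h7
    have hn : (1:ℝ) ≤ n := by exact_mod_cast h3
    have hn0 : (0:ℝ) < n := by linarith
    set x : ℝ := (n:ℝ) ^ (c / 4) with hx
    have hxc : (n:ℝ) ^ c = x ^ 4 := by
      rw [hx, ← Real.rpow_natCast, ← Real.rpow_mul hn0.le]
      congr 1; push_cast; ring
    refine ⟨h3, h1, ?_, ?_, ?_⟩
    · have hxL : (n:ℝ) ^ (k + 4) ≤ x ^ L := by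
        rw [hx, ← Real.rpow_natCast, ← Real.rpow_natCast (_ ^ _), ← Real.rpow_mul hn0.le]
        refine Real.rpow_le_rpow_of_exponent_le hn ?_
        push_cast; exact hL
      rw [Real.rpow_one] at h2
      have h8 : 1 < n * Real.log 2 := by
        rwa [div_lt_iff₀ hl2] at h4
      calc (n : ℝ) ^ (k + 2) * Real.log (2 * (n : ℝ) ^ (k + 2)) ≤ (n : ℝ) ^ (k + 2) * n :=
            mul_le_mul_of_nonneg_left (by linarith) (by positivity)
        _ = (n:ℝ) ^ (k + 3) * 1 := by ring
        _ < (n:ℝ) ^ (k + 3) * (n * Real.log 2) := mul_lt_mul_of_pos_left h8 (by positivity)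
        _ = (n:ℝ) ^ (k + 4) * Real.log 2 := by ring
        _ ≤ _ := mul_le_mul_of_nonneg_right hxL hl2.le
    · rw [hxc]
      exact h6.trans (le_self_pow₀ h5 (by norm_num))
    · rw [hxc]
      have hx2 : 1 ≤ x ^ 2 := one_le_pow₀ h5
      have hA : (0:ℝ) ≤ 2 ^ L * 2 ^ L := by positivity
      calc (2 : ℝ) ^ L * 2 ^ L + L * 2 ^ L * (2 * x * x / Real.log 2)
          ≤ (2 : ℝ) ^ L * 2 ^ L * x ^ 2 + L * 2 ^ L * (2 * x * x / Real.log 2) := by nlinarith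
        _ = ((2 : ℝ) ^ L * 2 ^ L + L * 2 ^ L * (2 / Real.log 2)) * x ^ 2 := by ring
        _ ≤ x * x ^ 2 := mul_le_mul_of_nonneg_right h7 (by positivity)
        _ = x ^ 3 := by ring
        _ ≤ x ^ 4 := pow_le_pow_right₀ h5 (by norm_num)
  exact eventually_atTop.1 hev

lemma pre_sdiff {V D : Type} (p : D → Option V) (S T : Set V) :
    p ⁻¹' (some '' S) \ p ⁻¹' (some '' T) = p ⁻¹' (some '' (S \ T)) := by
  rw [Set.image_sdiff (Option.some_injective V)]; rfl

/-- For every `c > 0` and integer `k ≥ 1` there is `n₀` such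
that every directed graph `G` on `n ≥ n₀` vertices and `m` edges with integer
capacities in `{1,…,n^k}` admits a DAG partial projection `D` (map
`π : V(D) → V(G) ∪ {⊥}`, nonempty fibers) with at most `m·n^c` edges and width
at most `n^c` such that for all `S, T ⊆ V(G)`:
`maxflow_G(S,T) ≤ maxflow_D(π⁻¹(S),π⁻¹(T)) ≤ n^c · maxflow_G(S,T)`. -/
theorem statement8 :
    ∀ c : ℝ, 0 < c → ∀ k : ℕ, 1 ≤ k →
    ∃ n₀ : ℕ, ∀ (VG : Type) (_ : Finite VG) (EG : VG → VG → Prop) (UG : VG → VG → ℕ),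
      n₀ ≤ Nat.card VG →
      (∀ u v, EG u v → 1 ≤ UG u v ∧ UG u v ≤ (Nat.card VG) ^ k) →
      ∃ (VD : Type) (_ : Finite VD) (ED : VD → VD → Prop) (UD : VD → VD → ℝ)
        (π : VD → Option VG),
        IsDag ED ∧
        (∀ x y, ED x y → 0 ≤ UD x y) ∧
        (∀ v : VG, (π ⁻¹' {some v}).Nonempty) ∧
        (({p : VD × VD | ED p.1 p.2}.ncard : ℝ) ≤
          ({p : VG × VG | EG p.1 p.2}.ncard : ℝ) * (Nat.card VG : ℝ) ^ c) ∧
        (∀ v : VG, ((π ⁻¹' {some v}).ncard : ℝ) ≤ (Nat.card VG : ℝ) ^ c) ∧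
        (∀ S T : Set VG,
          maxflow EG (fun u v => (UG u v : ℝ)) S T ≤
            maxflow ED UD (π ⁻¹' (some '' S)) (π ⁻¹' (some '' T)) ∧
          maxflow ED UD (π ⁻¹' (some '' S)) (π ⁻¹' (some '' T)) ≤
            (Nat.card VG : ℝ) ^ c * maxflow EG (fun u v => (UG u v : ℝ)) S T) := by
  intro c hc k _
  obtain ⟨L, hL⟩ := exists_nat_ge (((k : ℝ) + 4) / (c / 4))
  rw [div_le_iff₀ (by linarith), mul_comm] at hL
  obtain ⟨n₀, hn₀⟩ := eventually_bounds c hc k L hL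
  refine ⟨n₀, fun VG hfin EG UG hn hU => ?_⟩
  haveI : Fintype VG := Fintype.ofFinite VG
  obtain ⟨hn1, hK, hLL, hm, hf⟩ := hn₀ _ hn
  set n := Nat.card VG with hnd
  have hnR : (1:ℝ) ≤ n := by exact_mod_cast hn1
  have hl2 : 0 < Real.log 2 := Real.log_pos (by norm_num)
  set x : ℝ := (n:ℝ) ^ (c / 4) with hx
  have hx0 : 0 < x := by positivity
  have htot : tot (cE EG UG) ≤ n ^ (k + 2) := by
    have h1 : ∀ u v, cE EG UG u v ≤ n ^ k := by
      intro u v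
      unfold cE
      split_ifs with h
      · exact (hU u v h).2
      · exact Nat.zero_le _
    have h2 : tot (cE EG UG) ≤ ∑ _u : VG, ∑ _v : VG, n ^ k :=
      Finset.sum_le_sum fun u _ => Finset.sum_le_sum fun v _ => h1 u v
    refine h2.trans (le_of_eq ?_)
    simp only [Finset.sum_const, Finset.card_univ, smul_eq_mul, ← Nat.card_eq_fintype_card]
    rw [← hnd]; ring
  have htotR : (tot (cE EG UG) : ℝ) ≤ (n:ℝ) ^ (k + 2) := by exact_mod_cast htot
  have hlog : Real.log ((2 * tot (cE EG UG) : ℕ) : ℝ) ≤ Real.log (2 * (n : ℝ) ^ (k + 2)) := by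
    rcases Nat.eq_zero_or_pos (tot (cE EG UG)) with h0 | h0
    · rw [h0]
      simp only [Nat.mul_zero, Nat.cast_zero, Real.log_zero]
      refine Real.log_nonneg ?_
      have : (1:ℝ) ≤ (n:ℝ) ^ (k + 2) := one_le_pow₀ hnR
      linarith
    · have : (0:ℝ) < tot (cE EG UG) := by exact_mod_cast h0
      refine Real.log_le_log (by push_cast; linarith) (by push_cast; linarith)
  have hlog0 : 0 ≤ Real.log (2 * (n : ℝ) ^ (k + 2)) := by
    refine Real.log_nonneg ?_
    have : (1:ℝ) ≤ (n:ℝ) ^ (k + 2) := one_le_pow₀ hnR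
    linarith
  obtain ⟨q, hq1, hq2⟩ := hierarchy (cE EG UG) L x x hx0 (by linarith)
    (lt_of_le_of_lt ((mul_le_mul_of_nonneg_left hlog (by positivity)).trans
      (mul_le_mul_of_nonneg_right htotR hlog0)) hLL)
  have hUR : ∀ u v, EG u v → (0:ℝ) ≤ (fun u v => (UG u v : ℝ)) u v := fun u v _ => Nat.cast_nonneg _
  refine ⟨VDag VG L, inferInstance, EDag EG q, UDag UG (dg (cE EG UG) (rel q)), piDag,
    isDag_EDag EG q, fun a b _ => UDag_nonneg _ _ a b, fun v => ⟨Sum.inl (v, fun _ => false), rfl⟩,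
    ?_, ?_, ?_⟩
  · have h1 : (({p : VDag VG L × VDag VG L | EDag EG q p.1 p.2}.ncard : ℕ) : ℝ) ≤
        ((({p : VG × VG | EG p.1 p.2}.ncard * (2 ^ L * 2 ^ L + (L * 2 ^ L + L * 2 ^ L)) : ℕ)) : ℝ) :=
      Nat.cast_le.2 (edges_EDag EG q)
    refine h1.trans ?_
    push_cast
    exact mul_le_mul_of_nonneg_left hm (Nat.cast_nonneg _)
  · intro v
    have h1 : (((piDag (V := VG) (L := L)) ⁻¹' {some v}).ncard : ℝ) ≤ ((2 ^ L : ℕ) : ℝ) :=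
      Nat.cast_le.2 (width_EDag v)
    refine h1.trans (le_trans ?_ hm)
    push_cast
    have h2 : (1:ℝ) ≤ 2 ^ L := one_le_pow₀ (by norm_num)
    have h3 : (0:ℝ) ≤ L * 2 ^ L := by positivity
    nlinarith
  · intro S T
    rw [maxflow_sdiff EG, maxflow_sdiff (EDag EG q), pre_sdiff, pre_sdiff]
    have hdis : ∀ v ∈ T \ S, v ∉ S \ T := fun v h h' => h.2 h'.1
    generalize S \ T = S' at hdis ⊢
    generalize T \ S = T' at hdis ⊢
    constructor
    · obtain ⟨Y, hY1, hY2, hY3⟩ := exists_min_cut (E := EDag EG q)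
        (U := UDag UG (dg (cE EG UG) (rel q)))
        (S := piDag ⁻¹' (some '' S')) (T := piDag ⁻¹' (some '' T'))
        (fun a b _ => UDag_nonneg _ _ a b) (by
          rintro a ⟨v, hv, hva⟩ ⟨w, hw, hwa⟩
          have : w = v := Option.some_injective _ (hwa.trans hva.symm)
          subst this
          exact hdis w hv hw)
      obtain ⟨X, hX1, hX2, hX3⟩ := lower_cut hq1 (fun u v h => (hU u v h).1) (S := S') (T := T') Y
        (fun v hv b => hY1 ⟨v, hv, rfl⟩) (fun v hv b => hY2 _ ⟨v, hv, rfl⟩)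
      exact (maxflow_le_cut hUR hX1 hX2).trans (hX3.trans hY3)
    · obtain ⟨X, hX1, hX2, hX3⟩ := exists_min_cut (E := EG) (U := fun u v => (UG u v : ℝ))
        (S := S') (T := T') hUR hdis
      obtain ⟨Y, hY1, hY2⟩ := upper_cut (E := EG) (U := UG) (q := q) (B := 2 * x * x / Real.log 2) X (by
        intro i
        rw [div_mul_eq_mul_div, le_div_iff₀ hl2, mul_comm]
        exact hq2 i X)
      have h1 : maxflow (EDag EG q) (UDag UG (dg (cE EG UG) (rel q)))
          (piDag ⁻¹' (some '' S')) (piDag ⁻¹' (some '' T')) ≤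
          cutcap (EDag EG q) (UDag UG (dg (cE EG UG) (rel q))) Y := by
        refine maxflow_le_cut (fun a b _ => UDag_nonneg _ _ a b) ?_ ?_
        · rintro (⟨v, b⟩ | s) ⟨w, hw, hwa⟩
          · obtain rfl : w = v := Option.some_injective _ hwa
            exact (hY1 w b).2 (hX1 hw)
          · cases hwa
        · rintro (⟨v, b⟩ | s) ⟨w, hw, hwa⟩
          · obtain rfl : w = v := Option.some_injective _ hwa
            exact fun h => hX2 w hw ((hY1 w b).1 h)
          · cases hwa
      have h0 : 0 ≤ cutcap EG (fun u v => (UG u v : ℝ)) X := by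
        rw [cutcap_eq_ccut]; exact Nat.cast_nonneg _
      refine h1.trans (hY2.trans ((mul_le_mul_of_nonneg_right hf h0).trans
        (mul_le_mul_of_nonneg_left hX3 (by positivity))))
end
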